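/- arXiv:2001.01322 — 2 statements merged into one kernel-verified Lean document; each statement's English description precedes it below -/
import Mathlib

section
/- (Alessandrini–Nesi) Let γ : ∂𝔹 → ∂Ω be an orientation-preserving diffeomorphism of class C¹ of the unit circle onto a simple closed curve Γ = ∂Ω enclosing a bounded set Ω ⊂ ℝ², and let φ ∈ C²(𝔹, ℝ²) ∩ C¹(cl(𝔹), ℝ²) be the harmonic extension of γ (the solution of Δφ = 0 in 𝔹 with φ = γ on ∂𝔹). Then φ is a diffeomorphism of cl(𝔹) onto cl(Ω) if and only if det Dφ > 0 everywhere on ∂𝔹. -/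
noncomputable section

open Set Metric Filter

/-- Euclidean dot product of two complex numbers viewed as vectors in ℝ². -/
def dotC (u v : ℂ) : ℝ := u.re * v.re + u.im * v.im

/-- Clockwise rotation by π/2 of a planar vector (identified with ℂ):
`(x, y)^⊥ = (y, -x)`. -/
def perpC (z : ℂ) : ℂ := -Complex.I * z

/-- Cross product (2×2 determinant) of two planar vectors. -/
def crossC (u v : ℂ) : ℝ := u.re * v.im - u.im * v.re

/-- The Laplacian of a function `f : ℂ → ℝ` (ℂ is identified with ℝ²),
as the sum of the second derivatives in the two coordinate directions. -/
def lap2 (f : ℂ → ℝ) (z : ℂ) : ℝ :=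
  fderiv ℝ (fun w => fderiv ℝ f w 1) z 1 +
  fderiv ℝ (fun w => fderiv ℝ f w Complex.I) z Complex.I

/-- `φ : ℂ → ℂ` is harmonic (componentwise, Δφ = 0) on the set `s`. -/
def HarmonicOn2 (φ : ℂ → ℂ) (s : Set ℂ) : Prop :=
  ∀ z ∈ s, lap2 (fun w => (φ w).re) z = 0 ∧ lap2 (fun w => (φ w).im) z = 0

/-- The point `e^{iθ}` of the unit circle ∂𝔹. -/
def cpt (θ : ℝ) : ℂ := Complex.exp (θ * Complex.I)

/-- The Jacobian determinant `det Dφ` of `φ : ℂ → ℂ` (ℂ identified with ℝ²) at `z`, using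
derivatives within the set `s` (so that it makes sense up to the boundary of `s`). -/
def jacDetWithin (φ : ℂ → ℂ) (s : Set ℂ) (z : ℂ) : ℝ :=
  crossC (fderivWithin ℝ φ s z 1) (fderivWithin ℝ φ s z Complex.I)

/-- A nowhere vanishing continuous function on a simply connected space has a continuous
logarithm. -/
theorem exists_continuous_exp_eq {X : Type*} [TopologicalSpace X] [SimplyConnectedSpace X]
    [LocallyPathConnectedSpace X] {f : X → ℂ} (hf : Continuous f) (h0 : ∀ x, f x ≠ 0) :
    ∃ L : X → ℂ, Continuous L ∧ ∀ x, Complex.exp (L x) = f x := by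
  obtain ⟨x₀⟩ : Nonempty X := inferInstance
  obtain ⟨L, ⟨-, hL⟩, -⟩ := Complex.isCoveringMapOn_exp.existsUnique_continuousMap_lifts
    (f := ⟨f, hf⟩) (a₀ := x₀) (e₀ := Complex.log (f x₀)) (Complex.exp_log (h0 x₀))
    (fun x => h0 x)
  exact ⟨L, L.continuous, fun x => congrFun hL x⟩

/-- Two continuous logarithms of the same function agreeing at a point are equal. -/
theorem eq_of_exp_eq {X : Type*} [TopologicalSpace X] [PreconnectedSpace X] {f g : X → ℂ}
    (hf : Continuous f) (hg : Continuous g) (h : ∀ x, Complex.exp (f x) = Complex.exp (g x))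
    {a : X} (ha : f a = g a) (x : X) : f x = g x := by
  refine congrFun (Complex.isCoveringMap_exp.eq_of_comp_eq hf hg ?_ a ha) x
  ext y
  exact h y

theorem cpt_add_two_pi (θ : ℝ) : cpt (θ + 2 * Real.pi) = cpt θ := by
  unfold cpt
  rw [Complex.exp_eq_exp_iff_exists_int]
  exact ⟨1, by push_cast; ring⟩

theorem continuous_cpt : Continuous cpt := by unfold cpt; fun_prop

theorem norm_cpt (θ : ℝ) : ‖cpt θ‖ = 1 := Complex.norm_exp_ofReal_mul_I θ

theorem cpt_ne_zero (θ : ℝ) : cpt θ ≠ 0 := Complex.exp_ne_zero _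

theorem cpt_mem_closedBall (θ : ℝ) : cpt θ ∈ closedBall (0 : ℂ) 1 := by simp [norm_cpt]

theorem exists_cpt_eq {z : ℂ} (hz : ‖z‖ = 1) : ∃ θ, cpt θ = z :=
  ⟨z.arg, by simpa [hz, cpt] using Complex.norm_mul_exp_arg_mul_I z⟩

/-- A bounded open set disjoint from a closed topological disk, with frontier contained in that
disk, is empty. -/
theorem eq_empty_of_frontier_subset_image {φ : ℂ → ℂ} {W : Set ℂ}
    (hφ : ContinuousOn φ (closedBall 0 1)) (hinj : InjOn φ (closedBall 0 1))
    (hW : Bornology.IsBounded W) (hdisj : Disjoint W (φ '' closedBall 0 1))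
    (hfr : frontier W ⊆ φ '' closedBall 0 1) : W = ∅ := by
  by_contra hne
  obtain ⟨a, ha⟩ := nonempty_iff_ne_empty.2 hne
  have hr : ∀ z : ℂ, ((max 1 ‖z‖ : ℝ)⁻¹ : ℂ) * z ∈ closedBall (0 : ℂ) 1 := by
    intro z
    have h1 : 0 < max 1 ‖z‖ := lt_max_of_lt_left one_pos
    rw [mem_closedBall_zero_iff, norm_mul, norm_inv, Complex.norm_real, Real.norm_of_nonneg h1.le,
      inv_mul_le_one₀ h1]
    exact le_max_right _ _
  have hrc : Continuous fun z : ℂ => ((max 1 ‖z‖ : ℝ)⁻¹ : ℂ) * z := by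
    refine Continuous.mul (Continuous.inv₀ (by fun_prop) fun z => ?_) continuous_id
    exact_mod_cast (lt_max_of_lt_left one_pos : 0 < max 1 ‖z‖).ne'
  have hr1 : ∀ z ∈ closedBall (0 : ℂ) 1, ((max 1 ‖z‖ : ℝ)⁻¹ : ℂ) * z = z := by
    intro z hz
    rw [mem_closedBall_zero_iff] at hz
    simp [max_eq_left hz]
  have himg : ∀ z ∈ closedBall (0 : ℂ) 1, φ z - a ≠ 0 := fun z hz h =>
    disjoint_left.1 hdisj ha ⟨z, hz, sub_eq_zero.1 h⟩
  obtain ⟨M, hMc, hM⟩ := exists_continuous_exp_eq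
    (f := fun z : ℂ => φ (((max 1 ‖z‖ : ℝ)⁻¹ : ℂ) * z) - a)
    ((hφ.comp_continuous hrc hr).sub continuous_const) fun z => himg _ (hr z)
  have : CompactSpace (closedBall (0 : ℂ) 1) :=
    isCompact_iff_compactSpace.1 (isCompact_closedBall 0 1)
  have hemb : Topology.IsClosedEmbedding ((closedBall (0 : ℂ) 1).domRestrict φ) :=
    hφ.domRestrict.isClosedEmbedding (injOn_iff_injective.1 hinj)
  obtain ⟨L, hL⟩ := ContinuousMap.exists_extension hemb
    (⟨fun z => M z, hMc.comp continuous_subtype_val⟩ : C(closedBall (0 : ℂ) 1, ℂ))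
  have hL' : ∀ z ∈ closedBall (0 : ℂ) 1, Complex.exp (L (φ z)) = φ z - a := by
    intro z hz
    have h1 : L (φ z) = M z := DFunLike.congr_fun hL ⟨z, hz⟩
    have h2 := hM z
    simp only [hr1 z hz] at h2
    rw [h1, h2]
  classical
  have hhc : Continuous fun z => if z ∈ W then Complex.exp (L z) else z - a := by
    refine Continuous.if (fun p hp => ?_) (by fun_prop) (by fun_prop)
    obtain ⟨z, hz, rfl⟩ := hfr hp
    exact hL' z hz
  obtain ⟨N, hNc, hN⟩ := exists_continuous_exp_eq hhc fun z => by
    split_ifs with h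
    · exact Complex.exp_ne_zero _
    · exact fun h' => h (sub_eq_zero.1 h' ▸ ha)
  obtain ⟨R, hR⟩ := hW.subset_ball a
  have hR0 : 0 < R := dist_nonneg.trans_lt (mem_ball.1 (hR ha))
  have hcirc : ∀ θ : ℝ, Complex.exp (N (a + R * cpt θ)) = R * cpt θ := by
    intro θ
    rw [hN, if_neg, add_sub_cancel_left]
    intro h
    have := hR h
    simp [norm_cpt, abs_of_pos hR0] at this
  have key := eq_of_exp_eq (f := fun θ : ℝ => N (a + R * cpt θ))
    (g := fun θ : ℝ => θ * Complex.I + N (a + R * cpt 0)) (a := 0)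
    (by have := continuous_cpt; fun_prop) (by fun_prop)
    (fun θ => by rw [hcirc, Complex.exp_add, hcirc]; simp [cpt]; ring) (by simp) (0 + 2 * Real.pi)
  simp only [cpt_add_two_pi] at key
  simp [Real.pi_ne_zero] at key

/-- The mean of `deriv γ` on the segment from `θ` to `θ + t`. -/
def meanDeriv (γ : ℝ → ℂ) (θ t : ℝ) : ℂ := ∫ s in (0 : ℝ)..1, deriv γ (θ + s * t)

theorem mul_meanDeriv {γ : ℝ → ℂ} (hγ : ContDiff ℝ 1 γ) (θ t : ℝ) :
    t * meanDeriv γ θ t = γ (θ + t) - γ θ := by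
  have hd : ∀ s : ℝ, HasDerivAt (fun s => γ (θ + s * t)) (t * deriv γ (θ + s * t)) s := by
    intro s
    have h1 := (hγ.differentiable one_ne_zero (θ + s * t)).hasDerivAt
    have h2 : HasDerivAt (fun s : ℝ => θ + s * t) t s := by
      simpa using ((hasDerivAt_id s).mul_const t).const_add θ
    simpa [Function.comp_def] using h1.scomp s h2
  have hc : Continuous fun s : ℝ => (t : ℂ) * deriv γ (θ + s * t) := by
    have := hγ.continuous_deriv le_rfl
    fun_prop
  have := intervalIntegral.integral_eq_sub_of_hasDerivAt (fun s _ => hd s)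
    (hc.intervalIntegrable 0 1)
  rw [intervalIntegral.integral_const_mul] at this
  simpa [meanDeriv] using this

theorem continuous_meanDeriv {γ : ℝ → ℂ} (hγ : ContDiff ℝ 1 γ) :
    Continuous fun p : ℝ × ℝ => meanDeriv γ p.1 p.2 := by
  unfold meanDeriv
  refine intervalIntegral.continuous_parametric_intervalIntegral_of_continuous' ?_ 0 1
  have := hγ.continuous_deriv le_rfl
  fun_prop

@[simp]
theorem meanDeriv_zero (γ : ℝ → ℂ) (θ : ℝ) : meanDeriv γ θ 0 = deriv γ θ := by
  simp [meanDeriv]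

/-- The chord `γ (θ + t) - γ θ` divided by `t * (2 * π - t)`, extended continuously to
`t = 0` and `t = 2 * π`. -/
def normalizedChord (γ : ℝ → ℂ) (p : ℝ × ℝ) : ℂ :=
  if p.2 ≤ Real.pi then
    meanDeriv γ p.1 (max 0 (min p.2 Real.pi)) / (2 * Real.pi - max 0 (min p.2 Real.pi) : ℝ)
  else
    -meanDeriv γ p.1 (max Real.pi (min p.2 (2 * Real.pi)) - 2 * Real.pi) /
      (max Real.pi (min p.2 (2 * Real.pi)) : ℝ)

section Turning

variable {γ : ℝ → ℂ}

theorem normalizedChord_zero (θ : ℝ) :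
    normalizedChord γ (θ, 0) = deriv γ θ / (2 * Real.pi : ℝ) := by
  simp [normalizedChord, Real.pi_pos.le]

theorem normalizedChord_two_pi (θ : ℝ) :
    normalizedChord γ (θ, 2 * Real.pi) = -(deriv γ θ / (2 * Real.pi : ℝ)) := by
  have h : ¬ 2 * Real.pi ≤ Real.pi := by linarith [Real.pi_pos]
  have h' : max Real.pi (2 * Real.pi) = 2 * Real.pi := max_eq_right (by linarith [Real.pi_pos])
  simp only [normalizedChord, if_neg h, min_self, h', sub_self, meanDeriv_zero, neg_div]

theorem mul_meanDeriv_sub_two_pi (hγ : ContDiff ℝ 1 γ)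
    (hper : ∀ θ, γ (θ + 2 * Real.pi) = γ θ) (θ t : ℝ) :
    ((t - 2 * Real.pi : ℝ) : ℂ) * meanDeriv γ θ (t - 2 * Real.pi) = γ (θ + t) - γ θ := by
  have hp : ∀ x, deriv γ (x + 2 * Real.pi) = deriv γ x := fun x => by
    rw [← deriv_comp_add_const, funext hper]
  have h1 : meanDeriv γ (θ + 2 * Real.pi) (t - 2 * Real.pi) =
      meanDeriv γ θ (t - 2 * Real.pi) := by
    refine intervalIntegral.integral_congr fun s _ => ?_
    rw [← hp (θ + s * (t - 2 * Real.pi))]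
    congr 1
    ring
  rw [← h1, mul_meanDeriv hγ, hper]
  congr 2
  ring

theorem mul_normalizedChord (hγ : ContDiff ℝ 1 γ) (hper : ∀ θ, γ (θ + 2 * Real.pi) = γ θ)
    (θ : ℝ) {t : ℝ} (ht : t ∈ Icc 0 (2 * Real.pi)) :
    ((t * (2 * Real.pi - t) : ℝ) : ℂ) * normalizedChord γ (θ, t) = γ (θ + t) - γ θ := by
  have hpi := Real.pi_pos
  by_cases h : t ≤ Real.pi
  · have h1 : (((2 * Real.pi - t : ℝ)) : ℂ) ≠ 0 := by
      exact_mod_cast (by linarith : 0 < 2 * Real.pi - t).ne'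
    simp only [normalizedChord, if_pos h, min_eq_left h, max_eq_right ht.1]
    rw [← mul_meanDeriv hγ]
    push_cast at h1 ⊢
    field_simp
  · have h0 : 0 < t := by linarith
    have h1 : (t : ℂ) ≠ 0 := by exact_mod_cast h0.ne'
    simp only [normalizedChord, if_neg h, min_eq_left ht.2, max_eq_right (not_le.1 h).le]
    have h2 := mul_meanDeriv_sub_two_pi hγ hper θ t
    rw [← h2]
    push_cast
    field_simp
    ring

theorem continuous_normalizedChord (hγ : ContDiff ℝ 1 γ)
    (hper : ∀ θ, γ (θ + 2 * Real.pi) = γ θ) : Continuous (normalizedChord γ) := by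
  have hpi := Real.pi_pos
  have hD := continuous_meanDeriv hγ
  have key : ∀ p : ℝ × ℝ, p.2 = Real.pi →
      meanDeriv γ p.1 (max 0 (min p.2 Real.pi)) / (2 * Real.pi - max 0 (min p.2 Real.pi) : ℝ) =
      -meanDeriv γ p.1 (max Real.pi (min p.2 (2 * Real.pi)) - 2 * Real.pi) /
        (max Real.pi (min p.2 (2 * Real.pi)) : ℝ) := by
    rintro ⟨θ, t⟩ (rfl : t = Real.pi)
    have h1 := mul_meanDeriv hγ θ Real.pi
    rw [← mul_meanDeriv_sub_two_pi hγ hper,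
      show Real.pi - 2 * Real.pi = -Real.pi by ring, Complex.ofReal_neg, neg_mul, ← mul_neg] at h1
    have h2 := mul_left_cancel₀ (Complex.ofReal_ne_zero.2 hpi.ne') h1
    have h3 : min Real.pi (2 * Real.pi) = Real.pi := min_eq_left (by linarith)
    simp only [min_self, max_eq_right hpi.le, h3, h2, max_self,
      show Real.pi - 2 * Real.pi = -Real.pi by ring, show 2 * Real.pi - Real.pi = Real.pi by ring]
  refine Continuous.if_le ?_ ?_ continuous_snd continuous_const key
  · refine Continuous.div (hD.comp (by fun_prop : Continuous fun p : ℝ × ℝ =>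
      (p.1, max 0 (min p.2 Real.pi)))) (by fun_prop) fun p => ?_
    have : max 0 (min p.2 Real.pi) ≤ Real.pi := max_le hpi.le (min_le_right _ _)
    exact_mod_cast (by linarith : 0 < 2 * Real.pi - max 0 (min p.2 Real.pi)).ne'
  · refine Continuous.div (hD.comp (by fun_prop : Continuous fun p : ℝ × ℝ =>
      (p.1, max Real.pi (min p.2 (2 * Real.pi)) - 2 * Real.pi))).neg (by fun_prop) fun p => ?_
    exact_mod_cast (lt_max_of_lt_left hpi).ne'

theorem exists_int_of_eq (hper : ∀ θ, γ (θ + 2 * Real.pi) = γ θ)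
    (hinj : InjOn γ (Ico 0 (2 * Real.pi))) {a b : ℝ} (h : γ a = γ b) :
    ∃ n : ℤ, b = a + n * (2 * Real.pi) := by
  have hP : Function.Periodic γ (2 * Real.pi) := hper
  have h1 : ∀ x, γ (toIcoMod Real.two_pi_pos 0 x) = γ x := fun x => by
    rw [toIcoMod, hP.sub_zsmul_eq]
  have hm : ∀ x, toIcoMod Real.two_pi_pos 0 x ∈ Ico 0 (2 * Real.pi) := fun x => by
    simpa using toIcoMod_mem_Ico Real.two_pi_pos 0 x
  have h2 := hinj (hm a) (hm b) (by rw [h1, h1, h])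
  obtain ⟨n, hn⟩ := AddCommGroup.modEq_iff_eq_add_zsmul.1 ((toIcoMod_inj _).1 h2)
  refine ⟨n, ?_⟩
  simp only [zsmul_eq_mul] at hn
  linarith

theorem normalizedChord_ne_zero (hγ : ContDiff ℝ 1 γ)
    (hper : ∀ θ, γ (θ + 2 * Real.pi) = γ θ) (hinj : InjOn γ (Ico 0 (2 * Real.pi)))
    (h0 : ∀ θ, deriv γ θ ≠ 0) (p : ℝ × ℝ) : normalizedChord γ p ≠ 0 := by
  have hpi := Real.pi_pos
  have hpi' : ((2 * Real.pi : ℝ) : ℂ) ≠ 0 := Complex.ofReal_ne_zero.2 (by positivity)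
  obtain ⟨θ, t⟩ := p
  rcases le_or_gt t 0 with h1 | h1
  · have : normalizedChord γ (θ, t) = normalizedChord γ (θ, 0) := by
      have h2 : t ≤ Real.pi := by linarith
      simp [normalizedChord, h2, h1, hpi.le]
    rw [this, normalizedChord_zero]
    exact div_ne_zero (h0 θ) hpi'
  rcases le_or_gt (2 * Real.pi) t with h2 | h2
  · have : normalizedChord γ (θ, t) = normalizedChord γ (θ, 2 * Real.pi) := by
      have h3 : ¬ t ≤ Real.pi := by linarith
      have h4 : ¬ 2 * Real.pi ≤ Real.pi := by linarith
      simp [normalizedChord, h3, h4, h2]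
    rw [this, normalizedChord_two_pi]
    exact neg_ne_zero.2 (div_ne_zero (h0 θ) hpi')
  · intro h
    have h3 := mul_normalizedChord hγ hper θ ⟨h1.le, h2.le⟩
    rw [h, mul_zero, eq_comm, sub_eq_zero] at h3
    obtain ⟨n, hn⟩ := exists_int_of_eq hper hinj h3
    have h4 : t = -n * (2 * Real.pi) := by linarith
    have h5 : (0 : ℝ) < ((-n : ℤ) : ℝ) := by push_cast; nlinarith
    have h6 : ((-n : ℤ) : ℝ) < ((1 : ℤ) : ℝ) := by push_cast; nlinarith
    have h7 : (0 : ℤ) < -n := by exact_mod_cast h5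
    have h8 : -n < 1 := by exact_mod_cast h6
    omega

theorem normalizedChord_symm (hγ : ContDiff ℝ 1 γ)
    (hper : ∀ θ, γ (θ + 2 * Real.pi) = γ θ) (θ : ℝ) {t : ℝ} (ht : t ∈ Icc 0 (2 * Real.pi)) :
    normalizedChord γ (θ + t, 2 * Real.pi - t) = -normalizedChord γ (θ, t) := by
  have hp : ∀ x, deriv γ (x + 2 * Real.pi) = deriv γ x := fun x => by
    rw [← deriv_comp_add_const, funext hper]
  rcases ht.1.eq_or_lt with rfl | h1
  · rw [sub_zero, normalizedChord_two_pi, normalizedChord_zero, add_zero]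
  rcases ht.2.eq_or_lt with rfl | h2
  · rw [sub_self, normalizedChord_two_pi, normalizedChord_zero, neg_neg, hp]
  · have h3 := mul_normalizedChord hγ hper θ ht
    have h4 := mul_normalizedChord hγ hper (θ + t) (t := 2 * Real.pi - t)
      ⟨by linarith, by linarith⟩
    rw [show θ + t + (2 * Real.pi - t) = θ + 2 * Real.pi by ring, hper,
      show (2 * Real.pi - t) * (2 * Real.pi - (2 * Real.pi - t)) = t * (2 * Real.pi - t) by ring,
      ← neg_sub (γ _), ← h3, ← mul_neg] at h4
    refine mul_left_cancel₀ (Complex.ofReal_ne_zero.2 ?_) h4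
    exact (mul_pos h1 (by linarith)).ne'

theorem exists_isMinOn_im (hγ : ContDiff ℝ 1 γ) (hper : ∀ θ, γ (θ + 2 * Real.pi) = γ θ) :
    ∃ θ₀, ∀ θ, (γ θ₀).im ≤ (γ θ).im := by
  obtain ⟨θ₀, -, h⟩ := isCompact_Icc.exists_isMinOn (nonempty_Icc.2 Real.two_pi_pos.le)
    (Complex.continuous_im.comp hγ.continuous).continuousOn
  refine ⟨θ₀, fun θ => ?_⟩
  obtain ⟨y, hy, hy'⟩ := Function.Periodic.exists_mem_Ico₀ (f := γ) hper Real.two_pi_pos θ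
  rw [hy']
  exact h (Ico_subset_Icc_self hy)

/-- **Hopf's Umlaufsatz**: the tangent of a simple closed `C¹` curve has turning number `±1`. -/
theorem turning_number_simple_closed (hγ : ContDiff ℝ 1 γ)
    (hper : ∀ θ, γ (θ + 2 * Real.pi) = γ θ) (hinj : InjOn γ (Ico 0 (2 * Real.pi)))
    (h0 : ∀ θ, deriv γ θ ≠ 0) :
    ∃ L : ℝ → ℂ, Continuous L ∧ (∀ θ, Complex.exp (L θ) = deriv γ θ) ∧
      ∃ k : ℤ, (k = 1 ∨ k = -1) ∧
        ∀ θ, L (θ + 2 * Real.pi) = L θ + k * (2 * Real.pi * Complex.I) := by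
  have hpi := Real.pi_pos
  have hpi' : ((2 * Real.pi : ℝ) : ℂ) ≠ 0 := Complex.ofReal_ne_zero.2 (by positivity)
  have hconn : PreconnectedSpace (Icc 0 (2 * Real.pi)) :=
    Subtype.preconnectedSpace isPreconnected_Icc
  have hz : (0 : ℝ) ∈ Icc 0 (2 * Real.pi) := ⟨le_rfl, by positivity⟩
  have hp : 2 * Real.pi ∈ Icc 0 (2 * Real.pi) := ⟨by positivity, le_rfl⟩
  have hFc := continuous_normalizedChord hγ hper
  have hF0 := normalizedChord_ne_zero hγ hper hinj h0
  obtain ⟨Φ, hΦc, hΦ⟩ := exists_continuous_exp_eq hFc hF0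
  have hdouble : ∀ θ, Φ (θ + 2 * Real.pi, 0) =
      Φ (θ, 2 * Real.pi) + (Φ (θ, 2 * Real.pi) - Φ (θ, 0)) := by
    intro θ
    have := eq_of_exp_eq (X := Icc 0 (2 * Real.pi)) (a := ⟨0, hz⟩)
      (f := fun t => Φ (θ + t, 2 * Real.pi - t))
      (g := fun t => Φ (θ, t) + (Φ (θ, 2 * Real.pi) - Φ (θ, 0))) (by fun_prop) (by fun_prop)
      (fun t => by
        rw [Complex.exp_add, Complex.exp_sub]
        simp only [hΦ]
        rw [normalizedChord_symm hγ hper θ t.2, normalizedChord_two_pi, normalizedChord_zero,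
          neg_div, div_self (div_ne_zero (h0 θ) hpi'), mul_neg_one]) (by simp) ⟨_, hp⟩
    simpa using this
  have hconst : ∀ θ₀ θ, Φ (θ, 2 * Real.pi) = Φ (θ, 0) + (Φ (θ₀, 2 * Real.pi) - Φ (θ₀, 0)) := by
    intro θ₀ θ
    refine eq_of_exp_eq (f := fun θ => Φ (θ, 2 * Real.pi))
      (g := fun θ => Φ (θ, 0) + (Φ (θ₀, 2 * Real.pi) - Φ (θ₀, 0))) (a := θ₀) (by fun_prop)
      (by fun_prop) (fun θ => ?_) (by simp) θ
    rw [Complex.exp_add, Complex.exp_sub]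
    simp only [hΦ]
    rw [normalizedChord_two_pi, normalizedChord_zero, normalizedChord_two_pi,
      normalizedChord_zero, neg_div, div_self (div_ne_zero (h0 θ₀) hpi'), mul_neg_one]
  obtain ⟨θ₀, hmin⟩ := exists_isMinOn_im hγ hper
  have him : (deriv γ θ₀).im = 0 := by
    have h1 : HasDerivAt (fun θ => (γ θ).im) (deriv γ θ₀).im θ₀ :=
      Complex.imCLM.hasFDerivAt.comp_hasDerivAt θ₀
        (hγ.differentiable one_ne_zero θ₀).hasDerivAt
    have h2 : IsLocalMin (fun θ => (γ θ).im) θ₀ := Eventually.of_forall hmin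
    exact h2.hasDerivAt_eq_zero h1
  obtain ⟨x, hx⟩ : ∃ x : ℝ, deriv γ θ₀ / (2 * Real.pi : ℝ) = x := by
    refine ⟨(deriv γ θ₀ / (2 * Real.pi : ℝ)).re, Complex.ext rfl ?_⟩
    rw [Complex.div_ofReal_im, him, zero_div, Complex.ofReal_im]
  have hx0 : x ≠ 0 := by
    rintro rfl
    rw [Complex.ofReal_zero] at hx
    exact div_ne_zero (h0 θ₀) hpi' hx
  have hFim : ∀ t ∈ Icc 0 (2 * Real.pi), 0 ≤ (normalizedChord γ (θ₀, t)).im := by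
    intro t ht
    rcases ht.1.eq_or_lt with rfl | h1
    · rw [normalizedChord_zero, hx, Complex.ofReal_im]
    rcases ht.2.eq_or_lt with rfl | h2
    · rw [normalizedChord_two_pi, hx, Complex.neg_im, Complex.ofReal_im, neg_zero]
    have h3 := congrArg Complex.im (mul_normalizedChord hγ hper θ₀ ht)
    rw [Complex.im_ofReal_mul, Complex.sub_im] at h3
    have h4 : 0 < t * (2 * Real.pi - t) := mul_pos h1 (by linarith)
    have h5 := hmin (θ₀ + t)
    exact nonneg_of_mul_nonneg_right (by linarith) h4
  have hslit : ∀ t ∈ Icc 0 (2 * Real.pi),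
      -Complex.I * normalizedChord γ (θ₀, t) ∈ Complex.slitPlane := by
    intro t ht
    have h1 := hFim t ht
    have h2 := hF0 (θ₀, t)
    rw [Complex.mem_slitPlane_iff]
    simp only [Complex.mul_re, Complex.mul_im, Complex.neg_re, Complex.neg_im, Complex.I_re,
      Complex.I_im, zero_mul, neg_mul, one_mul, zero_add, ne_eq,
      neg_eq_zero, zero_sub, neg_neg]
    by_contra! hcon
    exact h2 (Complex.ext (by simpa using hcon.2) (le_antisymm hcon.1 h1))
  have hlog := eq_of_exp_eq (X := Icc 0 (2 * Real.pi)) (a := ⟨0, hz⟩)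
      (f := fun t => Φ (θ₀, t))
      (g := fun t => Complex.log (-Complex.I * normalizedChord γ (θ₀, t)) +
        (Φ (θ₀, 0) - Complex.log (-Complex.I * normalizedChord γ (θ₀, 0)))) (by fun_prop)
      (((by fun_prop : Continuous fun t : Icc 0 (2 * Real.pi) =>
        -Complex.I * normalizedChord γ (θ₀, t)).clog fun t => hslit t t.2).add continuous_const)
      (fun t => by
        rw [Complex.exp_add, Complex.exp_sub, hΦ, hΦ,
          Complex.exp_log (Complex.slitPlane_ne_zero (hslit t t.2)),
          Complex.exp_log (Complex.slitPlane_ne_zero (hslit 0 hz))]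
        have := hF0 (θ₀, 0)
        field_simp) (by simp) ⟨_, hp⟩
  simp only [normalizedChord_two_pi, normalizedChord_zero, hx] at hlog
  have hk : ∃ k : ℤ, (k = 1 ∨ k = -1) ∧
      Complex.log (-Complex.I * -(x : ℂ)) - Complex.log (-Complex.I * x) =
        k * (Real.pi * Complex.I) := by
    rcases lt_or_gt_of_ne hx0 with h | h
    · refine ⟨-1, Or.inr rfl, ?_⟩
      have h' : 0 < -x := by linarith
      rw [show -Complex.I * -(x : ℂ) = ((-x : ℝ) : ℂ) * -Complex.I by push_cast; ring,
        show -Complex.I * (x : ℂ) = ((-x : ℝ) : ℂ) * Complex.I by push_cast; ring,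
        Complex.log_ofReal_mul h' (neg_ne_zero.2 Complex.I_ne_zero),
        Complex.log_ofReal_mul h' Complex.I_ne_zero, Complex.log_I, Complex.log_neg_I]
      push_cast
      ring
    · refine ⟨1, Or.inl rfl, ?_⟩
      rw [show -Complex.I * -(x : ℂ) = (x : ℂ) * Complex.I by ring, mul_comm (-Complex.I),
        Complex.log_ofReal_mul h (neg_ne_zero.2 Complex.I_ne_zero),
        Complex.log_ofReal_mul h Complex.I_ne_zero, Complex.log_I, Complex.log_neg_I]
      push_cast
      ring
  obtain ⟨k, hk1, hk⟩ := hk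
  refine ⟨fun θ => Φ (θ, 0) + Real.log (2 * Real.pi), by fun_prop, fun θ => ?_, k, hk1,
    fun θ => ?_⟩
  · rw [Complex.exp_add, hΦ, normalizedChord_zero, ← Complex.ofReal_exp,
      Real.exp_log (by positivity), div_mul_cancel₀ _ hpi']
  · have h1 := hdouble θ
    have h2 := hconst θ₀ θ
    linear_combination h1 + 2 * h2 + 2 * hlog + 2 * hk

end Turning

section Holomorphic

theorem norm_lt_one_of_norm_lt_one_on_circle {f : ℂ → ℂ} (hf : DiffContOnCl ℂ f (ball 0 1))
    (hb : ∀ θ, ‖f (cpt θ)‖ < 1) {z : ℂ} (hz : z ∈ ball (0 : ℂ) 1) : ‖f z‖ < 1 := by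
  obtain ⟨w, hw, hmax⟩ := Complex.exists_mem_frontier_isMaxOn_norm isBounded_ball ⟨z, hz⟩ hf
  rw [frontier_ball _ one_ne_zero, mem_sphere_zero_iff_norm] at hw
  obtain ⟨θ, rfl⟩ := exists_cpt_eq hw
  exact (hmax (subset_closure hz)).trans_lt (hb θ)

/-- Uniform approximation of continuous functions on the circle by sums of a polynomial in `z`
and a polynomial in `conj z`. -/
theorem exists_differentiable_approx {q : ℝ → ℂ} (hq : Continuous q)
    (hper : ∀ θ, q (θ + 2 * Real.pi) = q θ) :
    ∃ A B : ℂ → ℂ, Differentiable ℂ A ∧ Differentiable ℂ B ∧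
      ∀ θ, ‖q θ - (A (cpt θ) + starRingEnd ℂ (B (cpt θ)))‖ < 1 := by
  have hT : Fact (0 < 2 * Real.pi) := ⟨Real.two_pi_pos⟩
  have hP : Function.Periodic q (2 * Real.pi) := hper
  let Q : C(AddCircle (2 * Real.pi), ℂ) :=
    ⟨hP.lift, continuous_coinduced_dom.2 hq⟩
  have hQ : Q ∈ (Submodule.span ℂ (range (@fourier (2 * Real.pi)))).topologicalClosure := by
    rw [span_fourier_closure_eq_top]
    trivial
  obtain ⟨p, hp, hpQ⟩ := Metric.mem_closure_iff.1 hQ 1 one_pos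
  have key : ∃ A B : ℂ → ℂ, Differentiable ℂ A ∧ Differentiable ℂ B ∧
      ∀ θ : ℝ, p θ = A (cpt θ) + starRingEnd ℂ (B (cpt θ)) := by
    clear hpQ
    refine Submodule.span_induction (p := fun (p : C(AddCircle (2 * Real.pi), ℂ)) _ =>
      ∃ A B : ℂ → ℂ, Differentiable ℂ A ∧ Differentiable ℂ B ∧
      ∀ θ : ℝ, p θ = A (cpt θ) + starRingEnd ℂ (B (cpt θ))) ?_ ?_ ?_ ?_ hp
    · rintro _ ⟨n, rfl⟩
      have hn : ∀ θ : ℝ, fourier n (θ : AddCircle (2 * Real.pi)) = cpt θ ^ n := by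
        intro θ
        rw [fourier_coe_apply, cpt, ← Complex.exp_int_mul]
        congr 1
        have : (Real.pi : ℂ) ≠ 0 := Complex.ofReal_ne_zero.2 Real.pi_ne_zero
        push_cast
        field_simp
      obtain ⟨m, rfl | rfl⟩ := n.eq_nat_or_neg
      · exact ⟨fun z => z ^ m, 0, by fun_prop, by fun_prop, fun θ => by simp [hn]⟩
      · refine ⟨0, fun z => z ^ m, by fun_prop, by fun_prop, fun θ => ?_⟩
        have h1 : (cpt θ)⁻¹ = starRingEnd ℂ (cpt θ) := Complex.inv_eq_conj (norm_cpt θ)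
        rw [hn, zpow_neg, zpow_natCast, ← inv_pow, h1]
        simp
    · exact ⟨0, 0, by fun_prop, by fun_prop, fun θ => by simp⟩
    · rintro x y - - ⟨A, B, hA, hB, h⟩ ⟨A', B', hA', hB', h'⟩
      refine ⟨A + A', B + B', hA.add hA', hB.add hB', fun θ => ?_⟩
      simp only [ContinuousMap.add_apply, h, h', Pi.add_apply, map_add]
      ring
    · rintro c x - ⟨A, B, hA, hB, h⟩
      refine ⟨c • A, starRingEnd ℂ c • B, hA.const_smul c, hB.const_smul _, fun θ => ?_⟩
      simp [h]
      ring
  obtain ⟨A, B, hA, hB, h⟩ := key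
  refine ⟨A, B, hA, hB, fun θ => ?_⟩
  rw [← h, ← dist_eq_norm]
  exact (ContinuousMap.dist_apply_le_dist (f := Q) (g := p) θ).trans_lt hpQ

/-- A holomorphic function whose boundary values have nonpositive winding number around `0` does
not vanish. -/
theorem ne_zero_of_exp_eq_on_circle {h : ℂ → ℂ} (hh : DiffContOnCl ℂ h (ball 0 1)) {ℓ : ℝ → ℂ}
    (hℓ : Continuous ℓ) (hper : ∀ θ, ℓ (θ + 2 * Real.pi) = ℓ θ) (m : ℕ)
    (hexp : ∀ θ, cpt θ ^ m * h (cpt θ) = Complex.exp (ℓ θ)) {z : ℂ}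
    (hz : z ∈ ball (0 : ℂ) 1) : h z ≠ 0 := by
  obtain ⟨A, B, hA, hB, hAB⟩ := exists_differentiable_approx hℓ hper
  have hH : DiffContOnCl ℂ (fun z => z ^ m * h z * Complex.exp (B z - A z)) (ball 0 1) := by
    have h1 : DiffContOnCl ℂ (fun z : ℂ => z ^ m) (ball 0 1) :=
      (by fun_prop : Differentiable ℂ fun z : ℂ => z ^ m).diffContOnCl
    have h2 : DiffContOnCl ℂ (fun z : ℂ => Complex.exp (B z - A z)) (ball 0 1) :=
      (by fun_prop : Differentiable ℂ fun z : ℂ => Complex.exp (B z - A z)).diffContOnCl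
    exact (h1.smul hh).smul h2
  have hH' : DiffContOnCl ℂ
      (fun z => Complex.exp (-(z ^ m * h z * Complex.exp (B z - A z)))) (ball 0 1) :=
    Complex.differentiable_exp.comp_diffContOnCl hH.neg
  have hpos : ∀ θ, 0 < (cpt θ ^ m * h (cpt θ) * Complex.exp (B (cpt θ) - A (cpt θ))).re := by
    intro θ
    set e := ℓ θ - (A (cpt θ) + starRingEnd ℂ (B (cpt θ))) with he
    have h1 : cpt θ ^ m * h (cpt θ) * Complex.exp (B (cpt θ) - A (cpt θ)) =
        (Real.exp (2 * (B (cpt θ)).re) : ℝ) * Complex.exp e := by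
      rw [hexp, Complex.ofReal_exp, ← Complex.exp_add, ← Complex.exp_add, he]
      congr 1
      have := Complex.add_conj (B (cpt θ))
      rw [← this]
      ring
    rw [h1, Complex.re_ofReal_mul, Complex.exp_re]
    have h2 := (Complex.abs_im_le_norm e).trans_lt (hAB θ)
    rw [abs_lt] at h2
    have h3 : 0 < Real.cos e.im :=
      Real.cos_pos_of_mem_Ioo ⟨by linarith [Real.pi_gt_three], by linarith [Real.pi_gt_three]⟩
    positivity
  have := norm_lt_one_of_norm_lt_one_on_circle hH'
    (fun θ => by rw [Complex.norm_exp, Real.exp_lt_one_iff]; simpa using hpos θ) hz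
  rw [Complex.norm_exp, Real.exp_lt_one_iff] at this
  intro h0
  simp [h0] at this

theorem ne_zero_of_turning_number {h₁ h₂ : ℂ → ℂ} {L : ℝ → ℂ}
    (hh₁ : DiffContOnCl ℂ h₁ (ball 0 1)) (hh₂ : ContinuousOn h₂ (closedBall 0 1))
    (hL : Continuous L)
    (hexp : ∀ θ, Complex.exp (L θ) = Complex.I * cpt θ * h₁ (cpt θ) +
      starRingEnd ℂ (Complex.I * cpt θ * h₂ (cpt θ)))
    (hlt : ∀ θ, ‖h₂ (cpt θ)‖ < ‖h₁ (cpt θ)‖) {k : ℤ} (hk : k = 1 ∨ k = -1)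
    (hLk : ∀ θ, L (θ + 2 * Real.pi) = L θ + k * (2 * Real.pi * Complex.I)) {z : ℂ}
    (hz : z ∈ ball (0 : ℂ) 1) : h₁ z ≠ 0 := by
  obtain ⟨m, hm⟩ : ∃ m : ℕ, (m : ℤ) = 1 - k := by
    rcases hk with rfl | rfl
    · exact ⟨0, by norm_num⟩
    · exact ⟨2, by norm_num⟩
  have hm' : (m : ℂ) = 1 - k := by exact_mod_cast congrArg (Int.cast : ℤ → ℂ) hm
  have hc := continuous_cpt
  have hc₁ : Continuous fun θ => h₁ (cpt θ) := by
    refine hh₁.continuousOn.comp_continuous hc fun θ => ?_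
    rw [closure_ball _ one_ne_zero]
    exact cpt_mem_closedBall θ
  have hc₂ : Continuous fun θ => h₂ (cpt θ) := hh₂.comp_continuous hc cpt_mem_closedBall
  have hne : ∀ θ, h₁ (cpt θ) ≠ 0 := fun θ h0 => by
    have := hlt θ
    rw [h0, norm_zero] at this
    exact absurd this (norm_nonneg _).not_gt
  have hne' : ∀ θ, Complex.I * cpt θ * h₁ (cpt θ) ≠ 0 := fun θ =>
    mul_ne_zero (mul_ne_zero Complex.I_ne_zero (cpt_ne_zero θ)) (hne θ)
  set w : ℝ → ℂ := fun θ => starRingEnd ℂ (Complex.I * cpt θ * h₂ (cpt θ)) /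
    (Complex.I * cpt θ * h₁ (cpt θ)) with hw
  have hwc : Continuous w := by
    refine Continuous.div ?_ ((continuous_const.mul hc).mul hc₁) hne'
    exact Complex.continuous_conj.comp ((continuous_const.mul hc).mul hc₂)
  have hw1 : ∀ θ, ‖w θ‖ < 1 := by
    intro θ
    have h1 : 0 < ‖h₁ (cpt θ)‖ := norm_pos_iff.2 (hne θ)
    simp only [hw, norm_div, norm_mul, RCLike.norm_conj, Complex.norm_I, norm_cpt, one_mul]
    exact (div_lt_one h1).2 (hlt θ)
  have hslit : ∀ θ, 1 + w θ ∈ Complex.slitPlane := fun θ =>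
    Complex.mem_slitPlane_of_norm_lt_one (hw1 θ)
  have hwper : ∀ θ, w (θ + 2 * Real.pi) = w θ := fun θ => by simp only [hw, cpt_add_two_pi]
  refine ne_zero_of_exp_eq_on_circle hh₁
    (ℓ := fun θ => L θ - Complex.log (1 + w θ) - Complex.log Complex.I +
      (m * (θ * Complex.I) - θ * Complex.I))
    ?_ (fun θ => ?_) m (fun θ => ?_) hz
  · have : Continuous fun θ => Complex.log (1 + w θ) := (continuous_const.add hwc).clog hslit
    fun_prop
  · simp only [hLk, hwper, hm']
    push_cast
    ring
  · have h1 : Complex.exp (L θ) = Complex.I * cpt θ * h₁ (cpt θ) * (1 + w θ) := by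
      rw [hexp, mul_add, mul_one, hw, mul_div_cancel₀ _ (hne' θ)]
    have h2 := Complex.slitPlane_ne_zero (hslit θ)
    rw [Complex.exp_add, Complex.exp_sub, Complex.exp_sub, Complex.exp_sub, h1,
      Complex.exp_log h2, Complex.exp_log Complex.I_ne_zero, Complex.exp_nat_mul]
    change _ = _ * (cpt θ ^ m / cpt θ)
    have h3 := cpt_ne_zero θ
    have h4 := Complex.I_ne_zero
    field_simp

theorem norm_lt_norm_of_ne_zero {h₁ h₂ : ℂ → ℂ}
    (hh₁ : DiffContOnCl ℂ h₁ (ball 0 1)) (hh₂ : DiffContOnCl ℂ h₂ (ball 0 1))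
    (hlt : ∀ θ, ‖h₂ (cpt θ)‖ < ‖h₁ (cpt θ)‖) (h0 : ∀ z ∈ ball (0 : ℂ) 1, h₁ z ≠ 0) {z : ℂ}
    (hz : z ∈ ball (0 : ℂ) 1) : ‖h₂ z‖ < ‖h₁ z‖ := by
  have hne : ∀ θ, 0 < ‖h₁ (cpt θ)‖ := fun θ => (norm_nonneg _).trans_lt (hlt θ)
  have h1 : ∀ z ∈ closure (ball (0 : ℂ) 1), h₁ z ≠ 0 := by
    intro z hz
    rw [closure_ball _ one_ne_zero, mem_closedBall_zero_iff] at hz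
    rcases hz.eq_or_lt with h | h
    · obtain ⟨θ, rfl⟩ := exists_cpt_eq h
      exact norm_pos_iff.1 (hne θ)
    · exact h0 z (by simpa using h)
  have := norm_lt_one_of_norm_lt_one_on_circle ((hh₁.inv h1).smul hh₂) (fun θ => by
    simp only [Pi.inv_apply, smul_eq_mul, norm_mul, norm_inv]
    exact (inv_mul_lt_one₀ (hne θ)).2 (hlt θ)) hz
  simp only [Pi.inv_apply, smul_eq_mul, norm_mul, norm_inv] at this
  exact (inv_mul_lt_one₀ (norm_pos_iff.2 (h0 z hz))).1 this

end Holomorphic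

section Calculus

variable {φ : ℂ → ℂ}

theorem uniqueDiffOn_closedBall : UniqueDiffOn ℝ (closedBall (0 : ℂ) 1) :=
  uniqueDiffOn_convex (convex_closedBall 0 1)
    ⟨0, ball_subset_interior_closedBall (mem_ball_self one_pos)⟩

theorem continuousOn_fderivWithin_closedBall (h1 : ContDiffOn ℝ 1 φ (closedBall 0 1)) :
    ContinuousOn (fderivWithin ℝ φ (closedBall 0 1)) (closedBall 0 1) :=
  h1.continuousOn_fderivWithin uniqueDiffOn_closedBall le_rfl

theorem continuousOn_fderivWithin_closedBall_apply (h1 : ContDiffOn ℝ 1 φ (closedBall 0 1))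
    (v : ℂ) : ContinuousOn (fun z => fderivWithin ℝ φ (closedBall 0 1) z v) (closedBall 0 1) :=
  (continuousOn_fderivWithin_closedBall h1).clm_apply continuousOn_const

theorem hasFDerivWithinAt_closedBall (h1 : ContDiffOn ℝ 1 φ (closedBall 0 1)) {z : ℂ}
    (hz : z ∈ closedBall (0 : ℂ) 1) :
    HasFDerivWithinAt φ (fderivWithin ℝ φ (closedBall 0 1) z) (closedBall 0 1) z :=
  (h1.differentiableOn one_ne_zero z hz).hasFDerivWithinAt

theorem closedBall_mem_nhds_of_mem_unitBall {z : ℂ} (hz : z ∈ ball (0 : ℂ) 1) :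
    closedBall (0 : ℂ) 1 ∈ nhds z :=
  mem_of_superset (isOpen_ball.mem_nhds hz) ball_subset_closedBall

theorem fderivWithin_closedBall_eventuallyEq {z : ℂ} (hz : z ∈ ball (0 : ℂ) 1) :
    fderivWithin ℝ φ (closedBall 0 1) =ᶠ[nhds z] fderiv ℝ φ := by
  filter_upwards [isOpen_ball.mem_nhds hz] with w hw
  exact fderivWithin_of_mem_nhds (closedBall_mem_nhds_of_mem_unitBall hw)

theorem hasFDerivAt_fderivWithin_closedBall (h2 : ContDiffOn ℝ 2 φ (ball 0 1)) {z : ℂ}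
    (hz : z ∈ ball (0 : ℂ) 1) :
    HasFDerivAt (fderivWithin ℝ φ (closedBall 0 1)) (fderiv ℝ (fderiv ℝ φ) z) z := by
  have h3 : ContDiffAt ℝ 2 φ z := h2.contDiffAt (isOpen_ball.mem_nhds hz)
  have h4 : ContDiffAt ℝ 1 (fderiv ℝ φ) z := h3.fderiv_right (by norm_num)
  exact (h4.differentiableAt one_ne_zero).hasFDerivAt.congr_of_eventuallyEq
    (fderivWithin_closedBall_eventuallyEq hz)

theorem second_fderiv_symm (h2 : ContDiffOn ℝ 2 φ (ball 0 1)) {z : ℂ}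
    (hz : z ∈ ball (0 : ℂ) 1) (v w : ℂ) :
    fderiv ℝ (fderiv ℝ φ) z v w = fderiv ℝ (fderiv ℝ φ) z w v :=
  ((h2.contDiffAt (isOpen_ball.mem_nhds hz)).isSymmSndFDerivAt (by simp)).eq v w

theorem HarmonicOn2.second_fderiv_eq (hh : HarmonicOn2 φ (ball 0 1))
    (h2 : ContDiffOn ℝ 2 φ (ball 0 1)) {z : ℂ} (hz : z ∈ ball (0 : ℂ) 1) :
    fderiv ℝ (fderiv ℝ φ) z Complex.I Complex.I = -fderiv ℝ (fderiv ℝ φ) z 1 1 := by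
  have h3 : ContDiffAt ℝ 2 φ z := h2.contDiffAt (isOpen_ball.mem_nhds hz)
  have h4 : DifferentiableAt ℝ (fderiv ℝ φ) z :=
    (h3.fderiv_right (m := 1) (by norm_num)).differentiableAt one_ne_zero
  have key : ∀ (T : ℂ →L[ℝ] ℝ) (v : ℂ),
      fderiv ℝ (fun w => fderiv ℝ (fun w => T (φ w)) w v) z v =
        T (fderiv ℝ (fderiv ℝ φ) z v v) := by
    intro T v
    have h5 : (fun w => fderiv ℝ (fun w => T (φ w)) w v) =ᶠ[nhds z]
        fun w => T (fderiv ℝ φ w v) := by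
      filter_upwards [isOpen_ball.mem_nhds hz] with w hw
      have h6 : HasFDerivAt φ (fderiv ℝ φ w) w :=
        ((h2.contDiffAt (isOpen_ball.mem_nhds hw)).differentiableAt two_ne_zero).hasFDerivAt
      exact congrArg (· v) (T.hasFDerivAt.comp w h6).fderiv
    rw [h5.fderiv_eq]
    have h7 : HasFDerivAt (fun w => fderiv ℝ φ w v) ((fderiv ℝ (fderiv ℝ φ) z).flip v) z :=
      by simpa using h4.hasFDerivAt.clm_apply (hasFDerivAt_const v z)
    exact congrArg (· v) (T.hasFDerivAt.comp z h7).fderiv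
  obtain ⟨hre, him⟩ := hh z hz
  have e1 := key Complex.reCLM
  have e2 := key Complex.imCLM
  simp only [Complex.reCLM_apply] at e1
  simp only [Complex.imCLM_apply] at e2
  rw [lap2, e1, e1] at hre
  rw [lap2, e2, e2] at him
  refine Complex.ext ?_ ?_
  · rw [Complex.neg_re]; linarith
  · rw [Complex.neg_im]; linarith

/-- The Wirtinger derivative `∂φ/∂z` on the closed unit disk. -/
def wirtinger (φ : ℂ → ℂ) (z : ℂ) : ℂ :=
  (fderivWithin ℝ φ (closedBall 0 1) z 1 -
    Complex.I * fderivWithin ℝ φ (closedBall 0 1) z Complex.I) / 2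

/-- The complex conjugate of the Wirtinger derivative `∂φ/∂(conj z)` on the closed unit disk. -/
def conjWirtinger (φ : ℂ → ℂ) (z : ℂ) : ℂ :=
  starRingEnd ℂ ((fderivWithin ℝ φ (closedBall 0 1) z 1 +
    Complex.I * fderivWithin ℝ φ (closedBall 0 1) z Complex.I) / 2)

theorem fderivWithin_eq_wirtinger (z v : ℂ) :
    fderivWithin ℝ φ (closedBall 0 1) z v =
      v * wirtinger φ z + starRingEnd ℂ (v * conjWirtinger φ z) := by
  conv_lhs => rw [← Complex.re_add_im v, map_add, ← Complex.real_smul, ← mul_one (v.re : ℂ),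
    ← Complex.real_smul, map_smul, map_smul]
  simp only [wirtinger, conjWirtinger, map_mul, Complex.conj_conj, Complex.real_smul]
  have h1 := Complex.re_add_im v
  have h2 : starRingEnd ℂ v = v.re - v.im * Complex.I := by
    conv_lhs => rw [← h1]
    simp only [map_add, map_mul, Complex.conj_ofReal, Complex.conj_I]
    ring
  rw [h2]
  conv_rhs => enter [1, 1]; rw [← h1]
  linear_combination (v.im * fderivWithin ℝ φ (closedBall 0 1) z Complex.I) * Complex.I_sq

theorem jacDetWithin_eq (z : ℂ) :
    jacDetWithin φ (closedBall 0 1) z = ‖wirtinger φ z‖ ^ 2 - ‖conjWirtinger φ z‖ ^ 2 := by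
  rw [← Complex.normSq_eq_norm_sq, ← Complex.normSq_eq_norm_sq]
  simp only [jacDetWithin, crossC, wirtinger, conjWirtinger, map_div₀,
    Complex.normSq_apply]
  simp
  ring

theorem continuousOn_wirtinger (h1 : ContDiffOn ℝ 1 φ (closedBall 0 1)) :
    ContinuousOn (wirtinger φ) (closedBall 0 1) :=
  ((continuousOn_fderivWithin_closedBall_apply h1 1).sub
    (continuousOn_const.mul (continuousOn_fderivWithin_closedBall_apply h1 _))).div_const 2

theorem continuousOn_conjWirtinger (h1 : ContDiffOn ℝ 1 φ (closedBall 0 1)) :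
    ContinuousOn (conjWirtinger φ) (closedBall 0 1) :=
  Complex.continuous_conj.comp_continuousOn
    (((continuousOn_fderivWithin_closedBall_apply h1 1).add
    (continuousOn_const.mul (continuousOn_fderivWithin_closedBall_apply h1 _))).div_const 2)

theorem diffContOnCl_wirtinger (h1 : ContDiffOn ℝ 1 φ (closedBall 0 1))
    (h2 : ContDiffOn ℝ 2 φ (ball 0 1)) (hh : HarmonicOn2 φ (ball 0 1)) :
    DiffContOnCl ℂ (wirtinger φ) (ball 0 1) := by
  refine ⟨fun z hz => DifferentiableAt.differentiableWithinAt ?_, ?_⟩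
  · have h3 := hasFDerivAt_fderivWithin_closedBall h2 hz
    have h4 : ∀ v, HasFDerivAt (fun w => fderivWithin ℝ φ (closedBall 0 1) w v)
        ((fderiv ℝ (fderiv ℝ φ) z).flip v) z := fun v => by
      simpa using h3.clm_apply (hasFDerivAt_const v z)
    have h5 : HasFDerivAt (wirtinger φ) ((2 : ℂ)⁻¹ • ((fderiv ℝ (fderiv ℝ φ) z).flip 1 -
        Complex.I • (fderiv ℝ (fderiv ℝ φ) z).flip Complex.I)) z := by
      refine (((h4 1).sub ((h4 Complex.I).const_smul Complex.I)).const_smul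
        (2 : ℂ)⁻¹).congr_of_eventuallyEq (Eventually.of_forall fun w => ?_)
      simp [wirtinger, div_eq_inv_mul]
    rw [differentiableAt_complex_iff_differentiableAt_real]
    refine ⟨h5.differentiableAt, ?_⟩
    have h6 := hh.second_fderiv_eq h2 hz
    have h7 := second_fderiv_symm h2 hz 1 Complex.I
    simp only [h5.fderiv, smul_apply, sub_apply,
      ContinuousLinearMap.flip_apply, smul_eq_mul, h6, h7]
    linear_combination (2⁻¹ * (fderiv ℝ (fderiv ℝ φ) z Complex.I) 1) * Complex.I_sq
  · rw [closure_ball _ one_ne_zero]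
    exact continuousOn_wirtinger h1

theorem diffContOnCl_conjWirtinger (h1 : ContDiffOn ℝ 1 φ (closedBall 0 1))
    (h2 : ContDiffOn ℝ 2 φ (ball 0 1)) (hh : HarmonicOn2 φ (ball 0 1)) :
    DiffContOnCl ℂ (conjWirtinger φ) (ball 0 1) := by
  refine ⟨fun z hz => DifferentiableAt.differentiableWithinAt ?_, ?_⟩
  · have h3 := hasFDerivAt_fderivWithin_closedBall h2 hz
    have h4 : ∀ v, HasFDerivAt (fun w => fderivWithin ℝ φ (closedBall 0 1) w v)
        ((fderiv ℝ (fderiv ℝ φ) z).flip v) z := fun v => by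
      simpa using h3.clm_apply (hasFDerivAt_const v z)
    have h5 : HasFDerivAt (conjWirtinger φ) ((Complex.conjCLE : ℂ →L[ℝ] ℂ).comp
        ((2 : ℂ)⁻¹ • ((fderiv ℝ (fderiv ℝ φ) z).flip 1 +
        Complex.I • (fderiv ℝ (fderiv ℝ φ) z).flip Complex.I))) z := by
      refine ((Complex.conjCLE : ℂ →L[ℝ] ℂ).hasFDerivAt.comp z
        (((h4 1).add ((h4 Complex.I).const_smul Complex.I)).const_smul
        (2 : ℂ)⁻¹)).congr_of_eventuallyEq (Eventually.of_forall fun w => ?_)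
      simp [conjWirtinger, div_eq_inv_mul, mul_add]
    rw [differentiableAt_complex_iff_differentiableAt_real]
    refine ⟨h5.differentiableAt, ?_⟩
    have h6 := hh.second_fderiv_eq h2 hz
    have h7 := second_fderiv_symm h2 hz 1 Complex.I
    simp only [h5.fderiv, smul_apply, add_apply,
      ContinuousLinearMap.flip_apply, smul_eq_mul, h6, h7, ContinuousLinearMap.comp_apply,
      ContinuousLinearEquiv.coe_coe, Complex.conjCLE_apply, map_mul, map_add, map_neg,
      Complex.conj_I, map_inv₀, map_ofNat]
    linear_combination (2⁻¹ * starRingEnd ℂ ((fderiv ℝ (fderiv ℝ φ) z Complex.I) 1)) *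
      Complex.I_sq
  · rw [closure_ball _ one_ne_zero]
    exact continuousOn_conjWirtinger h1

theorem hasDerivAt_cpt (θ : ℝ) : HasDerivAt cpt (Complex.I * cpt θ) θ := by
  have h1 : HasDerivAt (fun θ : ℝ => (θ : ℂ) * Complex.I) (1 * Complex.I) θ :=
    (Complex.ofRealCLM.hasDerivAt (x := θ)).mul_const Complex.I
  have h2 := h1.cexp
  rwa [one_mul, mul_comm] at h2

theorem hasDerivAt_comp_cpt (h1 : ContDiffOn ℝ 1 φ (closedBall 0 1)) (θ : ℝ) :
    HasDerivAt (fun θ => φ (cpt θ))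
      (fderivWithin ℝ φ (closedBall 0 1) (cpt θ) (Complex.I * cpt θ)) θ := by
  have h2 := (hasFDerivWithinAt_closedBall h1 (cpt_mem_closedBall θ)).comp_hasDerivWithinAt θ
    (hasDerivAt_cpt θ).hasDerivWithinAt (s := univ) (fun x _ => cpt_mem_closedBall x)
  rwa [hasDerivWithinAt_univ] at h2

theorem continuousOn_jacDetWithin (h1 : ContDiffOn ℝ 1 φ (closedBall 0 1)) :
    ContinuousOn (jacDetWithin φ (closedBall 0 1)) (closedBall 0 1) := by
  have h3 := continuousOn_wirtinger h1
  have h4 := continuousOn_conjWirtinger h1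
  exact ((h3.norm.pow 2).sub (h4.norm.pow 2)).congr fun z _ => jacDetWithin_eq z

/-- The positivity of the Jacobian determinant propagates from the circle to the disk. -/
theorem jacDetWithin_pos {γ : ℝ → ℂ} (hγper : ∀ θ, γ (θ + 2 * Real.pi) = γ θ)
    (hγinj : InjOn γ (Ico 0 (2 * Real.pi))) (hγC1 : ContDiff ℝ 1 γ)
    (hγ0 : ∀ θ, deriv γ θ ≠ 0) (h1 : ContDiffOn ℝ 1 φ (closedBall 0 1))
    (h2 : ContDiffOn ℝ 2 φ (ball 0 1)) (hh : HarmonicOn2 φ (ball 0 1))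
    (hbd : ∀ θ, φ (cpt θ) = γ θ) (hpos : ∀ θ, 0 < jacDetWithin φ (closedBall 0 1) (cpt θ))
    {z : ℂ} (hz : z ∈ closedBall (0 : ℂ) 1) : 0 < jacDetWithin φ (closedBall 0 1) z := by
  rw [mem_closedBall_zero_iff] at hz
  rcases hz.eq_or_lt with h | h
  · obtain ⟨θ, rfl⟩ := exists_cpt_eq h
    exact hpos θ
  have hlt : ∀ θ, ‖conjWirtinger φ (cpt θ)‖ < ‖wirtinger φ (cpt θ)‖ := fun θ => by
    have h3 := hpos θ
    rw [jacDetWithin_eq, sub_pos] at h3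
    exact lt_of_pow_lt_pow_left₀ 2 (norm_nonneg _) h3
  obtain ⟨L, hLc, hL, k, hk, hLk⟩ := turning_number_simple_closed hγC1 hγper hγinj hγ0
  have hw := diffContOnCl_wirtinger h1 h2 hh
  have hexp : ∀ θ, Complex.exp (L θ) = Complex.I * cpt θ * wirtinger φ (cpt θ) +
      starRingEnd ℂ (Complex.I * cpt θ * conjWirtinger φ (cpt θ)) := fun θ => by
    rw [hL, ← fderivWithin_eq_wirtinger, ← (hasDerivAt_comp_cpt h1 θ).deriv, funext hbd]
  have h4 := norm_lt_norm_of_ne_zero hw (diffContOnCl_conjWirtinger h1 h2 hh) hlt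
    (fun z hz => ne_zero_of_turning_number hw (continuousOn_conjWirtinger h1) hLc hexp hlt hk
      hLk hz) (z := z) (by simpa using h)
  rw [jacDetWithin_eq, sub_pos]
  gcongr

end Calculus

section Inversion

variable {φ : ℂ → ℂ}

theorem clm_apply_eq (L : ℂ →L[ℝ] ℂ) (v : ℂ) : L v = v.re * L 1 + v.im * L Complex.I := by
  conv_lhs => rw [← Complex.re_add_im v, map_add, ← Complex.real_smul, ← mul_one (v.re : ℂ),
    ← Complex.real_smul, map_smul, map_smul]
  simp only [Complex.real_smul]

theorem exists_equiv_of_crossC_ne_zero (L : ℂ →L[ℝ] ℂ) (h : crossC (L 1) (L Complex.I) ≠ 0) :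
    ∃ e : ℂ ≃L[ℝ] ℂ, (e : ℂ →L[ℝ] ℂ) = L := by
  have hinj : Function.Injective (L : ℂ →ₗ[ℝ] ℂ) := by
    rw [injective_iff_map_eq_zero]
    intro v hv
    rw [ContinuousLinearMap.coe_coe, clm_apply_eq] at hv
    have hre := congrArg Complex.re hv
    have him := congrArg Complex.im hv
    simp only [Complex.add_re, Complex.add_im, Complex.re_ofReal_mul, Complex.im_ofReal_mul,
      Complex.zero_re, Complex.zero_im] at hre him
    unfold crossC at h
    refine Complex.ext (mul_right_cancel₀ h ?_) (mul_right_cancel₀ h ?_)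
    · rw [Complex.zero_re]
      linear_combination (L Complex.I).im * hre - (L Complex.I).re * him
    · rw [Complex.zero_im]
      linear_combination (L 1).re * him - (L 1).im * hre
  refine ⟨(LinearEquiv.ofInjectiveEndo (L : ℂ →ₗ[ℝ] ℂ) hinj).toContinuousLinearEquiv, ?_⟩
  ext
  simp

theorem exists_isOpen_injOn (h1 : ContDiffOn ℝ 1 φ (closedBall 0 1)) {z : ℂ}
    (hz : z ∈ closedBall (0 : ℂ) 1) (hd : jacDetWithin φ (closedBall 0 1) z ≠ 0) :
    ∃ u, IsOpen u ∧ z ∈ u ∧ InjOn φ (u ∩ closedBall 0 1) := by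
  obtain ⟨e, he⟩ := exists_equiv_of_crossC_ne_zero _ hd
  set K : ℝ := ‖(e.symm : ℂ →L[ℝ] ℂ)‖ + 1 with hK
  have hK0 : 0 < K := by positivity
  have hc := (continuousOn_fderivWithin_closedBall h1) z hz
  obtain ⟨ε, hε, hball⟩ := Metric.continuousWithinAt_iff.1 hc (1 / (2 * K)) (by positivity)
  refine ⟨ball z ε, isOpen_ball, mem_ball_self hε, fun x hx y hy hxy => ?_⟩
  have key := ((convex_ball z ε).inter
    (convex_closedBall (0 : ℂ) 1)).norm_image_sub_le_of_norm_hasFDerivWithin_le'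
    (f := φ) (φ := fderivWithin ℝ φ (closedBall 0 1) z) (C := 1 / (2 * K))
    (fun w hw => (hasFDerivWithinAt_closedBall h1 hw.2).mono inter_subset_right)
    (fun w hw => by rw [← dist_eq_norm]; exact (hball hw.2 hw.1).le) hx hy
  rw [hxy, sub_self, zero_sub, norm_neg, ← he] at key
  have h2 : ‖y - x‖ ≤ K * ‖e (y - x)‖ := by
    have h3 := (e.symm : ℂ →L[ℝ] ℂ).le_opNorm (e (y - x))
    rw [ContinuousLinearEquiv.coe_coe, e.symm_apply_apply] at h3
    refine h3.trans ?_
    gcongr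
    linarith
  have h4 : K * ‖e (y - x)‖ ≤ K * (1 / (2 * K) * ‖y - x‖) := by gcongr; exact key
  have h5 : K * (1 / (2 * K) * ‖y - x‖) = ‖y - x‖ / 2 := by field_simp
  have h6 : ‖y - x‖ = 0 := le_antisymm (by linarith) (norm_nonneg _)
  exact (sub_eq_zero.1 (norm_eq_zero.1 h6)).symm

/-- The pairs of distinct points of a locally injective map with the same value form a compact
set. -/
theorem isCompact_noninjective_pairs {K : Set ℂ} (hK : IsCompact K) (hc : ContinuousOn φ K)
    (hloc : ∀ z ∈ K, ∃ u, IsOpen u ∧ z ∈ u ∧ InjOn φ (u ∩ K)) :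
    IsCompact {p : ℂ × ℂ | p.1 ∈ K ∧ p.2 ∈ K ∧ φ p.1 = φ p.2 ∧ p.1 ≠ p.2} := by
  choose! u huo hu huinj using hloc
  have hC : IsCompact ((K ×ˢ K) ∩ (fun p : ℂ × ℂ => φ p.1 - φ p.2) ⁻¹' {0}) := by
    refine (hK.prod hK).of_isClosed_subset ?_ inter_subset_left
    refine ContinuousOn.preimage_isClosed_of_isClosed ?_ (hK.prod hK).isClosed
      isClosed_singleton
    exact (hc.comp continuousOn_fst fun p hp => hp.1).sub
      (hc.comp continuousOn_snd fun p hp => hp.2)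
  have hO : IsOpen (⋃ z ∈ K, u z ×ˢ u z) :=
    isOpen_biUnion fun z hz => (huo z hz).prod (huo z hz)
  convert! hC.diff hO using 1
  ext ⟨z, w⟩
  simp only [mem_ofPred_eq, Set.mem_sdiff, mem_inter_iff, mem_prod, mem_preimage, mem_singleton_iff,
    sub_eq_zero, mem_iUnion, not_exists, not_and]
  constructor
  · rintro ⟨hz, hw, h, hne⟩
    exact ⟨⟨⟨hz, hw⟩, h⟩, fun x hx hzx hwx => hne (huinj x hx ⟨hzx, hz⟩ ⟨hwx, hw⟩ h)⟩
  · rintro ⟨⟨⟨hz, hw⟩, h⟩, hn⟩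
    refine ⟨hz, hw, h, ?_⟩
    rintro rfl
    exact hn z hz (hu z hz) (hu z hz)

theorem image_mem_nhds_of_jacDetWithin_ne_zero (h1 : ContDiffOn ℝ 1 φ (closedBall 0 1)) {z : ℂ}
    (hz : z ∈ ball (0 : ℂ) 1) (hd : jacDetWithin φ (closedBall 0 1) z ≠ 0) {s : Set ℂ}
    (hs : s ∈ nhds z) : φ '' s ∈ nhds (φ z) := by
  obtain ⟨e, he⟩ := exists_equiv_of_crossC_ne_zero _ hd
  have h2 : ContDiffAt ℝ 1 φ z := h1.contDiffAt (closedBall_mem_nhds_of_mem_unitBall hz)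
  have h3 := h2.hasStrictFDerivAt one_ne_zero
  rw [← fderivWithin_of_mem_nhds (closedBall_mem_nhds_of_mem_unitBall hz), ← he] at h3
  rw [← h3.map_nhds_eq_of_equiv]
  exact image_mem_map hs

/-- A local diffeomorphism of the closed disk which is injective on the circle is injective. -/
theorem injOn_closedBall_of_jacDetWithin_ne_zero (h1 : ContDiffOn ℝ 1 φ (closedBall 0 1))
    (hd : ∀ z ∈ closedBall (0 : ℂ) 1, jacDetWithin φ (closedBall 0 1) z ≠ 0)
    (hinj : ∀ a b : ℝ, φ (cpt a) = φ (cpt b) → cpt a = cpt b) :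
    InjOn φ (closedBall 0 1) := by
  have hcont : ContinuousOn φ (closedBall 0 1) := h1.continuousOn
  set E := {p : ℂ × ℂ | p.1 ∈ closedBall (0 : ℂ) 1 ∧ p.2 ∈ closedBall (0 : ℂ) 1 ∧
    φ p.1 = φ p.2 ∧ p.1 ≠ p.2} with hE
  have hEc : IsCompact E := isCompact_noninjective_pairs (isCompact_closedBall 0 1) hcont
    fun z hz => exists_isOpen_injOn h1 hz (hd z hz)
  have hopen : ∀ z ∈ ball (0 : ℂ) 1, ∀ s ∈ nhds z, φ '' s ∈ nhds (φ z) := fun z hz s hs =>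
    image_mem_nhds_of_jacDetWithin_ne_zero h1 hz (hd z (ball_subset_closedBall hz)) hs
  have hU : IsOpen (φ '' ball 0 1) := by
    rw [isOpen_iff_mem_nhds]
    rintro _ ⟨z, hz, rfl⟩
    exact hopen z hz _ (isOpen_ball.mem_nhds hz)
  have hproj : IsClosed (Prod.fst '' E) := (hEc.image continuous_fst).isClosed
  have hγc : Continuous fun θ => φ (cpt θ) :=
    hcont.comp_continuous continuous_cpt cpt_mem_closedBall
  have hE1 : ∀ θ, cpt θ ∈ Prod.fst '' E ↔ φ (cpt θ) ∈ φ '' ball 0 1 := by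
    intro θ
    constructor
    · rintro ⟨⟨z, w⟩, ⟨-, hw, h, hne⟩, hz⟩
      simp only at hw h hne hz
      subst hz
      rw [mem_closedBall_zero_iff] at hw
      rcases hw.eq_or_lt with h2 | h2
      · obtain ⟨θ', rfl⟩ := exists_cpt_eq h2
        exact absurd (hinj _ _ h) hne
      · exact ⟨w, by simpa using h2, h.symm⟩
    · rintro ⟨w, hw, h⟩
      refine ⟨(cpt θ, w), ⟨cpt_mem_closedBall θ, ball_subset_closedBall hw, h.symm, ?_⟩, rfl⟩
      intro (h' : cpt θ = w)
      simp [← h', norm_cpt] at hw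
  have hT : IsClopen {θ | φ (cpt θ) ∈ φ '' ball 0 1} := by
    refine ⟨?_, hU.preimage hγc⟩
    simp only [← hE1]
    exact hproj.preimage continuous_cpt
  have hbd : ∀ θ, φ (cpt θ) ∉ φ '' ball 0 1 := by
    rcases isClopen_iff.1 hT with h | h
    · exact fun θ hθ => (h ▸ hθ : θ ∈ (∅ : Set ℝ))
    · exfalso
      have h2 : φ '' ball 0 1 = φ '' closedBall 0 1 := by
        refine (image_mono ball_subset_closedBall).antisymm ?_
        rintro _ ⟨z, hz, rfl⟩
        rw [mem_closedBall_zero_iff] at hz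
        rcases hz.eq_or_lt with h3 | h3
        · obtain ⟨θ, rfl⟩ := exists_cpt_eq h3
          exact (h ▸ mem_univ θ : θ ∈ {θ | φ (cpt θ) ∈ φ '' ball 0 1})
        · exact mem_image_of_mem φ (by simpa using h3)
      have h3 : IsCompact (φ '' ball 0 1) := by
        rw [h2]
        exact (isCompact_closedBall 0 1).image_of_continuousOn hcont
      rcases isClopen_iff.1 ⟨h3.isClosed, hU⟩ with h4 | h4
      · exact (h4 ▸ mem_image_of_mem φ (mem_ball_self one_pos) : φ 0 ∈ (∅ : Set ℂ))
      · rw [h4] at h3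
        exact noncompact_univ ℂ h3
  have hS : IsOpen (ball (0 : ℂ) 1 ∩ Prod.fst '' E) := by
    rw [isOpen_iff_mem_nhds]
    rintro z ⟨hz, ⟨_, w⟩, ⟨hz', hw, h, hne⟩, rfl⟩
    simp only at hz hz' hw h hne ⊢
    have hwb : w ∈ ball (0 : ℂ) 1 := by
      rw [mem_closedBall_zero_iff] at hw
      rcases hw.eq_or_lt with h2 | h2
      · obtain ⟨θ, rfl⟩ := exists_cpt_eq h2
        exact absurd ⟨_, hz, h⟩ (hbd θ)
      · simpa using h2
    rename_i z
    obtain ⟨a, b, ha, hb, hza, hwb', hab⟩ := t2_separation hne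
    have h3 := hopen w hwb _ ((hb.inter isOpen_ball).mem_nhds ⟨hwb', hwb⟩)
    rw [← h] at h3
    have h4 : ContinuousAt φ z := hcont.continuousAt (closedBall_mem_nhds_of_mem_unitBall hz)
    filter_upwards [h4 h3, ha.mem_nhds hza, isOpen_ball.mem_nhds hz] with x hx hxa hxb
    obtain ⟨y, ⟨hyb, hy1⟩, hy⟩ := hx
    refine ⟨hxb, (x, y), ⟨ball_subset_closedBall hxb, ball_subset_closedBall hy1, hy.symm, ?_⟩,
      rfl⟩
    intro (h' : x = y)
    exact disjoint_left.1 hab hxa (h' ▸ hyb)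
  have hnot : ¬ ball (0 : ℂ) 1 ⊆ Prod.fst '' E := by
    intro h
    have h2 := closure_minimal h hproj
    rw [closure_ball _ one_ne_zero] at h2
    exact hbd 0 ((hE1 0).1 (h2 (cpt_mem_closedBall 0)))
  have hball : ∀ z ∈ ball (0 : ℂ) 1, z ∉ Prod.fst '' E := by
    intro z hz hzE
    refine hnot fun x hx => ?_
    have := (convex_ball (0 : ℂ) 1).isPreconnected.subset_left_of_subset_union hS
      (isOpen_ball.inter hproj.isOpen_compl)
      (disjoint_left.2 fun y hy hy' => hy'.2 hy.2)
      (fun y hy => (em (y ∈ Prod.fst '' E)).imp (fun h => ⟨hy, h⟩) fun h => ⟨hy, h⟩)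
      ⟨z, hz, hz, hzE⟩ hx
    exact this.2
  intro z hz w hw h
  by_contra hne
  have hzE : z ∈ Prod.fst '' E := ⟨(z, w), ⟨hz, hw, h, hne⟩, rfl⟩
  rcases (mem_closedBall_zero_iff.1 hz).eq_or_lt with h2 | h2
  · obtain ⟨θ, rfl⟩ := exists_cpt_eq h2
    exact hbd θ ((hE1 θ).1 hzE)
  · exact hball z (by simpa using h2) hzE

/-- An embedding of the closed disk mapping the circle onto the frontier of a bounded open set
maps the closed disk onto the closure of this set. -/
theorem image_closedBall_eq_closure {Ω : Set ℂ} (hΩo : IsOpen Ω) (hΩb : Bornology.IsBounded Ω)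
    (hcont : ContinuousOn φ (closedBall 0 1)) (hinj : InjOn φ (closedBall 0 1))
    (hfr : range (fun θ => φ (cpt θ)) = frontier Ω) :
    φ '' closedBall 0 1 = closure Ω := by
  have hK : IsClosed (φ '' closedBall 0 1) :=
    ((isCompact_closedBall 0 1).image_of_continuousOn hcont).isClosed
  have hfrK : frontier Ω ⊆ φ '' closedBall 0 1 := by
    rw [← hfr]
    rintro _ ⟨θ, rfl⟩
    exact mem_image_of_mem φ (cpt_mem_closedBall θ)
  have hbfr : φ '' ball 0 1 ⊆ (frontier Ω)ᶜ := by
    rintro _ ⟨z, hz, rfl⟩ h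
    rw [← hfr] at h
    obtain ⟨θ, hθ⟩ := h
    have := hinj (cpt_mem_closedBall θ) (ball_subset_closedBall hz) hθ
    simp [← this, norm_cpt] at hz
  have hsub : Ω \ φ '' closedBall 0 1 = ∅ := by
    refine eq_empty_of_frontier_subset_image hcont hinj (hΩb.subset sdiff_subset)
      disjoint_sdiff_left ?_
    intro p hp
    by_contra hpK
    have h1 : p ∈ closure Ω := closure_mono sdiff_subset (frontier_subset_closure hp)
    have h2 : p ∉ Ω := fun h => by
      rw [(hΩo.sdiff hK).frontier_eq] at hp
      exact hp.2 ⟨h, hpK⟩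
    exact hpK (hfrK (by rw [hΩo.frontier_eq]; exact ⟨h1, h2⟩))
  have hΩK : Ω ⊆ φ '' closedBall 0 1 := sdiff_eq_empty.1 hsub
  refine subset_antisymm ?_ (closure_minimal hΩK hK)
  have hne : (φ '' ball 0 1 ∩ Ω).Nonempty := by
    obtain ⟨p, hp⟩ : Ω.Nonempty := by
      by_contra h
      rw [not_nonempty_iff_eq_empty] at h
      have : φ (cpt 0) ∈ frontier Ω := hfr ▸ mem_range_self 0
      simp [h] at this
    obtain ⟨z, hz, rfl⟩ := hΩK hp
    refine ⟨φ z, ⟨z, ?_, rfl⟩, hp⟩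
    rcases (mem_closedBall_zero_iff.1 hz).eq_or_lt with h2 | h2
    · obtain ⟨θ, rfl⟩ := exists_cpt_eq h2
      have : φ (cpt θ) ∈ frontier Ω := hfr ▸ mem_range_self θ
      rw [hΩo.frontier_eq] at this
      exact absurd hp this.2
    · simpa using h2
  have hsub' : φ '' ball 0 1 ⊆ Ω := by
    have hpre : IsPreconnected (φ '' ball 0 1) :=
      (convex_ball (0 : ℂ) 1).isPreconnected.image φ (hcont.mono ball_subset_closedBall)
    refine hpre.subset_left_of_subset_union hΩo isClosed_closure.isOpen_compl
      (disjoint_left.2 fun x hx hx' => hx' (subset_closure hx)) (fun x hx => ?_) hne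
    by_contra hcon
    rw [mem_union, not_or, notMem_compl_iff] at hcon
    exact hbfr hx (by rw [hΩo.frontier_eq]; exact ⟨hcon.2, hcon.1⟩)
  rintro _ ⟨z, hz, rfl⟩
  rcases (mem_closedBall_zero_iff.1 hz).eq_or_lt with h2 | h2
  · obtain ⟨θ, rfl⟩ := exists_cpt_eq h2
    exact frontier_subset_closure (hfr ▸ mem_range_self θ)
  · exact subset_closure (hsub' (mem_image_of_mem φ (by simpa using h2)))

/-- The inverse of a `C¹` embedding of the closed disk with invertible derivative is `C¹`. -/
theorem exists_contDiffOn_leftInverse (h1 : ContDiffOn ℝ 1 φ (closedBall 0 1))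
    (hd : ∀ z ∈ closedBall (0 : ℂ) 1, jacDetWithin φ (closedBall 0 1) z ≠ 0)
    (hinj : InjOn φ (closedBall 0 1)) :
    ∃ ψ : ℂ → ℂ, ContDiffOn ℝ 1 ψ (φ '' closedBall 0 1) ∧
      ∀ z ∈ closedBall (0 : ℂ) 1, ψ (φ z) = z := by
  have hcont : ContinuousOn φ (closedBall 0 1) := h1.continuousOn
  have hleft : ∀ z ∈ closedBall (0 : ℂ) 1,
      Function.invFunOn φ (closedBall 0 1) (φ z) = z := fun z hz =>
    hinj.leftInvOn_invFunOn hz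
  set ψ := Function.invFunOn φ (closedBall 0 1) with hψ
  have hmaps : MapsTo ψ (φ '' closedBall 0 1) (closedBall 0 1) := by
    rintro _ ⟨z, hz, rfl⟩
    rwa [hleft z hz]
  have hψc : ContinuousOn ψ (φ '' closedBall 0 1) := by
    rw [continuousOn_iff_isClosed]
    intro t ht
    refine ⟨φ '' (closedBall 0 1 ∩ t), ?_, ?_⟩
    · exact (((isCompact_closedBall 0 1).inter_right ht).image_of_continuousOn
        (hcont.mono inter_subset_left)).isClosed
    · ext p
      constructor
      · rintro ⟨hp, z, hz, rfl⟩
        rw [mem_preimage, hleft z hz] at hp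
        exact ⟨⟨z, ⟨hz, hp⟩, rfl⟩, ⟨z, hz, rfl⟩⟩
      · rintro ⟨⟨z, ⟨hz, hzt⟩, rfl⟩, -⟩
        exact ⟨by rwa [mem_preimage, hleft z hz], z, hz, rfl⟩
  choose! e he using fun z hz => exists_equiv_of_crossC_ne_zero _ (hd z hz)
  have hder : ∀ p ∈ φ '' closedBall 0 1,
      HasFDerivWithinAt ψ ((e (ψ p)).symm : ℂ →L[ℝ] ℂ) (φ '' closedBall 0 1) p := by
    intro p hp
    have h2 := hasFDerivWithinAt_closedBall h1 (hmaps hp)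
    rw [← he _ (hmaps hp)] at h2
    refine HasFDerivWithinAt.of_local_left_inverse
      ((hψc p hp).tendsto_nhdsWithin hmaps) h2 hp ?_
    filter_upwards [self_mem_nhdsWithin]
    rintro _ ⟨z, hz, rfl⟩
    rw [hleft z hz]
  have hsymm : ContinuousOn (fun p => ((e (ψ p)).symm : ℂ →L[ℝ] ℂ)) (φ '' closedBall 0 1) := by
    intro p hp
    have h2 : ContinuousWithinAt (fun p => fderivWithin ℝ φ (closedBall 0 1) (ψ p))
        (φ '' closedBall 0 1) p :=
      ((continuousOn_fderivWithin_closedBall h1).comp hψc hmaps) p hp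
    have h3 : ContinuousAt ContinuousLinearMap.inverse
        (fderivWithin ℝ φ (closedBall 0 1) (ψ p)) := by
      rw [← he _ (hmaps hp)]
      exact (contDiffAt_map_inverse (n := 0) (e (ψ p))).continuousAt
    refine (ContinuousAt.comp_continuousWithinAt
      (f := fun p => fderivWithin ℝ φ (closedBall 0 1) (ψ p)) h3 h2).congr (fun q hq => ?_) ?_
    · rw [Function.comp_apply, ← he _ (hmaps hq), ContinuousLinearMap.inverse_equiv]
    · rw [Function.comp_apply, ← he _ (hmaps hp), ContinuousLinearMap.inverse_equiv]
  refine ⟨ψ, fun p hp => ?_, hleft⟩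
  refine (contDiffWithinAt_succ_iff_hasFDerivWithinAt (n := 0) (by simp)).2
    ⟨φ '' closedBall 0 1, by rw [insert_eq_of_mem hp]; exact self_mem_nhdsWithin, by simp,
      _, hder, contDiffOn_zero.2 hsymm p hp⟩

end Inversion

section Area

variable {φ : ℂ → ℂ}

/-- The cross product as a continuous bilinear map. -/
def crossCLM : ℂ →L[ℝ] ℂ →L[ℝ] ℝ :=
  (ContinuousLinearMap.compL ℝ ℂ ℂ ℝ Complex.imCLM) ∘L (ContinuousLinearMap.mul ℝ ℂ) ∘L
    (Complex.conjCLE : ℂ →L[ℝ] ℂ)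

theorem crossCLM_apply (u v : ℂ) : crossCLM u v = crossC u v := by
  simp [crossCLM, crossC]
  ring

theorem crossC_clm_apply (L : ℂ →L[ℝ] ℂ) (v : ℂ) :
    crossC (L v) (L (Complex.I * v)) = ‖v‖ ^ 2 * crossC (L 1) (L Complex.I) := by
  rw [clm_apply_eq L v, clm_apply_eq L (Complex.I * v), ← Complex.normSq_eq_norm_sq,
    Complex.normSq_apply]
  simp [crossC]
  ring

/-- Polar coordinates. -/
def polar (x : ℝ × ℝ) : ℂ := x.1 * cpt x.2

theorem norm_polar (x : ℝ × ℝ) : ‖polar x‖ = |x.1| := by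
  simp [polar, norm_cpt]

theorem continuous_polar : Continuous polar :=
  (Complex.continuous_ofReal.comp continuous_fst).mul (continuous_cpt.comp continuous_snd)

theorem hasFDerivAt_cpt_snd (x : ℝ × ℝ) :
    HasFDerivAt (fun x : ℝ × ℝ => cpt x.2)
      ((ContinuousLinearMap.snd ℝ ℝ ℝ).smulRight (Complex.I * cpt x.2)) x := by
  have := (hasDerivAt_cpt x.2).hasFDerivAt.comp x (hasFDerivAt_snd (p := x))
  refine this.congr_fderiv ?_
  ext
  all_goals simp

theorem hasFDerivAt_polar (x : ℝ × ℝ) :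
    HasFDerivAt polar ((ContinuousLinearMap.fst ℝ ℝ ℝ).smulRight (cpt x.2) +
      (ContinuousLinearMap.snd ℝ ℝ ℝ).smulRight (Complex.I * polar x)) x := by
  have h1 : HasFDerivAt (fun x : ℝ × ℝ => x.1 • cpt x.2) _ x :=
    (hasFDerivAt_fst (p := x)).smul (hasFDerivAt_cpt_snd x)
  refine (h1.congr_fderiv ?_).congr_of_eventuallyEq
    (Eventually.of_forall fun y => by simp [polar])
  ext <;> (simp [polar]; try ring)

/-- The area enclosed by the image of the circle is the integral of the Jacobian determinant. -/
theorem integral_crossC_eq (h1 : ContDiffOn ℝ 1 φ (closedBall 0 1))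
    (h2 : ContDiffOn ℝ 2 φ (ball 0 1)) :
    ∫ θ in (0 : ℝ)..2 * Real.pi, crossC (φ (cpt θ))
        (fderivWithin ℝ φ (closedBall 0 1) (cpt θ) (Complex.I * cpt θ)) =
      ∫ x in Icc ((0 : ℝ), (0 : ℝ)) (1, 2 * Real.pi),
        2 * x.1 * jacDetWithin φ (closedBall 0 1) (polar x) := by
  set D := fderivWithin ℝ φ (closedBall 0 1) with hD
  set S : Set (ℝ × ℝ) := Icc ((0 : ℝ), (0 : ℝ)) (1, 2 * Real.pi) with hS
  set T : Set (ℝ × ℝ) := Ioo (0 : ℝ) 1 ×ˢ Ioo (0 : ℝ) (2 * Real.pi) with hT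
  set P : ℝ × ℝ → ℝ := fun x => crossCLM (φ (polar x)) (D (polar x) (Complex.I * polar x)) with hP
  set Q : ℝ × ℝ → ℝ := fun x => -crossCLM (φ (polar x)) (D (polar x) (cpt x.2)) with hQ
  set K : ℝ × ℝ → ℝ := fun x => 2 * x.1 * jacDetWithin φ (closedBall 0 1) (polar x) with hK
  have hle : ((0 : ℝ), (0 : ℝ)) ≤ (1, 2 * Real.pi) := ⟨zero_le_one, Real.two_pi_pos.le⟩
  have hmaps : MapsTo polar S (closedBall 0 1) := fun x hx => by
    rw [mem_closedBall_zero_iff, norm_polar, abs_of_nonneg hx.1.1]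
    exact hx.2.1
  have hmapsT : MapsTo polar T (ball 0 1) := fun x hx => by
    rw [mem_ball_zero_iff, norm_polar, abs_of_pos hx.1.1]
    exact hx.1.2
  have hφc : ContinuousOn (fun x => φ (polar x)) S :=
    h1.continuousOn.comp continuous_polar.continuousOn hmaps
  have hDc : ContinuousOn (fun x => D (polar x)) S :=
    (continuousOn_fderivWithin_closedBall h1).comp continuous_polar.continuousOn hmaps
  have hPc : ContinuousOn P S :=
    (crossCLM.continuous.comp_continuousOn hφc).clm_apply
      (hDc.clm_apply (continuous_const.mul continuous_polar).continuousOn)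
  have hQc : ContinuousOn Q S :=
    ((crossCLM.continuous.comp_continuousOn hφc).clm_apply
      (hDc.clm_apply (continuous_cpt.comp continuous_snd).continuousOn)).neg
  have hKc : ContinuousOn K S :=
    (continuous_const.mul continuous_fst).continuousOn.mul
      ((continuousOn_jacDetWithin h1).comp continuous_polar.continuousOn hmaps)
  have hder : ∀ x ∈ T, ∃ P' Q' : ℝ × ℝ →L[ℝ] ℝ, HasFDerivAt P P' x ∧ HasFDerivAt Q Q' x ∧
      P' (1, 0) + Q' (0, 1) = K x := by
    intro x hx
    have hpx := hmapsT hx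
    have h3 : HasFDerivAt (fun x => φ (polar x)) _ x :=
      ((hasFDerivWithinAt_closedBall h1 (ball_subset_closedBall hpx)).hasFDerivAt
        (closedBall_mem_nhds_of_mem_unitBall hpx)).comp x (hasFDerivAt_polar x)
    have h4 : HasFDerivAt (fun x => D (polar x)) _ x :=
      (hasFDerivAt_fderivWithin_closedBall h2 hpx).comp x (hasFDerivAt_polar x)
    have hB : HasFDerivAt (fun x => D (polar x) (Complex.I * polar x)) _ x :=
      h4.clm_apply ((hasFDerivAt_polar x).const_mul Complex.I)
    have hA : HasFDerivAt (fun x => D (polar x) (cpt x.2)) _ x :=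
      h4.clm_apply (hasFDerivAt_cpt_snd x)
    refine ⟨_, _, crossCLM.hasFDerivAt_of_bilinear h3 hB,
      (crossCLM.hasFDerivAt_of_bilinear h3 hA).neg, ?_⟩
    have hsymm := second_fderiv_symm h2 hpx (cpt x.2) (Complex.I * polar x)
    have hanti : crossC (D (polar x) (Complex.I * polar x)) (D (polar x) (cpt x.2)) =
        -crossC (D (polar x) (cpt x.2)) (D (polar x) (Complex.I * polar x)) := by
      unfold crossC; ring
    have hdet : crossC (D (polar x) (cpt x.2)) (D (polar x) (Complex.I * polar x)) =
        x.1 * jacDetWithin φ (closedBall 0 1) (polar x) := by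
      have h5 : Complex.I * polar x = x.1 • (Complex.I * cpt x.2) := by
        simp [polar]; ring
      have h6 := crossC_clm_apply (D (polar x)) (cpt x.2)
      rw [norm_cpt, one_pow, one_mul] at h6
      rw [h5, map_smul, jacDetWithin, ← h6]
      simp [crossC]
      ring
    simp only [ContinuousLinearMap.compL_apply, ContinuousLinearMap.precompR_apply,
      ContinuousLinearMap.precompL_apply, add_apply, neg_apply,
      ContinuousLinearMap.comp_apply, ContinuousLinearMap.flip_apply,
      ContinuousLinearMap.smulRight_apply, ContinuousLinearMap.coe_fst',
      ContinuousLinearMap.coe_snd', smul_apply, one_smul, zero_smul, add_zero, zero_add,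
      smul_eq_mul, hsymm, map_add, crossCLM_apply, hanti, hdet, hK, ← hD]
    ring
  choose! P' Q' hP' hQ' hPQ using hder
  have hdiv : ∀ x,
      (if x ∈ T then P' x else (ContinuousLinearMap.fst ℝ ℝ ℝ).smulRight (K x)) (1, 0) +
      (if x ∈ T then Q' x else 0) (0, 1) = K x := fun x => by
    split_ifs with hx
    · exact hPQ x hx
    · simp
  have key := MeasureTheory.integral_divergence_prod_Icc_of_hasFDerivAt_of_le P Q
    (fun x => if x ∈ T then P' x else (ContinuousLinearMap.fst ℝ ℝ ℝ).smulRight (K x))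
    (fun x => if x ∈ T then Q' x else 0) (0, 0) (1, 2 * Real.pi) hle hPc hQc
    (fun x hx => by rw [if_pos hx]; exact hP' x hx)
    (fun x hx => by rw [if_pos hx]; exact hQ' x hx)
    (by simpa only [hdiv] using hKc.integrableOn_compact isCompact_Icc)
  have hQper : ∀ r : ℝ, Q (r, 2 * Real.pi) = Q (r, 0) := fun r => by
    have := cpt_add_two_pi 0
    rw [zero_add] at this
    simp only [hQ, polar, this]
  have hP0 : ∀ θ : ℝ, P (0, θ) = 0 := fun θ => by simp [hP, polar]
  have hP1 : ∀ θ : ℝ, P (1, θ) = crossC (φ (cpt θ)) (D (cpt θ) (Complex.I * cpt θ)) := fun θ => by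
    simp [hP, polar, crossCLM_apply]
  simp only [hdiv, hQper, hP0, hP1, sub_self, zero_add, intervalIntegral.integral_zero,
    sub_zero] at key
  exact key.symm

end Area

theorem cpt_eq_of_eq {γ : ℝ → ℂ} (hγper : ∀ θ, γ (θ + 2 * Real.pi) = γ θ)
    (hγinj : InjOn γ (Ico 0 (2 * Real.pi))) {a b : ℝ} (h : γ a = γ b) : cpt a = cpt b := by
  obtain ⟨n, rfl⟩ := exists_int_of_eq hγper hγinj h
  exact ((Function.Periodic.int_mul cpt_add_two_pi n) a).symm

theorem jacDetWithin_ne_zero_of_leftInverse {φ ψ : ℂ → ℂ} {s : Set ℂ}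
    (h1 : ContDiffOn ℝ 1 φ (closedBall 0 1)) (hψ : ContDiffOn ℝ 1 ψ s)
    (hmaps : MapsTo φ (closedBall 0 1) s) (hleft : ∀ z ∈ closedBall (0 : ℂ) 1, ψ (φ z) = z)
    {z : ℂ} (hz : z ∈ closedBall (0 : ℂ) 1) : jacDetWithin φ (closedBall 0 1) z ≠ 0 := by
  intro h
  have h2 := ((hψ.differentiableOn one_ne_zero (φ z) (hmaps hz)).hasFDerivWithinAt.comp z
    (hasFDerivWithinAt_closedBall h1 hz) hmaps).congr (f₁ := id)
    (fun w hw => (hleft w hw).symm) (hleft z hz).symm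
  have h3 := (uniqueDiffOn_closedBall z hz).eq h2 (hasFDerivWithinAt_id z _)
  have hker : ∀ v, fderivWithin ℝ φ (closedBall 0 1) z v = 0 → v = 0 := fun v hv => by
    have h4 := congrArg (· v) h3
    simpa [hv] using h4.symm
  set L := fderivWithin ℝ φ (closedBall 0 1) z
  have h5 : ∀ a b : ℝ, a * L 1 + b * L Complex.I = 0 → a = 0 ∧ b = 0 := fun a b hab => by
    have := hker ⟨a, b⟩ (by rw [clm_apply_eq]; exact hab)
    exact ⟨congrArg Complex.re this, congrArg Complex.im this⟩
  unfold jacDetWithin crossC at h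
  have h6 := h5 (L Complex.I).re (-(L 1).re) (by
    apply Complex.ext <;> simp <;> linarith)
  have h7 := h5 (L Complex.I).im (-(L 1).im) (by
    apply Complex.ext <;> simp <;> linarith)
  have h8 : L 1 = 0 := Complex.ext (neg_eq_zero.1 h6.2) (neg_eq_zero.1 h7.2)
  exact one_ne_zero (hker 1 h8)

/-- Alessandrini–Nesi, Theorem 3 of the paper. `γ` is an orientation
preserving `C¹` diffeomorphism of the unit circle onto the simple closed curve `Γ = ∂Ω`
(continuous `2π`-periodic parametrization, injective on a period, range `frontier Ω`,
`C¹` with nonvanishing derivative, traversed counter-clockwise: positive signed area), and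
`φ ∈ C²(𝔹) ∩ C¹(cl 𝔹)` is the harmonic extension of `γ`. Then `φ` is a diffeomorphism of
`cl 𝔹` onto `cl Ω` (a bijection of `cl 𝔹` onto `cl Ω` — which is automatically a
homeomorphism — admitting a `C¹` inverse; `φ` itself is `C¹` by hypothesis) if and only if
`det Dφ > 0` everywhere on `∂𝔹`. -/
theorem alessandrini_nesi
    (Ω : Set ℂ) (γ : ℝ → ℂ) (φ : ℂ → ℂ)
    (hΩo : IsOpen Ω) (hΩb : Bornology.IsBounded Ω)
    (hγc : Continuous γ) (hγper : ∀ θ, γ (θ + 2 * Real.pi) = γ θ)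
    (hγinj : Set.InjOn γ (Set.Ico 0 (2 * Real.pi)))
    (hγrange : Set.range γ = frontier Ω)
    (hγC1 : ContDiff ℝ 1 γ) (hγ'0 : ∀ θ, deriv γ θ ≠ 0)
    (horient : 0 < ∫ θ in (0:ℝ)..(2 * Real.pi), crossC (γ θ) (deriv γ θ))
    (hφcont : ContinuousOn φ (closedBall (0 : ℂ) 1))
    (hφC2 : ContDiffOn ℝ 2 φ (ball (0 : ℂ) 1))
    (hφC1 : ContDiffOn ℝ 1 φ (closedBall (0 : ℂ) 1))
    (hφharm : HarmonicOn2 φ (ball (0 : ℂ) 1))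
    (hφbd : ∀ θ : ℝ, φ (cpt θ) = γ θ) :
    (Set.BijOn φ (closedBall (0 : ℂ) 1) (closure Ω) ∧
      ∃ ψ : ℂ → ℂ, ContDiffOn ℝ 1 ψ (closure Ω) ∧
        ∀ z ∈ closedBall (0 : ℂ) 1, ψ (φ z) = z) ↔
      ∀ θ : ℝ, 0 < jacDetWithin φ (closedBall (0 : ℂ) 1) (cpt θ) := by
  have hγ' : ∀ θ, deriv γ θ =
      fderivWithin ℝ φ (closedBall 0 1) (cpt θ) (Complex.I * cpt θ) := fun θ => by
    rw [← (hasDerivAt_comp_cpt hφC1 θ).deriv, funext hφbd]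
  constructor
  · rintro ⟨hbij, ψ, hψ, hleft⟩ θ
    have hne : ∀ z ∈ closedBall (0 : ℂ) 1, jacDetWithin φ (closedBall 0 1) z ≠ 0 := fun z hz =>
      jacDetWithin_ne_zero_of_leftInverse hφC1 hψ hbij.mapsTo hleft hz
    by_contra hneg
    have hle : ∀ z ∈ closedBall (0 : ℂ) 1, jacDetWithin φ (closedBall 0 1) z ≤ 0 := by
      intro z hz
      by_contra! hpos
      obtain ⟨w, hw, hw0⟩ := (convex_closedBall (0 : ℂ) 1).isPreconnected.intermediate_value
        (cpt_mem_closedBall θ) hz (continuousOn_jacDetWithin hφC1)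
        (show (0 : ℝ) ∈ Icc _ _ from ⟨not_lt.1 hneg, hpos.le⟩)
      exact hne w hw hw0
    have harea := integral_crossC_eq hφC1 hφC2
    simp only [hφbd, ← hγ'] at harea
    rw [harea] at horient
    refine horient.not_ge (MeasureTheory.setIntegral_nonpos measurableSet_Icc fun x hx => ?_)
    refine mul_nonpos_of_nonneg_of_nonpos (mul_nonneg zero_le_two hx.1.1) (hle _ ?_)
    rw [mem_closedBall_zero_iff, norm_polar, abs_of_nonneg hx.1.1]
    exact hx.2.1
  · intro hpos
    have hne : ∀ z ∈ closedBall (0 : ℂ) 1, jacDetWithin φ (closedBall 0 1) z ≠ 0 := fun z hz =>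
      (jacDetWithin_pos hγper hγinj hγC1 hγ'0 hφC1 hφC2 hφharm hφbd hpos hz).ne'
    have hinj : InjOn φ (closedBall 0 1) := injOn_closedBall_of_jacDetWithin_ne_zero hφC1 hne
      fun a b hab => cpt_eq_of_eq hγper hγinj (by rwa [← hφbd, ← hφbd])
    have himage : φ '' closedBall 0 1 = closure Ω :=
      image_closedBall_eq_closure hΩo hΩb hφcont hinj (by rw [funext hφbd, hγrange])
    refine ⟨himage ▸ hinj.bijOn_image, ?_⟩
    rw [← himage]
    exact exists_contDiffOn_leftInverse hφC1 hne hinj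
end
end

section
/- (Alessandrini–Nesi, local-to-global) Let γ : ∂𝔹 → Γ be a homeomorphism of the unit circle onto a simple closed curve Γ = ∂Ω enclosing a bounded set Ω ⊂ ℝ², and let φ ∈ W¹,²_loc(𝔹, ℝ²) ∩ C(cl(𝔹), ℝ²) be the harmonic extension of γ (the solution of Δφ = 0 in 𝔹 with φ = γ on ∂𝔹). Then φ is a homeomorphism of cl(𝔹) onto cl(Ω) if and only if, for every point e^{iθ} ∈ ∂𝔹, the map φ is a local homeomorphism at e^{iθ}, meaning there exists a neighborhood of e^{iθ} in cl(𝔹) on which φ is injective. -/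
noncomputable section

open Set Metric Filter

open scoped Topology

/-- A homotopy of nonvanishing functions on a compact set changes the function by a factor with a
continuous logarithm. -/
theorem exists_log_homotopy {E : Type*} [PseudoMetricSpace E] {K : Set E} (hK : IsCompact K)
    {H : ℝ → E → ℂ} (hc : ContinuousOn (fun p : ℝ × E => H p.1 p.2) (Icc 0 1 ×ˢ K))
    (h0 : ∀ t ∈ Icc (0 : ℝ) 1, ∀ x ∈ K, H t x ≠ 0) :
    ∃ k : E → ℂ, ContinuousOn k K ∧ (∀ x ∈ K, H 1 x = H 0 x * Complex.exp (k x)) ∧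
      ∀ x ∈ K, ∀ y ∈ K, (∀ t ∈ Icc (0 : ℝ) 1, H t x = H t y) → k x = k y := by
  have hcomp : IsCompact (Icc (0 : ℝ) 1 ×ˢ K) := isCompact_Icc.prod hK
  obtain ⟨m, hm, hmle⟩ : ∃ m > 0, ∀ p ∈ Icc (0 : ℝ) 1 ×ˢ K, m ≤ ‖H p.1 p.2‖ := by
    rcases (Icc (0 : ℝ) 1 ×ˢ K).eq_empty_or_nonempty with he | hne
    · exact ⟨1, one_pos, by simp [he]⟩
    · obtain ⟨p, hp, hmin⟩ := hcomp.exists_isMinOn hne hc.norm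
      exact ⟨_, norm_pos_iff.2 (h0 _ hp.1 _ hp.2), fun q hq => hmin hq⟩
  obtain ⟨δ, hδ, hu⟩ := Metric.uniformContinuousOn_iff.1
    (hcomp.uniformContinuousOn_of_continuous hc) m hm
  obtain ⟨n, hn⟩ := exists_nat_one_div_lt hδ
  set N := n + 1 with hN
  have hNpos : (0 : ℝ) < N := by positivity
  have hmem : ∀ j ≤ N, ((j : ℝ) / N) ∈ Icc (0 : ℝ) 1 := fun j hj =>
    ⟨by positivity, (div_le_one hNpos).2 (by exact_mod_cast hj)⟩
  let r : ℕ → E → ℂ := fun j x => H ((j + 1 : ℕ) / N) x / H ((j : ℕ) / N) x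
  have hr : ∀ j < N, ∀ x ∈ K, r j x ∈ Complex.slitPlane := by
    intro j hj x hx
    have h1 := h0 _ (hmem j hj.le) x hx
    have hd : dist (H ((j + 1 : ℕ) / N) x) (H ((j : ℕ) / N) x) < m := by
      refine hu (_, x) ⟨hmem _ hj, hx⟩ (_, x) ⟨hmem _ hj.le, hx⟩ ?_
      simp only [Prod.dist_eq, dist_self, Real.dist_eq]
      have : ((j + 1 : ℕ) : ℝ) / N - (j : ℝ) / N = 1 / N := by push_cast; ring
      rw [this, abs_of_pos (by positivity)]
      simpa [hN, hδ] using hn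
    have hlt : ‖r j x - 1‖ < 1 := by
      have : r j x - 1 = (H ((j + 1 : ℕ) / N) x - H ((j : ℕ) / N) x) / H ((j : ℕ) / N) x := by
        simp only [r]; field_simp
      rw [this, norm_div, div_lt_one (norm_pos_iff.2 h1), ← dist_eq_norm]
      exact hd.trans_le (hmle (_, x) ⟨hmem _ hj.le, hx⟩)
    have : r j x ∈ ball (1 : ℂ) 1 := by simpa [dist_eq_norm] using hlt
    exact Complex.ball_one_subset_slitPlane this
  have hslice : ∀ j ≤ N, ContinuousOn (fun x => H ((j : ℕ) / N) x) K := fun j hj =>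
    hc.comp (f := fun x => (((j : ℝ) / N), x)) (by fun_prop) fun x hx => ⟨hmem j hj, hx⟩
  refine ⟨fun x => ∑ j ∈ Finset.range N, Complex.log (r j x), ?_, ?_, ?_⟩
  · refine continuousOn_finsetSum _ fun j hj => ?_
    have hj := Finset.mem_range.1 hj
    exact ((hslice _ hj).div (hslice _ hj.le) fun x hx => h0 _ (hmem _ hj.le) x hx).clog (hr j hj)
  · intro x hx
    have : ∀ M ≤ N, H ((M : ℕ) / N) x
        = H 0 x * Complex.exp (∑ j ∈ Finset.range M, Complex.log (r j x)) := by
      intro M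
      induction M with
      | zero => simp
      | succ M ih =>
        intro hM
        have h1 := h0 _ (hmem M (Nat.le_of_succ_le hM)) x hx
        rw [Finset.sum_range_succ, Complex.exp_add, ← mul_assoc, ← ih (Nat.le_of_succ_le hM),
          Complex.exp_log (Complex.slitPlane_ne_zero (hr M hM x hx))]
        simp only [r]
        field_simp
    simpa [hNpos.ne'] using this N le_rfl
  · intro x _ y _ hxy
    refine Finset.sum_congr rfl fun j hj => ?_
    have hj := Finset.mem_range.1 hj
    simp only [r]
    rw [hxy _ (hmem _ hj), hxy _ (hmem _ hj.le)]

/-- `HasWinding c n`: the nonvanishing loop `c`, parametrized by `[0, 2π]`, winds `n` times around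
the origin. -/
def HasWinding (c : ℝ → ℂ) (n : ℤ) : Prop :=
  ∃ k : ℝ → ℂ, ContinuousOn k (Icc 0 (2 * Real.pi)) ∧
    (∀ s ∈ Icc 0 (2 * Real.pi), c s = Complex.exp (k s)) ∧
    k (2 * Real.pi) = k 0 + n * (2 * Real.pi * Complex.I)

namespace HasWinding

variable {c c' : ℝ → ℂ} {m n : ℤ}

theorem congr (h : HasWinding c n) (hcc : ∀ s ∈ Icc 0 (2 * Real.pi), c' s = c s) :
    HasWinding c' n := by
  obtain ⟨k, h1, h2, h3⟩ := h
  exact ⟨k, h1, fun s hs => (hcc s hs).trans (h2 s hs), h3⟩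

theorem mul (h : HasWinding c n) (h' : HasWinding c' m) :
    HasWinding (fun s => c s * c' s) (n + m) := by
  obtain ⟨k, h1, h2, h3⟩ := h
  obtain ⟨k', h1', h2', h3'⟩ := h'
  refine ⟨fun s => k s + k' s, h1.add h1', fun s hs => ?_, ?_⟩
  · simp only [h2 s hs, h2' s hs, Complex.exp_add]
  · simp only [h3, h3']; push_cast; ring

theorem div (h : HasWinding c n) (h' : HasWinding c' m) :
    HasWinding (fun s => c s / c' s) (n - m) := by
  obtain ⟨k, h1, h2, h3⟩ := h
  obtain ⟨k', h1', h2', h3'⟩ := h'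
  refine ⟨fun s => k s - k' s, h1.sub h1', fun s hs => ?_, ?_⟩
  · simp only [h2 s hs, h2' s hs, Complex.exp_sub]
  · simp only [h3, h3']; push_cast; ring

theorem const {a : ℂ} (ha : a ≠ 0) : HasWinding (fun _ => a) 0 :=
  ⟨fun _ => Complex.log a, by fun_prop, fun _ _ => (Complex.exp_log ha).symm, by simp⟩

theorem unique (h : HasWinding c n) (h' : HasWinding c m) : n = m := by
  obtain ⟨k, h1, h2, h3⟩ := h.div h'
  have hpi := Real.two_pi_pos
  obtain ⟨k, hk, hexp, hend⟩ : HasWinding (fun _ => 1) (n - m) := by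
    refine (h.div h').congr fun s hs => ?_
    obtain ⟨l, -, hl, -⟩ := h
    rw [hl s hs, div_self (Complex.exp_ne_zero _)]
  have hint : ∀ s ∈ Icc 0 (2 * Real.pi), ∃ j : ℤ, k s / (2 * Real.pi * Complex.I) = j := by
    intro s hs
    obtain ⟨j, hj⟩ := Complex.exp_eq_one_iff.1 (hexp s hs).symm
    exact ⟨j, by rw [hj, mul_div_cancel_right₀ _ Complex.two_pi_I_ne_zero]⟩
  choose! j hj using hint
  have hjc : ContinuousOn j (Icc 0 (2 * Real.pi)) := by
    have h1 : ContinuousOn (fun s => ((j s : ℤ) : ℂ)) (Icc 0 (2 * Real.pi)) :=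
      (hk.div_const _).congr fun s hs => (hj s hs).symm
    exact Complex.isClosedEmbedding_intCast.isInducing.continuousOn_iff.2 h1
  have hcst := isPreconnected_Icc.constant hjc (x := 0) (y := 2 * Real.pi)
    (left_mem_Icc.2 hpi.le) (right_mem_Icc.2 hpi.le)
  have e0 := hj 0 (left_mem_Icc.2 hpi.le)
  have e1 := hj _ (right_mem_Icc.2 hpi.le)
  rw [hend, add_div, mul_div_cancel_right₀ _ Complex.two_pi_I_ne_zero, e0, ← hcst] at e1
  have : ((n - m : ℤ) : ℂ) = 0 := by linear_combination e1
  have : n - m = 0 := by exact_mod_cast this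
  omega

theorem homotopy {H : ℝ → ℝ → ℂ}
    (hc : ContinuousOn (fun p : ℝ × ℝ => H p.1 p.2) (Icc 0 1 ×ˢ Icc 0 (2 * Real.pi)))
    (h0 : ∀ t ∈ Icc (0 : ℝ) 1, ∀ s ∈ Icc 0 (2 * Real.pi), H t s ≠ 0)
    (hper : ∀ t ∈ Icc (0 : ℝ) 1, H t 0 = H t (2 * Real.pi)) :
    HasWinding (H 0) n ↔ HasWinding (H 1) n := by
  obtain ⟨k, hk, hexp, hend⟩ := exists_log_homotopy isCompact_Icc hc h0
  have hpi := Real.two_pi_pos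
  have hw : HasWinding (fun s => Complex.exp (k s)) 0 :=
    ⟨k, hk, fun _ _ => rfl, by
      simpa using (hend 0 (left_mem_Icc.2 hpi.le) _ (right_mem_Icc.2 hpi.le) hper).symm⟩
  constructor
  · intro h
    simpa using (h.mul hw).congr hexp
  · intro h
    have := (h.div hw).congr (c' := H 0) fun s hs => by
      rw [hexp s hs, mul_div_cancel_right₀ _ (Complex.exp_ne_zero _)]
    simpa using this

/-- Dog on a leash: a loop that stays closer to `c` than `c` stays to the origin winds as `c`. -/
theorem of_norm_sub_lt (h : HasWinding c n) (hc : ContinuousOn c' (Icc 0 (2 * Real.pi)))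
    (hper : c' 0 = c' (2 * Real.pi))
    (hlt : ∀ s ∈ Icc 0 (2 * Real.pi), ‖c' s - c s‖ < ‖c s‖) : HasWinding c' n := by
  have hpi := Real.two_pi_pos
  have hcc : ContinuousOn c (Icc 0 (2 * Real.pi)) := by
    obtain ⟨k, h1, h2, -⟩ := h
    exact h1.cexp.congr h2
  have hcper : c 0 = c (2 * Real.pi) := by
    obtain ⟨k, -, h2, h3⟩ := h
    rw [h2 _ (left_mem_Icc.2 hpi.le), h2 _ (right_mem_Icc.2 hpi.le), h3]
    exact Complex.exp_eq_exp_iff_exists_int.2 ⟨-n, by push_cast; ring⟩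
  have := homotopy (n := n) (H := fun t s => c s + t * (c' s - c s)) ?_ ?_ ?_
  · simpa using this.1 (by simpa using h)
  · have h1 : ContinuousOn (fun p : ℝ × ℝ => c p.2) (Icc 0 1 ×ˢ Icc 0 (2 * Real.pi)) :=
      hcc.comp continuousOn_snd fun p hp => hp.2
    have h2 : ContinuousOn (fun p : ℝ × ℝ => c' p.2) (Icc 0 1 ×ˢ Icc 0 (2 * Real.pi)) :=
      hc.comp continuousOn_snd fun p hp => hp.2
    exact h1.add (ContinuousOn.mul (by fun_prop) (h2.sub h1))
  · intro t ht s hs h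
    have h1 : ‖c s‖ = ‖(t : ℂ) * (c' s - c s)‖ := by
      rw [← norm_neg (_ * _), ← eq_neg_of_add_eq_zero_left h]
    have h2 : ‖(t : ℂ) * (c' s - c s)‖ ≤ ‖c' s - c s‖ := by
      rw [norm_mul, Complex.norm_real, Real.norm_of_nonneg ht.1]
      exact mul_le_of_le_one_left (norm_nonneg _) ht.2
    linarith [hlt s hs]
  · intro t _
    simp only [hcper, hper]

theorem circleMap_zero {r : ℝ} (hr : 0 < r) : HasWinding (circleMap 0 r) 1 := by
  refine ⟨fun s => Real.log r + s * Complex.I, by fun_prop, fun s _ => ?_, ?_⟩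
  · rw [Complex.exp_add, ← Complex.ofReal_exp, Real.exp_log hr]; simp [circleMap]
  · push_cast; ring

end HasWinding

theorem circleMap_zero_two_pi (a : ℂ) (r : ℝ) : circleMap a r 0 = circleMap a r (2 * Real.pi) := by
  simpa using (periodic_circleMap a r 0).symm

/-- A nonvanishing function on a torus: the winding number along the diagonal is the sum of the
winding numbers along the two factors. -/
theorem HasWinding.diagonal {F : ℝ → ℝ → ℂ} {m n : ℤ}
    (hc : ContinuousOn (fun p : ℝ × ℝ => F p.1 p.2) (Icc 0 (2 * Real.pi) ×ˢ Icc 0 (2 * Real.pi)))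
    (h0 : ∀ s ∈ Icc 0 (2 * Real.pi), ∀ t ∈ Icc 0 (2 * Real.pi), F s t ≠ 0)
    (hper : ∀ t ∈ Icc 0 (2 * Real.pi), F 0 t = F (2 * Real.pi) t)
    (h1 : HasWinding (fun s => F s 0) m) (h2 : HasWinding (F 0) n) :
    HasWinding (fun s => F s s) (m + n) := by
  have hpi := Real.two_pi_pos
  have l0 : (0 : ℝ) ∈ Icc 0 (2 * Real.pi) := left_mem_Icc.2 hpi.le
  have r0 : 2 * Real.pi ∈ Icc 0 (2 * Real.pi) := right_mem_Icc.2 hpi.le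
  have hmem : ∀ t ∈ Icc (0 : ℝ) 1, ∀ s ∈ Icc 0 (2 * Real.pi), t * s ∈ Icc 0 (2 * Real.pi) :=
    fun t ht s hs => ⟨mul_nonneg ht.1 hs.1, (mul_le_of_le_one_left hs.1 ht.2).trans hs.2⟩
  obtain ⟨k, hk, hexp, -⟩ := exists_log_homotopy (K := Icc 0 (2 * Real.pi) ×ˢ Icc 0 (2 * Real.pi))
    (isCompact_Icc.prod isCompact_Icc) (H := fun t (p : ℝ × ℝ) => F (t * p.1) (t * p.2))
    (hc.comp (f := fun q : ℝ × ℝ × ℝ => (q.1 * q.2.1, q.1 * q.2.2)) (by fun_prop)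
      fun p hp => ⟨hmem _ hp.1 _ hp.2.1, hmem _ hp.1 _ hp.2.2⟩)
    fun t ht p hp => h0 _ (hmem t ht _ hp.1) _ (hmem t ht _ hp.2)
  simp only [one_mul, zero_mul] at hexp
  have h00 := h0 _ l0 _ l0
  have key : ∀ {c : ℝ → ℝ × ℝ} {N : ℤ}, ContinuousOn c (Icc 0 (2 * Real.pi)) →
      MapsTo c (Icc 0 (2 * Real.pi)) (Icc 0 (2 * Real.pi) ×ˢ Icc 0 (2 * Real.pi)) →
      (k (c (2 * Real.pi)) = k (c 0) + N * (2 * Real.pi * Complex.I)) →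
      HasWinding (fun s => F (c s).1 (c s).2) N := by
    intro c N hcc hcm hN
    refine ⟨fun s => Complex.log (F 0 0) + k (c s), ?_, ?_, ?_⟩
    · have := hk.comp hcc hcm
      exact continuousOn_const.add this
    · intro s hs
      simp only [hexp _ (hcm hs), Complex.exp_add, Complex.exp_log h00]
    · simp only [hN]; ring
  have hint : ∀ p ∈ Icc 0 (2 * Real.pi) ×ˢ Icc 0 (2 * Real.pi),
      ∀ q ∈ Icc 0 (2 * Real.pi) ×ˢ Icc 0 (2 * Real.pi), F p.1 p.2 = F q.1 q.2 →
      ∃ N : ℤ, k p = k q + N * (2 * Real.pi * Complex.I) := by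
    intro p hp q hq hpq
    rw [hexp p hp, hexp q hq] at hpq
    exact Complex.exp_eq_exp_iff_exists_int.1 (mul_left_cancel₀ h00 hpq)
  have hper2 : F 0 0 = F 0 (2 * Real.pi) := by
    obtain ⟨k', -, e, e'⟩ := h2
    rw [e _ l0, e _ r0, e']
    exact Complex.exp_eq_exp_iff_exists_int.2 ⟨-n, by push_cast; ring⟩
  obtain ⟨a, ha⟩ := hint (2 * Real.pi, 0) ⟨r0, l0⟩ (0, 0) ⟨l0, l0⟩ (hper 0 l0).symm
  obtain ⟨b, hb⟩ := hint (0, 2 * Real.pi) ⟨l0, r0⟩ (0, 0) ⟨l0, l0⟩ hper2.symm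
  have ea : HasWinding (fun s => F s 0) a :=
    key (c := fun s => (s, 0)) (by fun_prop) (fun s hs => ⟨hs, l0⟩) ha
  have eb : HasWinding (F 0) b :=
    key (c := fun s => (0, s)) (by fun_prop) (fun s hs => ⟨l0, hs⟩) hb
  have hd : ∀ t ∈ Icc 0 (2 * Real.pi), ∃ N : ℤ,
      k (2 * Real.pi, t) = k (0, t) + N * (2 * Real.pi * Complex.I) := fun t ht =>
    hint _ ⟨r0, ht⟩ _ ⟨l0, ht⟩ (hper t ht).symm
  have hw : HasWinding (fun t => F (2 * Real.pi) t) b := eb.congr fun t ht => (hper t ht).symm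
  obtain ⟨b', hb'⟩ := hint (2 * Real.pi, 2 * Real.pi) ⟨r0, r0⟩ (2 * Real.pi, 0) ⟨r0, l0⟩
    (by simp only [← hper _ r0, ← hper _ l0, hper2])
  have eb' : HasWinding (F (2 * Real.pi)) b' :=
    key (c := fun s => (2 * Real.pi, s)) (by fun_prop) (fun s hs => ⟨r0, hs⟩) hb'
  have hbb : b' = b := eb'.unique hw
  have hma := h1.unique ea
  have hnb := h2.unique eb
  refine key (c := fun s => (s, s)) (by fun_prop) (fun s hs => ⟨hs, hs⟩) ?_
  rw [hb', ha, hbb, hma, hnb]; push_cast; ring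

/-- Winding numbers of a nonvanishing function along concentric circles agree. -/
theorem HasWinding.annulus_iff {h : ℂ → ℂ} {r₀ r₁ : ℝ} {n : ℤ} (h0 : 0 ≤ r₀) (h01 : r₀ ≤ r₁)
    (hc : ContinuousOn h (closedBall 0 r₁ \ ball 0 r₀))
    (hne : ∀ z ∈ closedBall 0 r₁ \ ball 0 r₀, h z ≠ 0) :
    HasWinding (fun s => h (circleMap 0 r₀ s)) n ↔ HasWinding (fun s => h (circleMap 0 r₁ s)) n := by
  have hmem : ∀ t ∈ Icc (0 : ℝ) 1, ∀ s : ℝ,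
      circleMap 0 (r₀ + t * (r₁ - r₀)) s ∈ closedBall (0 : ℂ) r₁ \ ball 0 r₀ := by
    intro t ht s
    have h1 : 0 ≤ t * (r₁ - r₀) := mul_nonneg ht.1 (by linarith)
    have h2 : t * (r₁ - r₀) ≤ r₁ - r₀ := mul_le_of_le_one_left (by linarith) ht.2
    simp only [Set.mem_sdiff, mem_closedBall_zero_iff, mem_ball_zero_iff, norm_circleMap_zero,
      abs_of_nonneg (add_nonneg h0 h1)]
    constructor <;> linarith
  have := HasWinding.homotopy (n := n) (H := fun t s => h (circleMap 0 (r₀ + t * (r₁ - r₀)) s))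
    (hc.comp (f := fun p : ℝ × ℝ => circleMap 0 (r₀ + p.1 * (r₁ - r₀)) p.2)
      (by unfold circleMap; fun_prop) fun p hp => hmem _ hp.1 _)
    (fun t ht s _ => hne _ (hmem t ht s)) (fun t _ => by rw [circleMap_zero_two_pi])
  simpa using this

theorem HasWinding.of_closedBall {h : ℂ → ℂ} {r : ℝ} (hr : 0 ≤ r)
    (hc : ContinuousOn h (closedBall 0 r)) (hne : ∀ z ∈ closedBall 0 r, h z ≠ 0) :
    HasWinding (fun s => h (circleMap 0 r s)) 0 := by
  refine (HasWinding.annulus_iff le_rfl hr (by simpa using hc) (by simpa using hne)).1 ?_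
  simpa using HasWinding.const (hne 0 (by simpa using hr))

/-- The function `h` has a zero of positive index at `a`, measured by a model function whose only
zero is `a` and whose winding number along the circle of radius `r` is positive. -/
def HasPositiveIndexAt (r : ℝ) (h : ℂ → ℂ) (a : ℂ) : Prop :=
  ∃ (L : ℂ → ℂ) (c : ℂ) (m : ℤ), Continuous L ∧ (∀ z, L z = 0 ↔ z = a) ∧
    HasWinding (fun s => L (circleMap 0 r s)) m ∧ 1 ≤ m ∧ c ≠ 0 ∧
    Tendsto (fun z => h z / L z) (𝓝[≠] a) (𝓝 c)

theorem HasPositiveIndexAt.eventually_ne {r : ℝ} {h : ℂ → ℂ} {a : ℂ}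
    (ha : HasPositiveIndexAt r h a) : ∀ᶠ z in 𝓝[≠] a, h z ≠ 0 := by
  obtain ⟨L, c, m, -, -, -, -, hc, ht⟩ := ha
  filter_upwards [ht.eventually_ne hc] with z hz h0
  simp [h0] at hz

theorem HasWinding.exists_card_le {r : ℝ} (hr : 0 ≤ r) (S : Finset ℂ) :
    ∀ h : ℂ → ℂ, ContinuousOn h (closedBall 0 r) → (∀ z ∈ closedBall 0 r, h z = 0 ↔ z ∈ S) →
      (∀ a ∈ S, a ∈ ball (0 : ℂ) r) → (∀ a ∈ S, HasPositiveIndexAt r h a) →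
      ∃ N : ℤ, (S.card : ℤ) ≤ N ∧ HasWinding (fun s => h (circleMap 0 r s)) N := by
  classical
  induction S using Finset.induction_on with
  | empty =>
    intro h hc hz _ _
    exact ⟨0, by simp, HasWinding.of_closedBall hr hc fun z hzm => by simp [hz z hzm]⟩
  | insert a S haS ih =>
    intro h hc hz hball hidx
    obtain ⟨L, c, m, hL, hL0, hLw, hm, hc0, ht⟩ := hidx a (Finset.mem_insert_self _ _)
    have hne : ∀ {z}, z ≠ a → L z ≠ 0 := fun hz h => hz ((hL0 _).1 h)
    have ha := hball a (Finset.mem_insert_self _ _)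
    have hac : a ∈ closedBall (0 : ℂ) r := ball_subset_closedBall ha
    set h1 := Function.update (fun z => h z / L z) a c with hh1
    have hmul : ∀ z ∈ closedBall 0 r, h z = h1 z * L z := by
      intro z hzm
      by_cases hza : z = a
      · rw [(hL0 z).2 hza, mul_zero, hz z hzm, hza]; exact Finset.mem_insert_self _ _
      · rw [hh1, Function.update_of_ne hza, div_mul_cancel₀ _ (hne hza)]
    have hc1 : ContinuousOn h1 (closedBall 0 r) := by
      rw [hh1, continuousOn_update_iff]
      exact ⟨(hc.mono sdiff_subset).div hL.continuousOn fun z hz => hne hz.2, fun _ =>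
        ht.mono_left (nhdsWithin_mono _ fun z hz => hz.2)⟩
    have hz1 : ∀ z ∈ closedBall 0 r, h1 z = 0 ↔ z ∈ S := by
      intro z hzm
      by_cases hza : z = a
      · subst hza; simp [hh1, hc0, haS]
      · have h2 := hz z hzm
        rw [hmul z hzm, mul_eq_zero, or_iff_left (hne hza), Finset.mem_insert,
          or_iff_right hza] at h2
        exact h2
    have hidx1 : ∀ b ∈ S, HasPositiveIndexAt r h1 b := by
      intro b hb
      have hba : b ≠ a := fun h => haS (h ▸ hb)
      obtain ⟨L', c', m', hL', hL0', hLw', hm', hc0', ht'⟩ :=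
        hidx b (Finset.mem_insert_of_mem hb)
      refine ⟨L', c' / L b, m', hL', hL0', hLw', hm', div_ne_zero hc0' (hne hba), ?_⟩
      have h2 : Tendsto (fun z => h z / L' z / L z) (𝓝[≠] b) (𝓝 (c' / L b)) :=
        ht'.div (hL.continuousAt.tendsto.mono_left nhdsWithin_le_nhds) (hne hba)
      refine h2.congr' ?_
      filter_upwards [nhdsWithin_le_nhds (isOpen_ne.mem_nhds hba)] with z hz
      rw [hh1, Function.update_of_ne hz]
      ring
    obtain ⟨N, hN, hw⟩ := ih h1 hc1 hz1 (fun b hb => hball b (Finset.mem_insert_of_mem hb)) hidx1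
    refine ⟨N + m, ?_, (hw.mul hLw).congr fun s _ => hmul _ ?_⟩
    · rw [Finset.card_insert_of_notMem haS]; push_cast; linarith
    · simp [abs_of_nonneg hr]

/-- If all zeros in a closed disc are interior and of positive index, then their number is at most
the winding number along the boundary circle. -/
theorem HasWinding.exists_zeros_card_le {r : ℝ} (hr : 0 ≤ r) {h : ℂ → ℂ}
    (hc : ContinuousOn h (closedBall 0 r))
    (hz : ∀ a ∈ closedBall 0 r, h a = 0 → a ∈ ball (0 : ℂ) r ∧ HasPositiveIndexAt r h a) :
    ∃ (S : Finset ℂ) (N : ℤ), (∀ z, z ∈ S ↔ z ∈ closedBall 0 r ∧ h z = 0) ∧ (S.card : ℤ) ≤ N ∧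
      HasWinding (fun s => h (circleMap 0 r s)) N := by
  have hcl : IsClosed (closedBall 0 r ∩ h ⁻¹' {0}) :=
    hc.preimage_isClosed_of_isClosed isClosed_closedBall isClosed_singleton
  have hcomp : IsCompact (closedBall 0 r ∩ h ⁻¹' {0}) :=
    (isCompact_closedBall 0 r).of_isClosed_subset hcl inter_subset_left
  have hfin : (closedBall 0 r ∩ h ⁻¹' {0}).Finite := by
    refine hcomp.finite ?_
    rw [isDiscrete_iff_nhdsNE]
    intro a ha
    rw [← disjoint_iff, disjoint_principal_right]
    filter_upwards [(hz a ha.1 ha.2).2.eventually_ne] with z hz hzz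
    exact hz hzz.2
  have hS : ∀ z, z ∈ hfin.toFinset ↔ z ∈ closedBall 0 r ∧ h z = 0 := fun z => by simp
  obtain ⟨N, hN, hw⟩ := HasWinding.exists_card_le hr hfin.toFinset h hc
    (fun z hzm => by rw [hS]; exact ⟨fun h => ⟨hzm, h⟩, fun h => h.2⟩)
    (fun a ha => (hz a ((hS a).1 ha).1 ((hS a).1 ha).2).1)
    (fun a ha => (hz a ((hS a).1 ha).1 ((hS a).1 ha).2).2)
  exact ⟨_, N, hS, hN, hw⟩

theorem HasWinding.circleMap_sub {r : ℝ} {a : ℂ} (ha : ‖a‖ < r) :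
    HasWinding (fun s => circleMap 0 r s - a) 1 := by
  have hr : 0 < r := (norm_nonneg a).trans_lt ha
  refine (HasWinding.circleMap_zero hr).of_norm_sub_lt (by fun_prop) ?_ ?_
  · simp only [circleMap_zero_two_pi 0 r]
  · intro s _
    simpa [abs_of_pos hr] using ha

theorem HasWinding.circleMap_sub_zero {r : ℝ} {a : ℂ} (hr : 0 ≤ r) (ha : r < ‖a‖) :
    HasWinding (fun s => circleMap 0 r s - a) 0 := by
  have ha0 : -a ≠ 0 := by rw [neg_ne_zero, ← norm_pos_iff]; linarith
  refine (HasWinding.const ha0).of_norm_sub_lt (by fun_prop) ?_ ?_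
  · simp only [circleMap_zero_two_pi 0 r]
  · intro s _
    simpa [abs_of_nonneg hr] using ha

theorem HasWinding.pow {c : ℝ → ℂ} {m : ℤ} (h : HasWinding c m) (n : ℕ) :
    HasWinding (fun s => c s ^ n) (n * m) := by
  induction n with
  | zero => simpa using HasWinding.const one_ne_zero
  | succ n ih =>
    have := ih.mul h
    simp only [← pow_succ] at this
    convert this using 1
    push_cast; ring

/-- The real-linear map `w ↦ α w + conj (β w)` on the plane preserves orientation if `‖β‖ < ‖α‖`;
here it is composed with translation by `-a`. -/
def planarLinear (α β a z : ℂ) : ℂ := α * (z - a) + starRingEnd ℂ (β * (z - a))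

theorem continuous_planarLinear (α β a : ℂ) : Continuous (planarLinear α β a) := by
  unfold planarLinear
  exact (by fun_prop : Continuous fun z : ℂ => α * (z - a)).add
    (Complex.continuous_conj.comp (by fun_prop))

theorem norm_le_planarLinear {α β a : ℂ} (z : ℂ) :
    (‖α‖ - ‖β‖) * ‖z - a‖ ≤ ‖planarLinear α β a z‖ := by
  have := norm_sub_norm_le (α * (z - a)) (-(starRingEnd ℂ (β * (z - a))))
  rw [sub_neg_eq_add, norm_neg, RCLike.norm_conj, norm_mul, norm_mul] at this
  unfold planarLinear
  linarith

theorem planarLinear_eq_zero_iff {α β a : ℂ} (h : ‖β‖ < ‖α‖) (z : ℂ) :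
    planarLinear α β a z = 0 ↔ z = a := by
  constructor
  · intro hz
    have := norm_le_planarLinear (α := α) (β := β) (a := a) z
    rw [hz, norm_zero] at this
    by_contra hne
    have h1 : 0 < ‖z - a‖ := norm_pos_iff.2 (sub_ne_zero.2 hne)
    nlinarith
  · rintro rfl; simp [planarLinear]

theorem HasWinding.planarLinear {α β a : ℂ} {r : ℝ} {n : ℤ} (h : ‖β‖ < ‖α‖)
    (hw : HasWinding (fun s => circleMap 0 r s - a) n) (hra : |r| ≠ ‖a‖) :
    HasWinding (fun s => planarLinear α β a (circleMap 0 r s)) n := by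
  have hα : α ≠ 0 := norm_pos_iff.1 ((norm_nonneg _).trans_lt h)
  have h1 := (HasWinding.const hα).mul hw
  rw [zero_add] at h1
  refine h1.of_norm_sub_lt ((continuous_planarLinear α β a).comp (by fun_prop)).continuousOn ?_ ?_
  · simp only [circleMap_zero_two_pi 0 r]
  · intro s _
    have hne : circleMap 0 r s - a ≠ 0 := fun h0 => hra (by
      rw [← sub_eq_zero.1 h0, norm_circleMap_zero])
    simp only [_root_.planarLinear, add_sub_cancel_left, RCLike.norm_conj, norm_mul]
    exact mul_lt_mul_of_pos_right h (norm_pos_iff.2 hne)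

theorem tendsto_div_planarLinear {f g : ℂ → ℂ} {a f' g' : ℂ} (hf : HasDerivAt f f' a)
    (hg : HasDerivAt g g' a) (h : ‖g'‖ < ‖f'‖) :
    Tendsto (fun z => (f z + starRingEnd ℂ (g z) - (f a + starRingEnd ℂ (g a))) /
      planarLinear f' g' a z) (𝓝[≠] a) (𝓝 1) := by
  have h1 := hf.isLittleO
  have h2 := hg.isLittleO
  have h3 : (fun z => (f z + starRingEnd ℂ (g z) - (f a + starRingEnd ℂ (g a))) -
      planarLinear f' g' a z) =o[𝓝 a] fun z => z - a := by
    have h4 : (fun z => starRingEnd ℂ (g z - g a - (z - a) • g')) =o[𝓝 a] fun z => z - a := by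
      rw [← Asymptotics.isLittleO_norm_left] at h2 ⊢
      simpa only [RCLike.norm_conj] using h2
    refine (h1.add h4).congr_left fun z => ?_
    simp only [planarLinear, map_sub, map_mul, smul_eq_mul]
    ring
  have h5 : (fun z => z - a) =O[𝓝 a] planarLinear f' g' a := by
    refine Asymptotics.IsBigO.of_bound (‖f'‖ - ‖g'‖)⁻¹ (Eventually.of_forall fun z => ?_)
    rw [← div_eq_inv_mul, le_div_iff₀ (sub_pos.2 h), mul_comm]
    exact norm_le_planarLinear z
  have h6 := ((h3.trans_isBigO h5).tendsto_div_nhds_zero.mono_left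
    (nhdsWithin_le_nhds (s := {a}ᶜ))).add_const 1
  rw [zero_add] at h6
  refine h6.congr' ?_
  filter_upwards [self_mem_nhdsWithin] with z hz
  have : planarLinear f' g' a z ≠ 0 := fun h0 => hz ((planarLinear_eq_zero_iff h z).1 h0)
  field_simp
  ring

theorem hasPositiveIndexAt_planar {f g : ℂ → ℂ} {a f' g' : ℂ} {r : ℝ} (hf : HasDerivAt f f' a)
    (hg : HasDerivAt g g' a) (h : ‖g'‖ < ‖f'‖) (ha : ‖a‖ < r) :
    HasPositiveIndexAt r (fun z => f z + starRingEnd ℂ (g z) - (f a + starRingEnd ℂ (g a))) a := by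
  have hr : 0 < r := (norm_nonneg a).trans_lt ha
  exact ⟨planarLinear f' g' a, 1, 1, continuous_planarLinear _ _ _, planarLinear_eq_zero_iff h,
    (HasWinding.circleMap_sub ha).planarLinear h (by rw [abs_of_pos hr]; exact ha.ne'), le_rfl,
    one_ne_zero, tendsto_div_planarLinear hf hg h⟩

theorem AnalyticAt.hasPositiveIndexAt {h : ℂ → ℂ} {a : ℂ} {r : ℝ} (hh : AnalyticAt ℂ h a)
    (h0 : h a = 0) (hne : ¬ ∀ᶠ z in 𝓝 a, h z = 0) (ha : ‖a‖ < r) : HasPositiveIndexAt r h a := by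
  obtain ⟨n, g, hg, hga, heq⟩ := (hh.exists_eventuallyEq_pow_smul_nonzero_iff).2 hne
  have hn : n ≠ 0 := by
    rintro rfl
    have := heq.self_of_nhds
    simp [h0, hga.symm] at this
  refine ⟨fun z => (z - a) ^ n, g a, n * 1, by fun_prop, fun z => ?_,
    (HasWinding.circleMap_sub ha).pow n, by omega, hga, ?_⟩
  · rw [pow_eq_zero_iff hn, sub_eq_zero]
  · refine (hg.continuousAt.tendsto.mono_left (nhdsWithin_le_nhds (s := {a}ᶜ))).congr' ?_
    filter_upwards [nhdsWithin_le_nhds heq, self_mem_nhdsWithin] with z hz hza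
    rw [hz, smul_eq_mul, mul_div_cancel_left₀ _ (pow_ne_zero _ (sub_ne_zero.2 hza))]

theorem HasWinding.of_mem_slitPlane {c : ℝ → ℂ} (hc : ContinuousOn c (Icc 0 (2 * Real.pi)))
    (hper : c 0 = c (2 * Real.pi)) (hs : ∀ s ∈ Icc 0 (2 * Real.pi), c s ∈ Complex.slitPlane) :
    HasWinding c 0 :=
  ⟨fun s => Complex.log (c s), hc.clog hs,
    fun s h => (Complex.exp_log (Complex.slitPlane_ne_zero (hs s h))).symm, by simp [hper]⟩

theorem HasPositiveIndexAt.congr {r : ℝ} {h h' : ℂ → ℂ} {a : ℂ} (ha : HasPositiveIndexAt r h a)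
    (hh : h' =ᶠ[𝓝 a] h) : HasPositiveIndexAt r h' a := by
  obtain ⟨L, c, m, h1, h2, h3, h4, h5, h6⟩ := ha
  refine ⟨L, c, m, h1, h2, h3, h4, h5, h6.congr' ?_⟩
  filter_upwards [nhdsWithin_le_nhds hh] with z hz
  rw [hz]

theorem norm_radial_sub_le_of_differentiableOn {F : ℂ → ℂ} (hF : DifferentiableOn ℂ F (ball 0 1))
    {r ε : ℝ} (hr : 0 ≤ r) (hr1 : r < 1) (hε : 0 < ε) :
    ∃ δ > 0, ∀ h : ℝ, 0 < h → h < δ → ∀ e : ℂ, ‖e‖ = 1 →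
      ‖F ((r + h : ℝ) * e) - F (r * e) - h * (e * deriv F (r * e))‖ ≤ ε * h := by
  set r' := (1 + r) / 2 with hr'
  have hsub : closedBall (0 : ℂ) r' ⊆ ball 0 1 := closedBall_subset_ball (by linarith)
  have hcont : ContinuousOn (deriv F) (closedBall 0 r') :=
    (hF.deriv isOpen_ball).continuousOn.mono hsub
  obtain ⟨δ, hδ, hu⟩ := Metric.uniformContinuousOn_iff.1
    ((isCompact_closedBall (0 : ℂ) r').uniformContinuousOn_of_continuous hcont) ε hε
  refine ⟨min δ (r' - r), lt_min hδ (by linarith), fun h h0 hlt e he => ?_⟩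
  have hhδ : h < δ := hlt.trans_le (min_le_left _ _)
  have hhr : h < r' - r := hlt.trans_le (min_le_right _ _)
  have hz0 : ‖(r : ℂ) * e‖ = r := by
    rw [norm_mul, he, mul_one, Complex.norm_real, Real.norm_of_nonneg hr]
  have hmem0 : (r : ℂ) * e ∈ closedBall (0 : ℂ) r' := by
    rw [mem_closedBall_zero_iff, hz0]; linarith
  have hd : ‖((r + h : ℝ) : ℂ) * e - r * e‖ = h := by
    have : ((r + h : ℝ) : ℂ) * e - r * e = h * e := by push_cast; ring
    rw [this, norm_mul, he, mul_one, Complex.norm_real, Real.norm_of_nonneg h0.le]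
  have hmem1 : ((r + h : ℝ) : ℂ) * e ∈ closedBall (0 : ℂ) r' := by
    rw [mem_closedBall_zero_iff, norm_mul, he, mul_one, Complex.norm_real,
      Real.norm_of_nonneg (by linarith)]
    linarith
  have hcv : Convex ℝ (closedBall (0 : ℂ) r' ∩ ball (r * e) δ) :=
    (convex_closedBall _ _).inter (convex_ball _ _)
  have := hcv.norm_image_sub_le_of_norm_hasDerivWithin_le
    (f := fun z => F z - z * deriv F (r * e)) (f' := fun z => deriv F z - 1 * deriv F (r * e))
    (C := ε) (x := r * e) (y := (r + h : ℝ) * e) ?_ ?_ ⟨hmem0, mem_ball_self hδ⟩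
    ⟨hmem1, by rw [mem_ball, dist_eq_norm, hd]; exact hhδ⟩
  · rw [hd] at this
    refine le_of_eq_of_le (congrArg norm ?_) this
    push_cast; ring
  · intro z hz
    have h1 : HasDerivAt F (deriv F z) z :=
      (hF.differentiableAt (isOpen_ball.mem_nhds (hsub hz.1))).hasDerivAt
    exact (h1.sub ((hasDerivAt_id z).mul_const _)).hasDerivWithinAt
  · intro z hz
    have := hu z hz.1 _ hmem0 hz.2
    rw [dist_eq_norm] at this
    simpa using this.le

theorem circleMap_mem_ring {r ρ : ℝ} (h0 : 0 ≤ r) (h1 : ρ ≤ r) (h2 : r ≤ 1) (s : ℝ) :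
    circleMap 0 r s ∈ closedBall (0 : ℂ) 1 \ ball 0 ρ := by
  simp [abs_of_nonneg h0, h1, h2]

/-- A planar harmonic map `f + conj g` of the unit disc that is continuous up to the boundary,
injective on the closed ring `ρ ≤ |z| ≤ 1` and orientation preserving on its interior. -/
structure HarmonicRing (f g φ : ℂ → ℂ) (ρ : ℝ) : Prop where
  pos : 0 < ρ
  lt_one : ρ < 1
  left : DifferentiableOn ℂ f (ball 0 1)
  right : DifferentiableOn ℂ g (ball 0 1)
  eq : ∀ z ∈ ball (0 : ℂ) 1, φ z = f z + starRingEnd ℂ (g z)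
  cont : ContinuousOn φ (closedBall 0 1)
  inj : InjOn φ (closedBall 0 1 \ ball 0 ρ)
  orient : ∀ z ∈ ball (0 : ℂ) 1 \ closedBall 0 ρ, ‖deriv g z‖ < ‖deriv f z‖

namespace HarmonicRing

variable {f g φ : ℂ → ℂ} {ρ : ℝ}

theorem hasDerivAt_left (H : HarmonicRing f g φ ρ) {z : ℂ} (hz : z ∈ ball (0 : ℂ) 1) :
    HasDerivAt f (deriv f z) z :=
  (H.left.differentiableAt (isOpen_ball.mem_nhds hz)).hasDerivAt

theorem hasDerivAt_right (H : HarmonicRing f g φ ρ) {z : ℂ} (hz : z ∈ ball (0 : ℂ) 1) :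
    HasDerivAt g (deriv g z) z :=
  (H.right.differentiableAt (isOpen_ball.mem_nhds hz)).hasDerivAt

theorem exists_isMaxOn_re (H : HarmonicRing f g φ ρ) {R : ℝ} (hR : 0 < R) (hR1 : R < 1) :
    ∃ q ∈ sphere (0 : ℂ) R, ∀ z ∈ closedBall 0 R, (φ z).re ≤ (φ q).re := by
  have hsub : closedBall (0 : ℂ) R ⊆ ball 0 1 := closedBall_subset_ball hR1
  have hnorm : ∀ z ∈ closedBall (0 : ℂ) R, ‖Complex.exp (f z + g z)‖ = Real.exp (φ z).re := by
    intro z hz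
    rw [Complex.norm_exp, H.eq z (hsub hz)]
    simp
  have hd : DiffContOnCl ℂ (fun z => Complex.exp (f z + g z)) (ball 0 R) := by
    refine DifferentiableOn.diffContOnCl ?_
    rw [closure_ball _ hR.ne']
    exact ((H.left.mono hsub).add (H.right.mono hsub)).cexp
  obtain ⟨q, hq, hmax⟩ := Complex.exists_mem_frontier_isMaxOn_norm isBounded_ball
    (nonempty_ball.2 hR) hd
  rw [frontier_ball _ hR.ne'] at hq
  rw [closure_ball _ hR.ne'] at hmax
  refine ⟨q, hq, fun z hz => ?_⟩
  have := hmax hz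
  simp only [Set.mem_ofPred_eq, Function.comp_apply, hnorm z hz,
    hnorm q (sphere_subset_closedBall hq), Real.exp_le_exp] at this
  exact this

theorem hasWinding_inner (H : HarmonicRing f g φ ρ) {z₀ : ℂ}
    (hz₀ : z₀ ∈ closedBall (0 : ℂ) 1 \ closedBall 0 ρ) :
    HasWinding (fun s => φ (circleMap 0 ρ s) - φ z₀) 0 := by
  have hρ := H.pos
  have hρ1 := H.lt_one
  set R := (1 + ρ) / 2 with hR
  obtain ⟨q, hq, hmax⟩ := H.exists_isMaxOn_re (R := R) (by linarith) (by linarith)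
  have hcρ : Continuous (fun s => φ (circleMap 0 ρ s)) :=
    H.cont.comp_continuous (by fun_prop) fun s => (circleMap_mem_ring hρ.le le_rfl hρ1.le s).1
  have hqn : ‖q‖ = R := by simpa using hq
  have hz1 : ‖z₀‖ ≤ 1 := by simpa using hz₀.1
  have hz2 : ρ < ‖z₀‖ := by simpa using hz₀.2
  have hne : ∀ s, ∀ w ∈ closedBall (0 : ℂ) 1 \ ball 0 ρ, ρ < ‖w‖ → φ (circleMap 0 ρ s) ≠ φ w := by
    intro s w hw hwn he
    have := H.inj (circleMap_mem_ring hρ.le le_rfl hρ1.le s) hw he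
    rw [← this, norm_circleMap_zero, abs_of_pos hρ] at hwn
    exact hwn.false
  have hbase : HasWinding (fun s => φ (circleMap 0 ρ s) - φ q) 0 := by
    have h1 : HasWinding (fun s => φ q - φ (circleMap 0 ρ s)) 0 := by
      refine HasWinding.of_mem_slitPlane (continuous_const.sub hcρ).continuousOn (by rw [circleMap_zero_two_pi]) fun s _ => ?_
      have hle := hmax (circleMap 0 ρ s) (by
        rw [mem_closedBall_zero_iff, norm_circleMap_zero, abs_of_pos hρ]; linarith)
      have hq' := hne s q (by
        rw [Set.mem_sdiff, mem_closedBall_zero_iff, mem_ball_zero_iff, hqn]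
        constructor <;> linarith) (by linarith)
      rw [Complex.mem_slitPlane_iff, Complex.sub_re, Complex.sub_im, sub_pos, sub_ne_zero]
      rcases hle.lt_or_eq with h | h
      · exact Or.inl h
      · exact Or.inr fun h' => hq' (Complex.ext h h'.symm)
    have h2 := (HasWinding.const (a := -1) (by norm_num)).mul h1
    simpa using h2
  obtain ⟨a, ha⟩ : ∃ a : ℝ, q = circleMap 0 R a :=
    ⟨q.arg, by simp [circleMap, ← hqn, Complex.norm_mul_exp_arg_mul_I]⟩
  obtain ⟨b, hb⟩ : ∃ b : ℝ, z₀ = circleMap 0 ‖z₀‖ b :=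
    ⟨z₀.arg, by simp [circleMap, Complex.norm_mul_exp_arg_mul_I]⟩
  let P : ℝ → ℂ := fun t => circleMap 0 (R + t * (‖z₀‖ - R)) (a + t * (b - a))
  have hPc : Continuous P := by unfold P circleMap; fun_prop
  have hP : ∀ t ∈ Icc (0 : ℝ) 1, ρ < ‖P t‖ ∧ ‖P t‖ ≤ 1 := by
    intro t ht
    have e : R + t * (‖z₀‖ - R) = (1 - t) * R + t * ‖z₀‖ := by ring
    have h1 : ρ < R + t * (‖z₀‖ - R) := by
      rw [e]
      rcases ht.1.eq_or_lt with h | h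
      · rw [← h]; linarith
      · nlinarith [mul_pos h (sub_pos.2 hz2), mul_nonneg (sub_nonneg.2 ht.2)
          (show 0 ≤ R - ρ by linarith)]
    have h2 : R + t * (‖z₀‖ - R) ≤ 1 := by
      rw [e]
      nlinarith [mul_nonneg ht.1 (sub_nonneg.2 hz1), mul_nonneg (sub_nonneg.2 ht.2)
          (show 0 ≤ 1 - R by linarith)]
    simp only [P, norm_circleMap_zero]
    rw [abs_of_pos (by linarith)]
    exact ⟨h1, h2⟩
  have := (HasWinding.homotopy (n := 0) (H := fun t s => φ (circleMap 0 ρ s) - φ (P t)) ?_ ?_ ?_).1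
    (by simpa [P, ← ha] using hbase)
  · simpa [P, ← hb] using this
  · refine (hcρ.comp continuous_snd).continuousOn.sub ?_
    exact H.cont.comp (hPc.comp continuous_fst).continuousOn fun p hp => by
      simpa using (hP _ hp.1).2
  · intro t ht s _
    have := hP t ht
    refine sub_ne_zero.2 (hne s _ ⟨by simpa using this.2, by simpa using this.1.le⟩ this.1)
  · intro t _
    rw [circleMap_zero_two_pi]

theorem hasWinding_outer (H : HarmonicRing f g φ ρ) {z₀ : ℂ}
    (hz₀ : z₀ ∈ ball (0 : ℂ) 1 \ closedBall 0 ρ) :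
    HasWinding (fun s => φ (circleMap 0 1 s) - φ z₀) 1 := by
  have hρ := H.pos
  have hρ1 := H.lt_one
  have hor := H.orient z₀ hz₀
  have hz1 : ‖z₀‖ < 1 := by simpa using hz₀.1
  have hz2 : ρ < ‖z₀‖ := by simpa using hz₀.2
  set L := planarLinear (deriv f z₀) (deriv g z₀) z₀ with hL
  have hLne : ∀ {z}, z ≠ z₀ → L z ≠ 0 := fun hz h => hz ((planarLinear_eq_zero_iff hor _).1 h)
  have hz₀A : z₀ ∈ closedBall (0 : ℂ) 1 \ ball 0 ρ :=
    ⟨ball_subset_closedBall hz₀.1, by simpa using hz2.le⟩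
  set G := Function.update (fun z => (φ z - φ z₀) / L z) z₀ 1 with hG
  have hGc : ContinuousOn G (closedBall 0 1 \ ball 0 ρ) := by
    rw [hG, continuousOn_update_iff]
    refine ⟨ContinuousOn.div ?_ (continuous_planarLinear _ _ _).continuousOn
      fun z hz => hLne hz.2, fun _ => ?_⟩
    · exact (H.cont.mono fun z hz => hz.1.1).sub continuousOn_const
    · refine Tendsto.mono_left ?_ (nhdsWithin_mono z₀ fun z hz => hz.2)
      refine (tendsto_div_planarLinear (H.hasDerivAt_left hz₀.1) (H.hasDerivAt_right hz₀.1)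
        hor).congr' ?_
      filter_upwards [nhdsWithin_le_nhds (isOpen_ball.mem_nhds hz₀.1)] with z hz
      rw [H.eq z hz, H.eq z₀ hz₀.1]
  have hGne : ∀ z ∈ closedBall (0 : ℂ) 1 \ ball 0 ρ, G z ≠ 0 := by
    intro z hz
    by_cases hzz : z = z₀
    · subst hzz; simp [hG]
    · rw [hG, Function.update_of_ne hzz]
      exact div_ne_zero (sub_ne_zero.2 fun h => hzz (H.inj hz hz₀A h)) (hLne hzz)
  have hcirc : ∀ {r : ℝ} (s : ℝ), |r| ≠ ‖z₀‖ → circleMap 0 r s ≠ z₀ := fun s hr h => hr (by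
    rw [← h, norm_circleMap_zero])
  have hr0 : |ρ| ≠ ‖z₀‖ := by rw [abs_of_pos hρ]; exact hz2.ne
  have hr1 : |(1 : ℝ)| ≠ ‖z₀‖ := by rw [abs_one]; exact hz1.ne'
  have hin : HasWinding (fun s => G (circleMap 0 ρ s)) 0 := by
    have h1 := (H.hasWinding_inner ⟨hz₀A.1, hz₀.2⟩).div
      ((HasWinding.circleMap_sub_zero hρ.le hz2).planarLinear hor hr0)
    refine h1.congr fun s _ => ?_
    rw [hG, Function.update_of_ne (hcirc s hr0)]
  have hout := (HasWinding.annulus_iff hρ.le hρ1.le hGc hGne).1 hin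
  have h1 := hout.mul ((HasWinding.circleMap_sub hz1).planarLinear hor hr1)
  refine h1.congr fun s _ => ?_
  rw [hG, Function.update_of_ne (hcirc s hr1), div_mul_cancel₀ _ (hLne (hcirc s hr1))]

theorem hasWinding_radial_diff (H : HarmonicRing f g φ ρ) {r₁ r₂ : ℝ} (h1 : ρ < r₁) (h12 : r₁ < r₂)
    (h2 : r₂ ≤ 1) :
    HasWinding (fun s => φ (circleMap 0 r₂ s) - φ (circleMap 0 r₁ s)) 1 := by
  have hρ := H.pos
  have hρ1 := H.lt_one
  have hr1 : 0 < r₁ := hρ.trans h1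
  have hA : ∀ {r : ℝ} (s : ℝ), ρ ≤ r → r ≤ 1 → circleMap 0 r s ∈ closedBall (0 : ℂ) 1 \ ball 0 ρ :=
    fun s h h' => circleMap_mem_ring (hρ.le.trans h) h h' s
  have hne : ∀ {r r' : ℝ} (s s' : ℝ), ρ ≤ r → r < r' → r' ≤ 1 →
      φ (circleMap 0 r' s') - φ (circleMap 0 r s) ≠ 0 := by
    intro r r' s s' h h' h'' he
    have := congrArg norm (H.inj (hA s' (h.trans h'.le) h'') (hA s h (h'.le.trans h''))
      (sub_eq_zero.1 he))
    rw [norm_circleMap_zero, norm_circleMap_zero, abs_of_nonneg (by linarith),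
      abs_of_nonneg (by linarith)] at this
    linarith
  have hc : ∀ {r : ℝ}, ρ ≤ r → r ≤ 1 → Continuous (fun s => φ (circleMap 0 r s)) :=
    fun h h' => H.cont.comp_continuous (by fun_prop) fun s => (hA s h h').1
  have e0 := circleMap_zero_two_pi
  have hdiag : HasWinding (fun s => φ (circleMap 0 1 s) - φ (circleMap 0 r₁ s)) (1 + 0) := by
    refine HasWinding.diagonal (F := fun s t => φ (circleMap 0 1 s) - φ (circleMap 0 r₁ t))
      ?_ ?_ ?_ ?_ ?_
    · exact (((hc hρ1.le le_rfl).comp continuous_fst).sub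
        ((hc h1.le (h12.le.trans h2)).comp continuous_snd)).continuousOn
    · exact fun s _ t _ => hne _ _ h1.le (h12.trans_le h2) le_rfl
    · intro t _
      rw [e0]
    · refine H.hasWinding_outer ⟨?_, ?_⟩
      · simpa [abs_of_pos hr1] using h12.trans_le h2
      · simpa [abs_of_pos hr1] using h1
    · set z₀ := circleMap 0 1 0 with hz₀
      have hz₀n : ‖z₀‖ = 1 := by simp [hz₀]
      have hin := H.hasWinding_inner (z₀ := z₀) ⟨by simp [hz₀n], by simpa [hz₀n] using hρ1⟩
      have hz₀A : z₀ ∈ closedBall (0 : ℂ) 1 \ ball 0 ρ := by simp [hz₀n, hρ1.le]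
      have hsub : closedBall (0 : ℂ) r₁ \ ball 0 ρ ⊆ closedBall 0 1 \ ball 0 ρ :=
        sdiff_subset_sdiff_left (closedBall_subset_closedBall (h12.le.trans h2))
      have hmid := (HasWinding.annulus_iff (h := fun z => φ z - φ z₀) hρ.le h1.le
        ((H.cont.mono fun z hz => (hsub hz).1).sub continuousOn_const) (fun z hz he => ?_)).1 hin
      · simpa using (HasWinding.const (a := -1) (by norm_num)).mul hmid
      · have := H.inj (hsub hz) hz₀A (sub_eq_zero.1 he)
        have hzn : ‖z‖ ≤ r₁ := by simpa using hz.1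
        rw [this, hz₀n] at hzn
        linarith
  rw [add_zero] at hdiag
  have hm : ∀ t ∈ Icc (0 : ℝ) 1, r₁ < 1 + t * (r₂ - 1) ∧ 1 + t * (r₂ - 1) ≤ 1 := by
    intro t ht
    constructor
    · nlinarith [mul_nonneg (sub_nonneg.2 ht.2) (sub_nonneg.2 h2)]
    · nlinarith [mul_nonneg ht.1 (sub_nonneg.2 h2)]
  have := (HasWinding.homotopy (n := 1)
    (H := fun t s => φ (circleMap 0 (1 + t * (r₂ - 1)) s) - φ (circleMap 0 r₁ s)) ?_ ?_ ?_).1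
    (by simpa using hdiag)
  · simpa using this
  · refine ContinuousOn.sub ?_ ((hc h1.le (h12.le.trans h2)).comp continuous_snd).continuousOn
    refine H.cont.comp (f := fun p : ℝ × ℝ => circleMap 0 (1 + p.1 * (r₂ - 1)) p.2)
      (by unfold circleMap; fun_prop) fun p hp => ?_
    exact (hA _ (h1.le.trans (hm _ hp.1).1.le) (hm _ hp.1).2).1
  · exact fun t ht s _ => hne _ _ h1.le (hm t ht).1 (hm t ht).2
  · intro t _
    simp only [e0]

end HarmonicRing

namespace HarmonicRing

variable {f g φ : ℂ → ℂ} {ρ : ℝ}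

theorem deriv_left_ne_zero (H : HarmonicRing f g φ ρ) {r : ℝ} (hr : ρ < r) (hr1 : r < 1) {z : ℂ}
    (hz : z ∈ closedBall (0 : ℂ) r) : deriv f z ≠ 0 := by
  have hr0 : 0 < r := H.pos.trans hr
  have hsub : closedBall (0 : ℂ) r ⊆ ball 0 1 := closedBall_subset_ball hr1
  have hsph : ∀ {w : ℂ}, ‖w‖ = r → ‖deriv g w‖ < ‖deriv f w‖ := fun {w} hw =>
    H.orient w (by rw [Set.mem_sdiff, mem_ball_zero_iff, mem_closedBall_zero_iff, hw]; grind)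
  have hf' := H.left.deriv isOpen_ball
  have hg' := H.right.deriv isOpen_ball
  have hcr : ∀ s, ‖circleMap 0 r s‖ = r := fun s => by rw [norm_circleMap_zero, abs_of_pos hr0]
  obtain ⟨m, hm, hmle⟩ : ∃ m > 0, ∀ w : ℂ, ‖w‖ = r → m ≤ ‖deriv f w‖ - ‖deriv g w‖ := by
    have hss : sphere (0 : ℂ) r ⊆ ball 0 1 := sphere_subset_closedBall.trans hsub
    obtain ⟨w, hw, hmin⟩ := (isCompact_sphere (0 : ℂ) r).exists_isMinOn
      (NormedSpace.sphere_nonempty.2 hr0.le)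
      ((hf'.continuousOn.mono hss).norm.sub (hg'.continuousOn.mono hss).norm)
    exact ⟨_, sub_pos.2 (hsph (by simpa using hw)), fun v hv => hmin (by simpa using hv)⟩
  obtain ⟨S, N, hS, hSN, hN⟩ := HasWinding.exists_zeros_card_le hr0.le
    (hf'.continuousOn.mono hsub) fun a ha h0 => by
      have han : ‖a‖ < r := by
        refine (mem_closedBall_zero_iff.1 ha).lt_of_ne fun h => ?_
        have := hsph h
        rw [h0, norm_zero] at this
        exact (norm_nonneg _).not_gt this
      refine ⟨by simpa using han, ?_⟩
      have han' := hf'.analyticOnNhd isOpen_ball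
      refine (han' a (hsub ha)).hasPositiveIndexAt h0 (fun hev => ?_) han
      have := han'.eqOn_zero_of_preconnected_of_eventuallyEq_zero
        (convex_ball _ _).isPreconnected (hsub ha) hev (x := circleMap 0 r 0)
        (hsub (by simp [abs_of_pos hr0]))
      have h2 := hsph (hcr 0)
      rw [this, Pi.zero_apply, norm_zero] at h2
      exact (norm_nonneg _).not_gt h2
  obtain ⟨δ₁, hδ₁, hF⟩ := norm_radial_sub_le_of_differentiableOn H.left hr0.le hr1
    (show 0 < m / 4 by linarith)
  obtain ⟨δ₂, hδ₂, hG⟩ := norm_radial_sub_le_of_differentiableOn H.right hr0.le hr1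
    (show 0 < m / 4 by linarith)
  obtain ⟨h, h0, hh⟩ : ∃ h, 0 < h ∧ h < min (min δ₁ δ₂) (1 - r) :=
    exists_between (lt_min (lt_min hδ₁ hδ₂) (by linarith))
  have hh1 : h < δ₁ := hh.trans_le ((min_le_left _ _).trans (min_le_left _ _))
  have hh2 : h < δ₂ := hh.trans_le ((min_le_left _ _).trans (min_le_right _ _))
  have hh3 : r + h < 1 := by linarith [hh.trans_le (min_le_right _ _)]
  have hrad := H.hasWinding_radial_diff (r₂ := r + h) hr (by linarith) hh3.le
  have hmain := (HasWinding.const (a := (h : ℂ)) (by exact_mod_cast h0.ne')).mul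
    ((HasWinding.circleMap_zero one_pos).mul hN)
  have hscale : ∀ (t s : ℝ), circleMap 0 t s = t * circleMap 0 1 s := by simp [circleMap]
  have hcont : ∀ {t : ℝ}, 0 ≤ t → t < 1 → Continuous fun s => φ (circleMap 0 t s) := by
    intro t ht ht1
    exact H.cont.comp_continuous (by fun_prop) fun s => by simp [abs_of_nonneg ht, ht1.le]
  have hlast := hmain.of_norm_sub_lt
    (c' := fun s => φ (circleMap 0 (r + h) s) - φ (circleMap 0 r s))
    ((hcont (by linarith) hh3).sub (hcont hr0.le hr1)).continuousOn
    (by simp only [circleMap_zero_two_pi]) fun s _ => by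
      set e := circleMap 0 1 s with he
      have hen : ‖e‖ = 1 := by simp [he]
      have hre : ‖(r : ℂ) * e‖ = r := by rw [← hscale, hcr]
      have h1 := hF h h0 hh1 e hen
      have h2 := hG h h0 hh2 e hen
      have h3 := hmle _ hre
      have hm1 : ((r : ℂ) * e) ∈ ball (0 : ℂ) 1 := by
        rw [mem_ball_zero_iff, hre]; exact hr1
      have hm2 : (((r + h : ℝ) : ℂ) * e) ∈ ball (0 : ℂ) 1 := by
        rw [mem_ball_zero_iff, ← hscale, norm_circleMap_zero, abs_of_pos (by linarith)]; exact hh3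
      rw [hscale r, hscale (r + h), H.eq _ hm1, H.eq _ hm2]
      set X := f ((r + h : ℝ) * e) - f (r * e) - h * (e * deriv f (r * e))
      set Y := g ((r + h : ℝ) * e) - g (r * e) - h * (e * deriv g (r * e))
      have key : f ((r + h : ℝ) * e) + starRingEnd ℂ (g ((r + h : ℝ) * e)) -
          (f (r * e) + starRingEnd ℂ (g (r * e))) - h * (e * deriv f (r * e)) =
          X + starRingEnd ℂ Y + starRingEnd ℂ (h * (e * deriv g (r * e))) := by
        simp only [X, Y, map_sub]; ring
      rw [key]
      refine (norm_add₃_le).trans_lt ?_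
      rw [RCLike.norm_conj, RCLike.norm_conj, norm_mul, norm_mul, norm_mul, norm_mul, hen, one_mul,
        one_mul, Complex.norm_real, Real.norm_of_nonneg h0.le]
      nlinarith
  have hN0 := hlast.unique hrad
  have hS0 : S.card = 0 := by omega
  intro hz0
  have := (hS z).2 ⟨hz, hz0⟩
  rw [Finset.card_eq_zero.1 hS0] at this
  simp at this

theorem norm_deriv_right_lt (H : HarmonicRing f g φ ρ) {z : ℂ} (hz : z ∈ ball (0 : ℂ) 1) :
    ‖deriv g z‖ < ‖deriv f z‖ := by
  by_cases hzρ : z ∈ closedBall (0 : ℂ) ρ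
  swap
  · exact H.orient z ⟨hz, hzρ⟩
  obtain ⟨r, hr, hr1⟩ := exists_between H.lt_one
  have hr0 : 0 < r := H.pos.trans hr
  have hsub : closedBall (0 : ℂ) r ⊆ ball 0 1 := closedBall_subset_ball hr1
  have hne := fun {w : ℂ} hw => H.deriv_left_ne_zero hr hr1 (z := w) hw
  have hd : DiffContOnCl ℂ (fun w => deriv g w / deriv f w) (ball 0 r) := by
    refine DifferentiableOn.diffContOnCl ?_
    rw [closure_ball _ hr0.ne']
    exact ((H.right.deriv isOpen_ball).mono hsub).div ((H.left.deriv isOpen_ball).mono hsub)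
      fun w hw => hne hw
  obtain ⟨q, hq, hmax⟩ := Complex.exists_mem_frontier_isMaxOn_norm isBounded_ball
    (nonempty_ball.2 hr0) hd
  rw [frontier_ball _ hr0.ne', mem_sphere_zero_iff_norm] at hq
  rw [closure_ball _ hr0.ne'] at hmax
  have hzr : z ∈ closedBall (0 : ℂ) r := closedBall_subset_closedBall hr.le hzρ
  have hqr : q ∈ closedBall (0 : ℂ) r := by simp [hq]
  have h1 := hmax hzr
  simp only [Set.mem_ofPred_eq, Function.comp_apply, norm_div] at h1
  have h2 := H.orient q ⟨hsub hqr, by simp [hq, hr]⟩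
  rw [← div_lt_one (norm_pos_iff.2 (hne hqr))] at h2
  exact (div_lt_one (norm_pos_iff.2 (hne hzr))).1 (h1.trans_lt h2)

theorem hasPositiveIndexAt (H : HarmonicRing f g φ ρ) {a : ℂ} {r : ℝ} (hr1 : r ≤ 1)
    (har : ‖a‖ < r) : HasPositiveIndexAt r (fun z => φ z - φ a) a := by
  have ha : a ∈ ball (0 : ℂ) 1 := by simpa using har.trans_le hr1
  refine (hasPositiveIndexAt_planar (H.hasDerivAt_left ha) (H.hasDerivAt_right ha)
    (H.norm_deriv_right_lt ha) har).congr ?_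
  filter_upwards [isOpen_ball.mem_nhds ha] with z hz
  rw [H.eq z hz, H.eq a ha]

theorem ne_of_mem_closedBall (H : HarmonicRing f g φ ρ) {z z₀ : ℂ} (hz : z ∈ closedBall (0 : ℂ) ρ)
    (hz₀ : z₀ ∈ closedBall (0 : ℂ) 1 \ closedBall 0 ρ) : φ z ≠ φ z₀ := by
  have hρ := H.pos
  have hρ1 := H.lt_one
  obtain ⟨S, N, hS, hSN, hN⟩ := HasWinding.exists_zeros_card_le (h := fun w => φ w - φ z₀) hρ.le
    ((H.cont.mono (closedBall_subset_closedBall hρ1.le)).sub continuousOn_const)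
    fun a ha h0 => by
      have han : ‖a‖ < ρ := by
        refine (mem_closedBall_zero_iff.1 ha).lt_of_ne fun h => hz₀.2 ?_
        rwa [← H.inj ⟨by simpa [h] using hρ1.le, by simp [h]⟩
          ⟨hz₀.1, fun h' => hz₀.2 (ball_subset_closedBall h')⟩ (sub_eq_zero.1 h0)]
      refine ⟨by simpa using han, ?_⟩
      rw [← sub_eq_zero.1 h0]
      exact H.hasPositiveIndexAt hρ1.le han
  have hN0 := hN.unique (H.hasWinding_inner hz₀)
  have hS0 : S.card = 0 := by omega
  intro he
  have := (hS z).2 ⟨hz, sub_eq_zero.2 he⟩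
  rw [Finset.card_eq_zero.1 hS0] at this
  simp at this

theorem ne_of_mem_sphere (H : HarmonicRing f g φ ρ) {z z₀ : ℂ} (hz : z ∈ ball (0 : ℂ) 1)
    (hz₀ : ‖z₀‖ = 1) : φ z₀ ≠ φ z := by
  have hρ1 := H.lt_one
  intro he
  by_cases hzρ : z ∈ closedBall (0 : ℂ) ρ
  · exact H.ne_of_mem_closedBall hzρ ⟨by simp [hz₀], by simp [hz₀, hρ1]⟩ he.symm
  · have := H.inj ⟨by simp [hz₀], by simp [hz₀, hρ1.le]⟩
      ⟨ball_subset_closedBall hz, fun h' => hzρ (ball_subset_closedBall h')⟩ he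
    rw [← this, mem_ball_zero_iff, hz₀] at hz
    exact hz.false

theorem hasWinding_circle (H : HarmonicRing f g φ ρ) {a : ℂ} (ha : a ∈ ball (0 : ℂ) 1) :
    HasWinding (fun s => φ (circleMap 0 1 s) - φ a) 1 := by
  obtain ⟨r, hr, hr1⟩ := exists_between H.lt_one
  have hr0 : 0 < r := H.pos.trans hr
  have hrm : (r : ℂ) ∈ ball (0 : ℂ) 1 := by simpa [abs_of_pos hr0] using hr1
  have hP : ∀ t ∈ Icc (0 : ℝ) 1, (r : ℂ) + t • (a - r) ∈ ball (0 : ℂ) 1 := fun t ht =>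
    (convex_ball (0 : ℂ) 1).add_smul_sub_mem hrm ha ht
  have hcirc : ∀ s, circleMap 0 1 s ∈ closedBall (0 : ℂ) 1 := fun s => by simp
  have := (HasWinding.homotopy (n := 1)
    (H := fun t s => φ (circleMap 0 1 s) - φ ((r : ℂ) + t • (a - r))) ?_ ?_ ?_).1
    (by simpa using H.hasWinding_outer ⟨hrm, by simpa [abs_of_pos hr0] using hr⟩)
  · simpa using this
  · refine ContinuousOn.sub ?_ ?_
    · exact H.cont.comp (by fun_prop) fun p _ => hcirc _
    · exact H.cont.comp (f := fun p : ℝ × ℝ => (r : ℂ) + p.1 • (a - r)) (by fun_prop)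
        fun p hp => ball_subset_closedBall (hP _ hp.1)
  · exact fun t ht s _ => sub_ne_zero.2 (H.ne_of_mem_sphere (hP t ht) (by simp))
  · intro t _
    rw [circleMap_zero_two_pi]

theorem injOn_ball (H : HarmonicRing f g φ ρ) : InjOn φ (ball 0 1) := by
  intro a ha b hb hab
  obtain ⟨S, N, hS, hSN, hN⟩ := HasWinding.exists_zeros_card_le (h := fun w => φ w - φ a)
    zero_le_one (H.cont.sub continuousOn_const) fun c hc h0 => by
      have hcn : ‖c‖ < 1 := (mem_closedBall_zero_iff.1 hc).lt_of_ne fun h =>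
        H.ne_of_mem_sphere ha h (sub_eq_zero.1 h0)
      refine ⟨by simpa using hcn, ?_⟩
      rw [← sub_eq_zero.1 h0]
      exact H.hasPositiveIndexAt le_rfl hcn
  have hN1 := hN.unique (H.hasWinding_circle ha)
  have hS1 : S.card ≤ 1 := by omega
  exact Finset.card_le_one.1 hS1 _ ((hS a).2 ⟨ball_subset_closedBall ha, sub_self _⟩) _
    ((hS b).2 ⟨ball_subset_closedBall hb, sub_eq_zero.2 hab.symm⟩)

theorem injOn_closedBall (H : HarmonicRing f g φ ρ) : InjOn φ (closedBall 0 1) := by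
  intro a ha b hb hab
  rcases (mem_closedBall_zero_iff.1 ha).eq_or_lt with ha' | ha' <;>
    rcases (mem_closedBall_zero_iff.1 hb).eq_or_lt with hb' | hb'
  · exact H.inj ⟨ha, by simp [ha', H.lt_one.le]⟩ ⟨hb, by simp [hb', H.lt_one.le]⟩ hab
  · exact absurd hab (H.ne_of_mem_sphere (mem_ball_zero_iff.2 hb') ha')
  · exact absurd hab.symm (H.ne_of_mem_sphere (mem_ball_zero_iff.2 ha') hb')
  · exact H.injOn_ball (mem_ball_zero_iff.2 ha') (mem_ball_zero_iff.2 hb') hab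

end HarmonicRing

/-- Local normal form of a nonconstant holomorphic function: up to a local change of variables it
is `w ↦ h z₀ + w ^ n`. -/
theorem exists_local_pow_of_analyticAt {h : ℂ → ℂ} {z₀ : ℂ} (hh : AnalyticAt ℂ h z₀)
    (hnc : ¬ ∀ᶠ z in 𝓝 z₀, h z = h z₀) {U : Set ℂ} (hU : U ∈ 𝓝 z₀) :
    ∃ (n : ℕ) (σ : ℂ → ℂ) (δ : ℝ), n ≠ 0 ∧ 0 < δ ∧ ContinuousOn σ (closedBall 0 δ) ∧
      InjOn σ (closedBall 0 δ) ∧ MapsTo σ (closedBall 0 δ) U ∧ σ 0 = z₀ ∧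
      (∀ w ∈ closedBall 0 δ, h (σ w) = h z₀ + w ^ n) ∧ (n = 1 → deriv h z₀ ≠ 0) := by
  have hh' : AnalyticAt ℂ (fun z => h z - h z₀) z₀ := hh.sub analyticAt_const
  obtain ⟨n, G, hG, hG0, heq⟩ := hh'.exists_eventuallyEq_pow_smul_nonzero_iff.2 fun hev =>
    hnc (hev.mono fun z hz => sub_eq_zero.1 hz)
  have hn : n ≠ 0 := by
    rintro rfl
    have := heq.self_of_nhds
    simp [hG0.symm] at this
  have hn' : (n : ℂ) ≠ 0 := by exact_mod_cast hn
  obtain ⟨a, ha⟩ := IsAlgClosed.exists_pow_nat_eq (G z₀) (Nat.pos_of_ne_zero hn)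
  have ha0 : a ≠ 0 := fun h0 => hG0 (by rw [← ha, h0, zero_pow hn])
  set k : ℂ → ℂ := fun z => a * Complex.exp (Complex.log (G z / G z₀) / n) with hk
  have hslit : G z₀ / G z₀ ∈ Complex.slitPlane := by rw [div_self hG0]; exact Complex.one_mem_slitPlane
  have hka : AnalyticAt ℂ k z₀ := by
    refine analyticAt_const.mul (AnalyticAt.cexp ?_)
    exact ((hG.div analyticAt_const hG0).clog hslit).div analyticAt_const hn'
  have hk0 : k z₀ = a := by simp [hk, div_self hG0]
  have hkn : ∀ᶠ z in 𝓝 z₀, k z ^ n = G z := by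
    filter_upwards [hG.continuousAt.eventually_ne hG0] with z hz
    rw [hk]
    simp only
    rw [mul_pow, ha, ← Complex.exp_nat_mul, mul_div_cancel₀ _ hn',
      Complex.exp_log (div_ne_zero hz hG0), mul_div_cancel₀ _ hG0]
  set ψ : ℂ → ℂ := fun z => (z - z₀) * k z with hψ
  have hψa : AnalyticAt ℂ ψ z₀ := (analyticAt_id.sub analyticAt_const).mul hka
  have hψ0 : ψ z₀ = 0 := by simp [hψ]
  have hψd : HasDerivAt ψ a z₀ := by
    have := ((hasDerivAt_id z₀).sub_const z₀).mul hka.differentiableAt.hasDerivAt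
    refine this.congr_deriv ?_
    simp [hk0]
  have hψs : HasStrictDerivAt ψ a z₀ := by
    rw [← hψd.deriv]; exact hψa.hasStrictDerivAt
  have hψf := hψs.hasStrictFDerivAt_equiv ha0
  set e := hψf.toOpenPartialHomeomorph ψ with he
  have hcoe : (e : ℂ → ℂ) = ψ := hψf.toOpenPartialHomeomorph_coe
  have hsrc : z₀ ∈ e.source := hψf.mem_toOpenPartialHomeomorph_source
  have htgt : (0 : ℂ) ∈ e.target := by
    rw [← hψ0]; exact hψf.image_mem_toOpenPartialHomeomorph_target
  have hσ0 : e.symm 0 = z₀ := by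
    rw [← hψ0, ← hcoe]; exact e.left_inv hsrc
  have hσc : ContinuousAt e.symm 0 := e.continuousAt_symm htgt
  have hev : ∀ᶠ z in 𝓝 z₀, z ∈ U ∧ h z = h z₀ + ψ z ^ n := by
    filter_upwards [hU, heq, hkn] with z h1 h2 h3
    refine ⟨h1, ?_⟩
    rw [hψ]
    simp only
    rw [mul_pow, h3, ← smul_eq_mul, ← h2]; ring
  rw [← hσ0] at hev
  obtain ⟨δ, hδ, hball⟩ := Metric.nhds_basis_closedBall.mem_iff.1
    (Filter.inter_mem (e.open_target.mem_nhds htgt) (hσc.eventually hev))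
  refine ⟨n, e.symm, δ, hn, hδ, e.continuousOn_symm.mono fun w hw => (hball hw).1,
    e.symm.injOn.mono fun w hw => (hball hw).1, fun w hw => (hball hw).2.1, hσ0, fun w hw => ?_, ?_⟩
  · rw [(hball hw).2.2, hσ0, ← hcoe, e.right_inv (hball hw).1]
  · rintro rfl
    have hd : HasDerivAt (fun z => h z - h z₀) (G z₀) z₀ := by
      have := ((hasDerivAt_id z₀).sub_const z₀).mul hG.differentiableAt.hasDerivAt
      refine HasDerivAt.congr_of_eventuallyEq (by simpa using this) ?_
      filter_upwards [heq] with z hz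
      simpa using hz
    have hd' : HasDerivAt h (G z₀) z₀ := by simpa using hd.add_const (h z₀)
    rwa [hd'.deriv]

/-- A critical level set of the real part of a holomorphic function contains three arcs that are
disjoint away from the critical point. -/
theorem exists_three_rays {h : ℂ → ℂ} {z₀ : ℂ} (hh : AnalyticAt ℂ h z₀) (hd : deriv h z₀ = 0)
    {U : Set ℂ} (hU : U ∈ 𝓝 z₀) :
    ∃ (d : Fin 3 → ℂ) (σ : ℂ → ℂ) (δ : ℝ), Function.Injective d ∧ (∀ j, ‖d j‖ = 1) ∧ 0 < δ ∧
      ContinuousOn σ (closedBall 0 δ) ∧ InjOn σ (closedBall 0 δ) ∧ MapsTo σ (closedBall 0 δ) U ∧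
      ∀ j, ∀ t ∈ Icc 0 δ, (h (σ (t * d j))).re = (h (σ 0)).re := by
  by_cases hc : ∀ᶠ z in 𝓝 z₀, h z = h z₀
  · obtain ⟨δ, hδ, hball⟩ := Metric.nhds_basis_closedBall.mem_iff.1 (Filter.inter_mem hU hc)
    have hm : ∀ w ∈ closedBall (0 : ℂ) δ, z₀ + w ∈ closedBall z₀ δ := by simp
    refine ⟨![1, -1, Complex.I], fun w => z₀ + w, δ, ?_, ?_, hδ, by fun_prop,
      (add_right_injective z₀).injOn, fun w hw => (hball (hm w hw)).1, fun j t ht => ?_⟩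
    · intro i j hij
      fin_cases i <;> fin_cases j <;> simp [Complex.ext_iff] at hij ⊢ <;> norm_num at hij
    · intro j
      fin_cases j <;> simp
    · have hj : ‖(![1, -1, Complex.I] : Fin 3 → ℂ) j‖ = 1 := by fin_cases j <;> simp
      have h1 := (hball (hm (t * (![1, -1, Complex.I] : Fin 3 → ℂ) j) (by
        rw [mem_closedBall_zero_iff, norm_mul, hj, mul_one, Complex.norm_real,
          Real.norm_of_nonneg ht.1]
        exact ht.2))).2
      exact congrArg Complex.re (h1.trans (congrArg h (add_zero z₀).symm))
  · obtain ⟨n, σ, δ, hn, hδ, h1, h2, h3, h4, h5, h6⟩ := exists_local_pow_of_analyticAt hh hc hU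
    have hn2 : 2 ≤ n := by
      have : n ≠ 1 := fun h => h6 h hd
      omega
    have hn0 : (0 : ℝ) < n := by positivity
    have hpi := Real.pi_pos
    set θ : Fin 3 → ℝ := fun j => (2 * (j : ℕ) + 1) * Real.pi / (2 * n) with hθ
    refine ⟨fun j => Complex.exp (θ j * Complex.I), σ, δ, ?_, fun j => Complex.norm_exp_ofReal_mul_I _,
      hδ, h1, h2, h3, fun j t ht => ?_⟩
    · have hθm : ∀ j, θ j ∈ Ico 0 (2 * Real.pi) := by
        intro j
        have hj : ((j : ℕ) : ℝ) ≤ 2 := by exact_mod_cast Nat.le_of_lt_succ j.2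
        have hn2' : (2 : ℝ) ≤ n := by exact_mod_cast hn2
        refine ⟨by positivity, ?_⟩
        rw [hθ]
        simp only
        rw [div_lt_iff₀ (by positivity)]
        nlinarith
      intro i j hij
      have h7 : θ i = θ j := by
        refine injOn_circleMap_of_abs_sub_le' (c := 0) (R := 1) one_ne_zero (a := 0)
          (b := 2 * Real.pi) (by simp) (hθm i) (hθm j) ?_
        simpa [circleMap] using hij
      rw [hθ] at h7
      simp only at h7
      rw [div_left_inj' (by positivity), mul_left_inj' hpi.ne'] at h7
      have : ((i : ℕ) : ℝ) = (j : ℕ) := by linarith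
      exact Fin.ext (by exact_mod_cast this)
    · have hm : (t : ℂ) * Complex.exp (θ j * Complex.I) ∈ closedBall (0 : ℂ) δ := by
        rw [mem_closedBall_zero_iff, norm_mul, Complex.norm_exp_ofReal_mul_I, mul_one,
          Complex.norm_real, Real.norm_of_nonneg ht.1]
        exact ht.2
      rw [h5 _ hm, h4, mul_pow, ← Complex.exp_nat_mul]
      have e1 : (n : ℂ) * (θ j * Complex.I) = ((2 * (j : ℕ) + 1) * Real.pi / 2 : ℝ) * Complex.I := by
        rw [hθ]
        push_cast
        field_simp
      have e2 : Real.cos ((2 * (j : ℕ) + 1) * Real.pi / 2) = 0 :=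
        Real.cos_eq_zero_iff.2 ⟨(j : ℕ), by push_cast; rfl⟩
      rw [e1, ← Complex.ofReal_pow, Complex.add_re, Complex.re_ofReal_mul,
        Complex.exp_ofReal_mul_I_re, e2, mul_zero, add_zero]

theorem exists_eq_of_mul_pos {u v : ℝ → ℝ} {δ : ℝ} (hδ : 0 ≤ δ) (hu : ContinuousOn u (Icc 0 δ))
    (hv : ContinuousOn v (Icc 0 δ)) (h0 : u 0 = v 0) (hpos : 0 < (u δ - u 0) * (v δ - u 0)) :
    ∃ s ∈ Ioc 0 δ, ∃ t ∈ Ioc 0 δ, u s = v t := by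
  wlog h : 0 < u δ - u 0 generalizing u v
  · obtain ⟨s, hs, t, ht, hst⟩ := this (u := fun x => -u x) (v := fun x => -v x) hu.neg hv.neg
      (by rw [h0]) (by nlinarith) (by
        by_contra h'
        have : u δ - u 0 = 0 := by linarith
        simp [this] at hpos)
    exact ⟨s, hs, t, ht, neg_injective hst⟩
  have h' : 0 < v δ - u 0 := (pos_iff_pos_of_mul_pos hpos).1 h
  set m := min (u δ) (v δ) with hm
  have hm0 : u 0 < m := lt_min (by linarith) (by linarith)
  obtain ⟨s, hs, hsm⟩ := intermediate_value_Icc hδ hu ⟨hm0.le, min_le_left _ _⟩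
  obtain ⟨t, ht, htm⟩ := intermediate_value_Icc hδ hv ⟨by rw [← h0]; exact hm0.le, min_le_right _ _⟩
  refine ⟨s, ⟨hs.1.lt_of_ne ?_, hs.2⟩, t, ⟨ht.1.lt_of_ne ?_, ht.2⟩, hsm.trans htm.symm⟩
  · rintro rfl
    exact hm0.ne hsm
  · rintro rfl
    rw [← h0] at htm
    exact hm0.ne htm

/-- **Lewy's theorem**: the Jacobian of an injective planar harmonic map does not vanish. -/
theorem norm_deriv_ne_of_injOn {f g : ℂ → ℂ} {z₀ : ℂ} (hf : AnalyticAt ℂ f z₀)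
    (hg : AnalyticAt ℂ g z₀) {U : Set ℂ} (hU : U ∈ 𝓝 z₀)
    (hcont : ContinuousOn (fun z => f z + starRingEnd ℂ (g z)) U)
    (hinj : InjOn (fun z => f z + starRingEnd ℂ (g z)) U) :
    ‖deriv g z₀‖ ≠ ‖deriv f z₀‖ := by
  intro heq
  obtain ⟨ω, hω, hω0⟩ : ∃ ω : ℂ, ω ≠ 0 ∧ ω * deriv f z₀ + starRingEnd ℂ ω * deriv g z₀ = 0 := by
    by_cases hf0 : deriv f z₀ = 0
    · refine ⟨1, one_ne_zero, ?_⟩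
      rw [hf0, norm_zero, norm_eq_zero] at heq
      rw [hf0, heq]; simp
    · obtain ⟨ω, hω⟩ := IsAlgClosed.exists_pow_nat_eq (-(deriv g z₀ / deriv f z₀)) two_pos
      have hn : ‖ω‖ = 1 := by
        have := congrArg norm hω
        rw [norm_pow, norm_neg, norm_div, heq, div_self (norm_ne_zero_iff.2 hf0)] at this
        exact (pow_eq_one_iff_of_nonneg (norm_nonneg _) two_ne_zero).1 this
      have h0 : ω ≠ 0 := by rw [← norm_ne_zero_iff, hn]; exact one_ne_zero
      refine ⟨ω, h0, ?_⟩
      have hg' : deriv g z₀ = -(ω ^ 2 * deriv f z₀) := by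
        rw [hω]; field_simp
      have hconj : starRingEnd ℂ ω * ω = 1 := by
        rw [Complex.conj_mul', hn]; simp
      rw [hg']
      linear_combination (-ω * deriv f z₀) * hconj
  set h : ℂ → ℂ := fun z => ω * f z + starRingEnd ℂ ω * g z with hh
  have hha : AnalyticAt ℂ h z₀ := (analyticAt_const.mul hf).add (analyticAt_const.mul hg)
  have hhd : deriv h z₀ = 0 := by
    rw [← hω0]
    exact ((hf.differentiableAt.hasDerivAt.const_mul ω).add
      (hg.differentiableAt.hasDerivAt.const_mul _)).deriv
  obtain ⟨d, σ, δ, hd, hd1, hδ, hσc, hσi, hσU, hre⟩ := exists_three_rays hha hhd hU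
  set Φ : ℂ → ℂ := fun z => ω * (f z + starRingEnd ℂ (g z)) with hΦ
  have hΦre : ∀ z, (Φ z).re = (h z).re := by
    intro z
    simp [hΦ, hh]
    ring
  have hΦi : InjOn Φ U := fun x hx y hy hxy => hinj hx hy (mul_left_cancel₀ hω hxy)
  have hΦc : ContinuousOn Φ U := continuousOn_const.mul hcont
  have hmem : ∀ j, ∀ t ∈ Icc 0 δ, (t : ℂ) * d j ∈ closedBall (0 : ℂ) δ := by
    intro j t ht
    rw [mem_closedBall_zero_iff, norm_mul, hd1, mul_one, Complex.norm_real,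
      Real.norm_of_nonneg ht.1]
    exact ht.2
  set u : Fin 3 → ℝ → ℝ := fun j t => (Φ (σ (t * d j))).im with hu
  have huc : ∀ j, ContinuousOn (u j) (Icc 0 δ) := by
    intro j
    refine Complex.continuous_im.comp_continuousOn (hΦc.comp (hσc.comp ?_ (hmem j)) ?_)
    · fun_prop
    · exact fun t ht => hσU (hmem j t ht)
  have hueq : ∀ i j, ∀ s ∈ Icc 0 δ, ∀ t ∈ Icc 0 δ, u i s = u j t → (s : ℂ) * d i = t * d j := by
    intro i j s hs t ht hst
    refine hσi (hmem i s hs) (hmem j t ht) (hΦi (hσU (hmem i s hs)) (hσU (hmem j t ht)) ?_)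
    refine Complex.ext ?_ hst
    rw [hΦre, hΦre, hre i s hs, hre j t ht]
  have hδm : δ ∈ Icc 0 δ := right_mem_Icc.2 hδ.le
  have h0m : (0 : ℝ) ∈ Icc 0 δ := left_mem_Icc.2 hδ.le
  have hdne : ∀ j, d j ≠ 0 := fun j => by rw [← norm_ne_zero_iff, hd1]; exact one_ne_zero
  have hu0 : ∀ i j, u i 0 = u j 0 := by simp [hu]
  have hune : ∀ j, u j δ - u j 0 ≠ 0 := by
    intro j hj
    have := hueq j j δ hδm 0 h0m (sub_eq_zero.1 hj)
    simp [hδ.ne', hdne] at this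
  obtain ⟨i, j, hij, hpos⟩ : ∃ i j, i ≠ j ∧ 0 < (u i δ - u i 0) * (u j δ - u i 0) := by
    have h01 := hu0 0 1
    have h02 := hu0 0 2
    have a0 := hune 0
    have a1 := hune 1
    have a2 := hune 2
    rw [← h01] at a1
    rw [← h02] at a2
    by_contra! hcon
    have b1 := hcon 0 1 (by decide)
    have b2 := hcon 0 2 (by decide)
    have b3 := hcon 1 2 (by decide)
    rw [← h01] at b3
    rcases a0.lt_or_gt with c0 | c0 <;> rcases a1.lt_or_gt with c1 | c1 <;>
      rcases a2.lt_or_gt with c2 | c2 <;> nlinarith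
  obtain ⟨s, hs, t, ht, hst⟩ := exists_eq_of_mul_pos hδ.le (huc i) (huc j) (hu0 i j) hpos
  have h1 := hueq i j s (Ioc_subset_Icc_self hs) t (Ioc_subset_Icc_self ht) hst
  have h2 := congrArg norm h1
  rw [norm_mul, norm_mul, hd1, hd1, mul_one, mul_one, Complex.norm_real, Complex.norm_real,
    Real.norm_of_nonneg hs.1.le, Real.norm_of_nonneg ht.1.le] at h2
  rw [h2] at h1
  exact hij (hd (mul_left_cancel₀ (by exact_mod_cast ht.1.ne') h1))

theorem exists_re_eq_of_lap2_eq_zero {u : ℂ → ℝ} (hu : ContDiffOn ℝ 2 u (ball 0 1))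
    (hlap : ∀ z ∈ ball (0 : ℂ) 1, lap2 u z = 0) :
    ∃ F : ℂ → ℂ, DifferentiableOn ℂ F (ball 0 1) ∧ ∀ z ∈ ball (0 : ℂ) 1, (F z).re = u z := by
  have hharm : InnerProductSpace.HarmonicOnNhd u (ball 0 1) := by
    intro z hz
    refine ⟨hu.contDiffAt (isOpen_ball.mem_nhds hz), ?_⟩
    filter_upwards [isOpen_ball.mem_nhds hz] with w hw
    have hd : DifferentiableAt ℝ (fderiv ℝ u) w :=
      ((hu.contDiffAt (isOpen_ball.mem_nhds hw)).fderiv_right (m := 1) (by norm_num)).differentiableAt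
        one_ne_zero
    have key : ∀ v : ℂ, fderiv ℝ (fun x => fderiv ℝ u x v) w v = fderiv ℝ (fderiv ℝ u) w v v := by
      intro v
      rw [fderiv_clm_apply hd (differentiableAt_const v)]
      simp
    have := hlap w hw
    rw [lap2, key, key] at this
    rw [InnerProductSpace.laplacian_eq_iteratedFDeriv_complexPlane]
    simpa [iteratedFDeriv_two_apply] using this
  obtain ⟨F, hF, hre⟩ := hharm.exists_analyticOnNhd_ball_re_eq
  exact ⟨F, hF.differentiableOn, fun z hz => hre hz⟩

theorem HarmonicOn2.exists_holomorphic {φ : ℂ → ℂ} (hh : HarmonicOn2 φ (ball 0 1))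
    (hφ : ContDiffOn ℝ 2 φ (ball 0 1)) :
    ∃ f g : ℂ → ℂ, DifferentiableOn ℂ f (ball 0 1) ∧ DifferentiableOn ℂ g (ball 0 1) ∧
      ∀ z ∈ ball (0 : ℂ) 1, φ z = f z + starRingEnd ℂ (g z) := by
  obtain ⟨F, hF, hFre⟩ := exists_re_eq_of_lap2_eq_zero
    (Complex.reCLM.contDiff.comp_contDiffOn hφ) fun z hz => (hh z hz).1
  obtain ⟨G, hG, hGre⟩ := exists_re_eq_of_lap2_eq_zero
    (Complex.imCLM.contDiff.comp_contDiffOn hφ) fun z hz => (hh z hz).2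
  refine ⟨fun z => (F z + Complex.I * G z) / 2, fun z => (F z - Complex.I * G z) / 2,
    (hF.add (hG.const_mul _)).div_const _, (hF.sub (hG.const_mul _)).div_const _, fun z hz => ?_⟩
  have h1 := hFre z hz
  have h2 := hGre z hz
  simp only [Function.comp_apply, Complex.reCLM_apply, Complex.imCLM_apply] at h1 h2
  refine Complex.ext ?_ ?_
  · rw [← h1, Complex.add_re, Complex.conj_re]; simp; ring
  · rw [← h2, Complex.add_im, Complex.conj_im]; simp; ring

theorem exists_injOn_ring {φ : ℂ → ℂ} (hc : ContinuousOn φ (closedBall 0 1))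
    (hinj : InjOn φ (sphere 0 1))
    (hloc : ∀ z ∈ sphere (0 : ℂ) 1, ∃ U ∈ 𝓝[closedBall 0 1] z, InjOn φ U) :
    ∃ ρ, 0 < ρ ∧ ρ < 1 ∧ InjOn φ (closedBall 0 1 \ ball 0 ρ) := by
  let X := closedBall (0 : ℂ) 1
  have : CompactSpace X := isCompact_iff_compactSpace.1 (isCompact_closedBall _ _)
  have hcX : Continuous (X.domRestrict φ) := continuousOn_iff_continuous_domRestrict.1 hc
  have hs : IsClosed {x : X | ‖(x : ℂ)‖ = 1} := isClosed_eq (by fun_prop) continuous_const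
  obtain ⟨t, ht, hti⟩ := Set.InjOn.exists_mem_nhdsSet (f := X.domRestrict φ)
    (s := {x : X | ‖(x : ℂ)‖ = 1})
    (fun x hx y hy hxy => Subtype.ext (hinj (by simpa using hx) (by simpa using hy) hxy))
    hs.isCompact (fun x _ => hcX.continuousAt) fun x hx => by
      obtain ⟨U, hU, hUi⟩ := hloc x (by simpa using hx)
      refine ⟨Subtype.val ⁻¹' U, mem_nhds_subtype_iff_nhdsWithin.2 ?_, fun a ha b hb hab =>
        Subtype.ext (hUi ha hb hab)⟩
      filter_upwards [hU, self_mem_nhdsWithin] with z hz hzX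
      exact ⟨⟨z, hzX⟩, hz, rfl⟩
  obtain ⟨V, hV, hsV, hVt⟩ := mem_nhdsSet_iff_exists.1 ht
  obtain ⟨ρ, h0, h1, hρ⟩ : ∃ ρ : ℝ, 0 < ρ ∧ ρ < 1 ∧ ∀ x : X, ρ ≤ ‖(x : ℂ)‖ → x ∈ V := by
    rcases (Vᶜ).eq_empty_or_nonempty with he | hne
    · refine ⟨1 / 2, by norm_num, by norm_num, fun x _ => ?_⟩
      rw [compl_empty_iff.1 he]; trivial
    · obtain ⟨x, hx, hmax⟩ := hV.isClosed_compl.isCompact.exists_isMaxOn hne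
        (f := fun x : X => ‖(x : ℂ)‖) (by fun_prop)
      have hx1 : ‖(x : ℂ)‖ < 1 :=
        (mem_closedBall_zero_iff.1 x.2).lt_of_ne fun h => hx (hsV h)
      refine ⟨(1 + ‖(x : ℂ)‖) / 2, by positivity, by linarith, fun y hy => ?_⟩
      by_contra hyV
      have : ‖(y : ℂ)‖ ≤ ‖(x : ℂ)‖ := hmax hyV
      linarith
  refine ⟨ρ, h0, h1, fun a ha b hb hab => ?_⟩
  have := hti (hVt (hρ ⟨a, ha.1⟩ (by simpa using ha.2))) (hVt (hρ ⟨b, hb.1⟩ (by simpa using hb.2))) hab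
  exact congrArg Subtype.val this

theorem isPreconnected_ball_diff_closedBall {ρ : ℝ} (hρ : 0 ≤ ρ) :
    IsPreconnected (ball (0 : ℂ) 1 \ closedBall 0 ρ) := by
  have : ball (0 : ℂ) 1 \ closedBall 0 ρ =
      (fun p : ℝ × ℝ => circleMap 0 p.1 p.2) '' (Ioo ρ 1 ×ˢ univ) := by
    ext z
    simp only [Set.mem_sdiff, mem_ball_zero_iff, mem_closedBall_zero_iff, not_le, mem_image,
      mem_prod, mem_univ, and_true, mem_Ioo, Prod.exists]
    constructor
    · exact fun h => ⟨‖z‖, z.arg, ⟨h.2, h.1⟩, by simp [circleMap, Complex.norm_mul_exp_arg_mul_I]⟩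
    · rintro ⟨r, s, ⟨h1, h2⟩, rfl⟩
      rw [norm_circleMap_zero, abs_of_pos (hρ.trans_lt h1)]
      exact ⟨h2, h1⟩
  rw [this]
  exact (isPreconnected_Ioo.prod isPreconnected_univ).image _
    (by unfold circleMap; fun_prop)

theorem injOn_closedBall_of_injOn_ring {f g φ : ℂ → ℂ} {ρ : ℝ} (hρ : 0 < ρ) (hρ1 : ρ < 1)
    (hf : DifferentiableOn ℂ f (ball 0 1)) (hg : DifferentiableOn ℂ g (ball 0 1))
    (heq : ∀ z ∈ ball (0 : ℂ) 1, φ z = f z + starRingEnd ℂ (g z))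
    (hc : ContinuousOn φ (closedBall 0 1)) (hinj : InjOn φ (closedBall 0 1 \ ball 0 ρ)) :
    InjOn φ (closedBall 0 1) := by
  set A := ball (0 : ℂ) 1 \ closedBall 0 ρ with hA
  have hAo : IsOpen A := isOpen_ball.sdiff isClosed_closedBall
  have hAs : A ⊆ closedBall (0 : ℂ) 1 \ ball 0 ρ := fun z hz =>
    ⟨ball_subset_closedBall hz.1, fun h => hz.2 (ball_subset_closedBall h)⟩
  have hne : ∀ z ∈ A, ‖deriv g z‖ ≠ ‖deriv f z‖ := by
    intro z hz
    have hφA : EqOn φ (fun z => f z + starRingEnd ℂ (g z)) A := fun w hw => heq w hw.1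
    exact norm_deriv_ne_of_injOn (hf.analyticAt (isOpen_ball.mem_nhds hz.1))
      (hg.analyticAt (isOpen_ball.mem_nhds hz.1)) (hAo.mem_nhds hz)
      ((hc.mono fun w hw => (hAs hw).1).congr hφA.symm) ((hinj.mono hAs).congr hφA)
  by_cases hor : ∀ z ∈ A, ‖deriv g z‖ < ‖deriv f z‖
  · exact HarmonicRing.injOn_closedBall ⟨hρ, hρ1, hf, hg, heq, hc, hinj, hor⟩
  push Not at hor
  obtain ⟨a, ha, hale⟩ := hor
  have hor' : ∀ z ∈ A, ‖deriv f z‖ < ‖deriv g z‖ := by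
    intro z hz
    by_contra! hz'
    obtain ⟨w, hw, hw0⟩ := (isPreconnected_ball_diff_closedBall hρ.le).intermediate_value hz ha
      (f := fun z => ‖deriv g z‖ - ‖deriv f z‖)
      ((((hg.deriv isOpen_ball).continuousOn.mono sdiff_subset).norm).sub
        ((hf.deriv isOpen_ball).continuousOn.mono sdiff_subset).norm)
      ⟨sub_nonpos.2 hz', sub_nonneg.2 hale⟩
    exact hne w hw (sub_eq_zero.1 hw0)
  have hconj : Function.Injective (starRingEnd ℂ) := (starRingEnd ℂ).injective
  have := HarmonicRing.injOn_closedBall (f := g) (g := f) (φ := fun z => starRingEnd ℂ (φ z))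
    ⟨hρ, hρ1, hg, hf, fun z hz => by simp [heq z hz, add_comm],
      Complex.continuous_conj.comp_continuousOn hc, hconj.injOn.comp hinj (mapsTo_univ _ _), hor'⟩
  exact fun x hx y hy hxy => this hx hy (congrArg (starRingEnd ℂ) hxy)

/-- A compact disc in the plane contains every bounded region whose frontier it contains. -/
theorem subset_image_closedBall {φ : ℂ → ℂ} (hc : ContinuousOn φ (closedBall 0 1))
    (hinj : InjOn φ (closedBall 0 1)) {Ω : Set ℂ} (hΩo : IsOpen Ω) (hΩb : Bornology.IsBounded Ω)
    (hfr : frontier Ω ⊆ φ '' closedBall 0 1) : Ω ⊆ φ '' closedBall 0 1 := by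
  by_contra hcon
  obtain ⟨p, hpΩ, hpD⟩ := Set.not_subset.1 hcon
  set D := φ '' closedBall 0 1 with hD
  have hDc : IsClosed D := ((isCompact_closedBall _ _).image_of_continuousOn hc).isClosed
  set Ω' := Ω \ D with hΩ'
  have hΩ'o : IsOpen Ω' := hΩo.sdiff hDc
  have hfr' : frontier Ω' ⊆ D := by
    intro x hx
    rw [hΩ'o.frontier_eq] at hx
    by_contra hxD
    have hxΩ : x ∉ Ω := fun h => hx.2 ⟨h, hxD⟩
    refine hxD (hfr ?_)
    rw [hΩo.frontier_eq]
    exact ⟨closure_mono sdiff_subset hx.1, hxΩ⟩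
  have hsmul : ∀ t ∈ Icc (0 : ℝ) 1, ∀ z ∈ closedBall (0 : ℂ) 1, t • z ∈ closedBall (0 : ℂ) 1 := by
    intro t ht z hz
    rw [mem_closedBall_zero_iff] at hz ⊢
    rw [norm_smul, Real.norm_of_nonneg ht.1]
    exact mul_le_one₀ ht.2 (norm_nonneg _) hz
  have hne : ∀ z ∈ closedBall (0 : ℂ) 1, φ z - p ≠ 0 := fun z hz h =>
    hpD ⟨z, hz, sub_eq_zero.1 h⟩
  obtain ⟨k, hk, hkexp, -⟩ := exists_log_homotopy (isCompact_closedBall (0 : ℂ) 1)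
    (H := fun t z => φ (t • z) - p)
    ((hc.comp (by fun_prop) fun q hq => hsmul _ hq.1 _ hq.2).sub continuousOn_const)
    fun t ht z hz => hne _ (hsmul t ht z hz)
  let X := closedBall (0 : ℂ) 1
  have : CompactSpace X := isCompact_iff_compactSpace.1 (isCompact_closedBall _ _)
  have hemb : Topology.IsClosedEmbedding (X.domRestrict φ) :=
    (continuousOn_iff_continuous_domRestrict.1 hc).isClosedEmbedding (injOn_iff_injective.1 hinj)
  obtain ⟨ℓ, hℓ⟩ := ContinuousMap.exists_extension hemb
    (⟨X.domRestrict fun z => Complex.log (φ 0 - p) + k z,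
      continuousOn_iff_continuous_domRestrict.1 (continuousOn_const.add hk)⟩ : C(X, ℂ))
  have hℓexp : ∀ w ∈ D, Complex.exp (ℓ w) = w - p := by
    rintro _ ⟨z, hz, rfl⟩
    have h1 : ℓ (φ z) = Complex.log (φ 0 - p) + k z := DFunLike.congr_fun hℓ ⟨z, hz⟩
    have h2 := hkexp z hz
    simp only [one_smul, zero_smul] at h2
    rw [h1, Complex.exp_add, Complex.exp_log (hne 0 (by simp)), h2]
  classical
  set Φ : ℂ → ℂ := (closure Ω').piecewise (fun w => Complex.exp (ℓ w)) fun w => w - p with hΦ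
  have hΦc : Continuous Φ := by
    refine Continuous.piecewise (fun w hw => hℓexp w (hfr' (frontier_closure_subset hw)))
      (by fun_prop) (by fun_prop)
  have hΦne : ∀ w, Φ w ≠ 0 := by
    intro w
    by_cases hw : w ∈ closure Ω'
    · rw [hΦ, Set.piecewise_eq_of_mem _ _ _ hw]
      exact Complex.exp_ne_zero _
    · rw [hΦ, Set.piecewise_eq_of_notMem _ _ _ hw, sub_ne_zero]
      rintro rfl
      exact hw (subset_closure ⟨hpΩ, hpD⟩)
  obtain ⟨R, hR⟩ := hΩb.subset_ball 0
  obtain ⟨R', hRR⟩ := exists_gt (max R 0)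
  have hR' : R < R' := (le_max_left _ _).trans_lt hRR
  have hR0 : 0 < R' := (le_max_right _ _).trans_lt hRR
  have hpR : ‖p‖ < R' := (mem_ball_zero_iff.1 (hR hpΩ)).trans hR'
  have h0 := HasWinding.of_closedBall hR0.le hΦc.continuousOn fun w _ => hΦne w
  have h1 := (HasWinding.circleMap_sub hpR).congr (c' := fun s => Φ (circleMap 0 R' s)) fun s _ => by
    rw [hΦ, Set.piecewise_eq_of_notMem]
    intro hmem
    have := closure_ball_subset_closedBall (closure_mono (sdiff_subset.trans hR) hmem)
    rw [mem_closedBall_zero_iff, norm_circleMap_zero, abs_of_pos hR0] at this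
    exact this.not_gt hR'
  exact zero_ne_one (h0.unique h1)

theorem bijOn_closure_of_injOn {φ : ℂ → ℂ} (hc : ContinuousOn φ (closedBall 0 1))
    (hinj : InjOn φ (closedBall 0 1)) {Ω : Set ℂ} (hΩo : IsOpen Ω) (hΩb : Bornology.IsBounded Ω)
    (hfr : φ '' sphere 0 1 = frontier Ω) : BijOn φ (closedBall 0 1) (closure Ω) := by
  have hsub : frontier Ω ⊆ φ '' closedBall 0 1 := by
    rw [← hfr]; exact image_mono sphere_subset_closedBall
  have hΩD := subset_image_closedBall hc hinj hΩo hΩb hsub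
  have hball : ∀ z ∈ ball (0 : ℂ) 1, φ z ∉ frontier Ω := by
    intro z hz hzf
    rw [← hfr] at hzf
    obtain ⟨w, hw, hwz⟩ := hzf
    have := hinj (sphere_subset_closedBall hw) (ball_subset_closedBall hz) hwz
    rw [this, mem_sphere_zero_iff_norm] at hw
    rw [mem_ball_zero_iff, hw] at hz
    exact hz.false
  have hne : (φ '' ball 0 1 ∩ Ω).Nonempty := by
    have h1 : φ 1 ∈ closure Ω := frontier_subset_closure (hfr ▸ mem_image_of_mem φ (by simp))
    obtain ⟨p, hp⟩ := closure_nonempty_iff.1 ⟨_, h1⟩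
    obtain ⟨z, hz, rfl⟩ := hΩD hp
    refine ⟨φ z, ⟨z, ?_, rfl⟩, hp⟩
    refine mem_ball_zero_iff.2 ((mem_closedBall_zero_iff.1 hz).lt_of_ne fun h => ?_)
    have : φ z ∈ frontier Ω := hfr ▸ mem_image_of_mem φ (by simpa using h)
    rw [hΩo.frontier_eq] at this
    exact this.2 hp
  have hin : φ '' ball 0 1 ⊆ Ω := by
    refine (((convex_ball (0 : ℂ) 1).isPreconnected.image φ
      (hc.mono ball_subset_closedBall))).subset_left_of_subset_union hΩo
      isClosed_closure.isOpen_compl (disjoint_compl_right.mono_left subset_closure) ?_ hne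
    rintro _ ⟨z, hz, rfl⟩
    by_contra hcon
    rw [mem_union, not_or, notMem_compl_iff] at hcon
    exact hball z hz (by rw [hΩo.frontier_eq]; exact ⟨hcon.2, hcon.1⟩)
  refine ⟨fun z hz => ?_, hinj, ?_⟩
  · rcases (mem_closedBall_zero_iff.1 hz).eq_or_lt with h | h
    · exact frontier_subset_closure (hfr ▸ mem_image_of_mem φ (by simpa using h))
    · exact subset_closure (hin (mem_image_of_mem φ (mem_ball_zero_iff.2 h)))
  · rw [closure_eq_self_union_frontier]
    exact union_subset hΩD hsub

/-- Alessandrini–Nesi, local-to-global; Theorem 5 of the paper. `γ` is a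
homeomorphism of the unit circle onto the simple closed curve `Γ = ∂Ω` enclosing the
bounded open set `Ω`, and `φ` is the harmonic extension of `γ` (continuous on `cl 𝔹`,
smooth — hence in particular in `W¹²_loc` — and componentwise harmonic in `𝔹`, equal to `γ`
on `∂𝔹`). Then `φ` is a homeomorphism of `cl 𝔹` onto `cl Ω` (equivalently, since `φ` is
continuous on the compact set `cl 𝔹`, a bijection onto `cl Ω`) if and only if every
boundary point `e^{iθ}` has a neighborhood in `cl 𝔹` on which `φ` is injective. -/
theorem alessandrini_nesi_local_to_global
    (Ω : Set ℂ) (γ : ℝ → ℂ) (φ : ℂ → ℂ)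
    (hΩo : IsOpen Ω) (hΩb : Bornology.IsBounded Ω)
    (hγc : Continuous γ) (hγper : ∀ θ, γ (θ + 2 * Real.pi) = γ θ)
    (hγinj : Set.InjOn γ (Set.Ico 0 (2 * Real.pi)))
    (hγrange : Set.range γ = frontier Ω)
    (hφcont : ContinuousOn φ (closedBall (0 : ℂ) 1))
    (hφC2 : ContDiffOn ℝ 2 φ (ball (0 : ℂ) 1))
    (hφharm : HarmonicOn2 φ (ball (0 : ℂ) 1))
    (hφbd : ∀ θ : ℝ, φ (cpt θ) = γ θ) :
    Set.BijOn φ (closedBall (0 : ℂ) 1) (closure Ω) ↔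
      ∀ θ : ℝ, ∃ U ∈ nhdsWithin (cpt θ) (closedBall (0 : ℂ) 1), Set.InjOn φ U := by
  have hcpt : ∀ θ, cpt θ = circleMap 0 1 θ := by simp [cpt, circleMap]
  have hcm : ∀ z ∈ sphere (0 : ℂ) 1, ∃ θ ∈ Ico 0 (2 * Real.pi), cpt θ = z := by
    intro z hz
    rw [← abs_one (α := ℝ), ← range_circleMap] at hz
    obtain ⟨s, rfl⟩ := hz
    obtain ⟨θ, hθ, he⟩ := (periodic_circleMap 0 1).exists_mem_Ico₀ Real.two_pi_pos s
    exact ⟨θ, hθ, (hcpt θ).trans he.symm⟩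
  have hsphere : ∀ θ, cpt θ ∈ sphere (0 : ℂ) 1 := fun θ => by simp [hcpt]
  constructor
  · exact fun h θ => ⟨closedBall 0 1, self_mem_nhdsWithin, h.injOn⟩
  · intro hloc
    have himg : φ '' sphere 0 1 = frontier Ω := by
      rw [← hγrange]
      refine Subset.antisymm ?_ ?_
      · rintro _ ⟨z, hz, rfl⟩
        obtain ⟨θ, -, rfl⟩ := hcm z hz
        exact ⟨θ, (hφbd θ).symm⟩
      · rintro _ ⟨θ, rfl⟩
        exact ⟨cpt θ, hsphere θ, hφbd θ⟩
    have hinjS : InjOn φ (sphere 0 1) := by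
      intro x hx y hy hxy
      obtain ⟨s, hs, rfl⟩ := hcm x hx
      obtain ⟨t, ht, rfl⟩ := hcm y hy
      rw [hφbd, hφbd] at hxy
      rw [hγinj hs ht hxy]
    obtain ⟨ρ, h0, h1, hinj⟩ := exists_injOn_ring hφcont hinjS fun z hz => by
      obtain ⟨θ, -, rfl⟩ := hcm z hz
      exact hloc θ
    obtain ⟨f, g, hf, hg, heq⟩ := hφharm.exists_holomorphic hφC2
    exact bijOn_closure_of_injOn hφcont
      (injOn_closedBall_of_injOn_ring h0 h1 hf hg heq hφcont hinj) hΩo hΩb himg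
end
end
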